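/- arXiv:1610.03654 — 9 statements merged into one kernel-verified Lean document; each statement's English description precedes it below -/
import Mathlib

section
/- Let p > 0 be a real number, let q ≥ 2 be an integer, and let φ : ℝ² → ℝ be a smooth compactly supported function. Then lim_{t→∞} t^{1/q} (log t)^{1/p} · J⁽¹⁾(t) = Γ(1/q + 1) · e^{iπ/(2q)} · φ(0,0). -/
open MeasureTheory Filter

/-- `J⁽¹⁾(t) = ∫₀^∞ ∫₀^{(log t)^{-1/p}} e^{i t (x₂^q + exp(-1/x₁^p))} φ(x₁,x₂) dx₁ dx₂`. -/
noncomputable def Jone (p : ℝ) (q : ℕ) (φ : ℝ × ℝ → ℝ) (t : ℝ) : ℂ :=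
  ∫ x₂ in Set.Ioi (0 : ℝ), ∫ x₁ in Set.Ioo (0 : ℝ) ((Real.log t) ^ (-(1 / p))),
    Complex.exp (Complex.I * (t : ℂ) *
        ((x₂ ^ q + Real.exp (-1 / x₁ ^ p) : ℝ) : ℂ)) * ((φ (x₁, x₂) : ℝ) : ℂ)

/-- The primitive `∫₀ˣ e^{i s^q} ds`. -/
noncomputable def oscPrimitive (q : ℕ) (x : ℝ) : ℂ :=
  ∫ s in (0 : ℝ)..x, Complex.exp (Complex.I * (s : ℂ) ^ q)

theorem hasDerivAt_oscPrimitive (q : ℕ) (x : ℝ) :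
    HasDerivAt (oscPrimitive q) (Complex.exp (Complex.I * (x : ℂ) ^ q)) x := by
  have hc : Continuous fun s : ℝ => Complex.exp (Complex.I * (s : ℂ) ^ q) := by fun_prop
  exact (hc.integral_hasStrictDerivAt 0 x).hasDerivAt

theorem continuous_oscPrimitive (q : ℕ) : Continuous (oscPrimitive q) :=
  continuous_iff_continuousAt.2 fun x => (hasDerivAt_oscPrimitive q x).continuousAt

theorem norm_exp_I_mul_ofReal_pow (q : ℕ) (x : ℝ) :
    ‖Complex.exp (Complex.I * (x : ℂ) ^ q)‖ = 1 := by
  rw [← Complex.ofReal_pow, mul_comm, Complex.norm_exp_ofReal_mul_I]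

theorem hasDerivAt_ofReal_pow (n : ℕ) (x : ℝ) :
    HasDerivAt (fun x : ℝ => (x : ℂ) ^ n) (n * (x : ℂ) ^ (n - 1)) x := by
  simpa using (hasDerivAt_pow n (x : ℂ)).comp_ofReal

theorem exists_tendsto_oscPrimitive {q : ℕ} (hq : 2 ≤ q) :
    ∃ E : ℂ, Tendsto (oscPrimitive q) atTop (nhds E) := by
  have hq0 : (q : ℂ) ≠ 0 := by exact_mod_cast (by omega : q ≠ 0)
  let e : ℝ → ℂ := fun x => Complex.exp (Complex.I * (x : ℂ) ^ q)
  let b : ℝ → ℂ := fun x => e x / (Complex.I * q * (x : ℂ) ^ (q - 1))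
  let d : ℝ → ℂ := fun x => ((q - 1 : ℕ) : ℂ) / (Complex.I * q) * (e x / (x : ℂ) ^ q)
  have hderiv : ∀ x ∈ Set.Ioi (1 : ℝ),
      HasDerivAt (fun x => oscPrimitive q x - b x) (d x) x := by
    intro x hx
    have hx0 : (x : ℂ) ≠ 0 := by
      exact_mod_cast (zero_lt_one.trans hx).ne'
    have he : HasDerivAt e (e x * (Complex.I * (q * (x : ℂ) ^ (q - 1)))) x :=
      ((hasDerivAt_ofReal_pow q x).const_mul Complex.I).cexp
    have hb := he.div ((hasDerivAt_ofReal_pow (q - 1) x).const_mul (Complex.I * q))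
      (mul_ne_zero (mul_ne_zero Complex.I_ne_zero hq0) (pow_ne_zero _ hx0))
    convert! (hasDerivAt_oscPrimitive q x).sub hb using 1
    obtain ⟨m, rfl⟩ : ∃ m, q = m + 2 := ⟨q - 2, by omega⟩
    simp only [d, e, Nat.add_sub_cancel, show m + 2 - 1 = m + 1 by omega]
    have := Complex.I_ne_zero
    field_simp
    ring
  have hint : IntegrableOn d (Set.Ioi 1) := by
    have hr : IntegrableOn (fun x : ℝ => x ^ (-(q : ℝ))) (Set.Ioi 1) :=
      integrableOn_Ioi_rpow_of_lt (by
        have : (2 : ℝ) ≤ q := by exact_mod_cast hq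
        linarith) zero_lt_one
    refine Integrable.const_mul ?_ _
    refine hr.mono' (Measurable.aestronglyMeasurable (by fun_prop)) ?_
    refine (ae_restrict_iff' measurableSet_Ioi).2 (ae_of_all _ fun x hx => ?_)
    have hx0 : 0 < x := zero_lt_one.trans hx
    simp only [e]
    rw [norm_div, norm_exp_I_mul_ofReal_pow, norm_pow, Complex.norm_real, Real.norm_of_nonneg hx0.le,
      Real.rpow_neg hx0.le, Real.rpow_natCast, one_div]
  have hb : Tendsto b atTop (nhds 0) := by
    rw [tendsto_zero_iff_norm_tendsto_zero]
    have : Tendsto (fun x : ℝ => ((q : ℝ) * x ^ (q - 1))⁻¹) atTop (nhds 0) := by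
      refine tendsto_inv_atTop_zero.comp (Tendsto.const_mul_atTop ?_ (tendsto_pow_atTop (by omega)))
      exact_mod_cast (by omega : 0 < q)
    refine this.congr' ?_
    filter_upwards [eventually_gt_atTop 0] with x hx
    simp only [b, e]
    rw [norm_div, norm_exp_I_mul_ofReal_pow]
    simp [abs_of_pos hx]
  have hlim := tendsto_limUnder_of_hasDerivAt_of_integrableOn_Ioi hderiv hint
  exact ⟨_, (hlim.add hb).congr fun x => by simp⟩

theorem exists_norm_oscPrimitive_le {q : ℕ} (hq : 2 ≤ q) :
    ∃ C : ℝ, ∀ x, 0 ≤ x → ‖oscPrimitive q x‖ ≤ C := by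
  obtain ⟨E, hE⟩ := exists_tendsto_oscPrimitive hq
  obtain ⟨X, hX⟩ := eventually_atTop.1 (hE.norm.eventually_le_const (lt_add_one ‖E‖))
  obtain ⟨C, hC⟩ := (isCompact_Icc (a := (0 : ℝ)) (b := X)).exists_bound_of_continuousOn
    (continuous_oscPrimitive q).continuousOn
  refine ⟨max C (‖E‖ + 1), fun x hx => ?_⟩
  rcases le_total x X with h | h
  · exact (hC x ⟨hx, h⟩).trans (le_max_left _ _)
  · exact (hX x h).trans (le_max_right _ _)

theorem rpow_mul_integral_exp_mul {q : ℕ} (hq : 2 ≤ q) {g g' : ℝ → ℂ} {t : ℝ} (ht : 0 < t)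
    (hg : ∀ x, HasDerivAt g (g' x) x) (hgi : IntegrableOn g (Set.Ioi 0))
    (hgi' : IntegrableOn g' (Set.Ioi 0)) (hg0 : Tendsto g atTop (nhds 0)) :
    ((t ^ (1 / (q : ℝ)) : ℝ) : ℂ) *
        ∫ x in Set.Ioi (0 : ℝ), Complex.exp (Complex.I * t * (x : ℂ) ^ q) * g x =
      -∫ x in Set.Ioi (0 : ℝ), oscPrimitive q (t ^ (1 / (q : ℝ)) * x) * g' x := by
  set c : ℝ := t ^ (1 / (q : ℝ)) with hc
  have hcpos : 0 < c := Real.rpow_pos_of_pos ht _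
  have hcq : c ^ q = t := by
    rw [hc, ← Real.rpow_natCast, ← Real.rpow_mul ht.le,
      one_div_mul_cancel (by exact_mod_cast (by omega : q ≠ 0)), Real.rpow_one]
  obtain ⟨C, hC⟩ := exists_norm_oscPrimitive_le hq
  obtain ⟨E, hE⟩ := exists_tendsto_oscPrimitive hq
  have hexp (x : ℝ) : Complex.exp (Complex.I * ((c * x : ℝ) : ℂ) ^ q) =
      Complex.exp (Complex.I * t * (x : ℂ) ^ q) := by
    rw [← hcq]; push_cast; ring_nf
  have hv : ∀ x ∈ Set.Ioi (0 : ℝ), HasDerivAt (fun x => oscPrimitive q (c * x))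
      (c * Complex.exp (Complex.I * t * (x : ℂ) ^ q)) x := by
    intro x _
    have := (hasDerivAt_oscPrimitive q (c * x)).scomp x ((hasDerivAt_id x).const_mul c)
    rw [hexp] at this
    simpa [Function.comp_def] using this
  have hcont : Continuous fun x : ℝ => oscPrimitive q (c * x) :=
    (continuous_oscPrimitive q).comp (by fun_prop)
  have key := integral_Ioi_mul_deriv_eq_deriv_mul (a := (0 : ℝ)) (a' := (0 : ℂ)) (b' := (0 : ℂ))
    (u := g) (u' := g') (fun x _ => hg x) hv ?_ ?_ ?_ ?_
  · rw [sub_zero, zero_sub] at key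
    rw [← integral_const_mul]
    convert! key using 2
    · ext x; ring
    · simp_rw [mul_comm]
  · refine Integrable.mul_bdd (c := c) hgi
      (Continuous.aestronglyMeasurable (by fun_prop)) (ae_of_all _ fun x => ?_)
    rw [← hexp, norm_mul, norm_exp_I_mul_ofReal_pow]
    simp [abs_of_pos hcpos]
  · refine Integrable.mul_bdd (c := C) hgi' hcont.aestronglyMeasurable ?_
    refine (ae_restrict_iff' measurableSet_Ioi).2 (ae_of_all _ fun x hx => ?_)
    exact hC _ (mul_nonneg hcpos.le (le_of_lt hx))
  · have : Tendsto (fun x => g x * oscPrimitive q (c * x)) (nhds 0)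
        (nhds (g 0 * oscPrimitive q (c * 0))) :=
      ((hg 0).continuousAt.mul hcont.continuousAt)
    have h0 : oscPrimitive q 0 = 0 := by simp [oscPrimitive]
    rw [mul_zero, h0, mul_zero] at this
    exact this.mono_left nhdsWithin_le_nhds
  · have := hg0.mul (hE.comp (tendsto_id.const_mul_atTop hcpos))
    rw [zero_mul] at this
    exact this

theorem tendsto_integral_oscPrimitive_mul {q : ℕ} (hq : 2 ≤ q) {E : ℂ}
    (hE : Tendsto (oscPrimitive q) atTop (nhds E)) {h : ℝ → ℝ → ℂ} {h₀ : ℝ → ℂ} {B : ℝ → ℝ}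
    (hmeas : ∀ t, AEStronglyMeasurable (h t) (volume.restrict (Set.Ioi 0)))
    (hB : IntegrableOn B (Set.Ioi 0)) (hle : ∀ t x, ‖h t x‖ ≤ B x)
    (hlim : ∀ x, Tendsto (fun t => h t x) atTop (nhds (h₀ x))) :
    Tendsto (fun t : ℝ => ∫ x in Set.Ioi (0 : ℝ), oscPrimitive q (t ^ (1 / (q : ℝ)) * x) * h t x)
      atTop (nhds (E * ∫ x in Set.Ioi (0 : ℝ), h₀ x)) := by
  obtain ⟨C, hC⟩ := exists_norm_oscPrimitive_le hq
  rw [← integral_const_mul]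
  refine tendsto_integral_filter_of_dominated_convergence (fun x => C * B x) ?_ ?_
    (hB.const_mul C) ?_
  · refine Eventually.of_forall fun t => AEStronglyMeasurable.mul ?_ (hmeas t)
    exact ((continuous_oscPrimitive q).comp (by fun_prop)).aestronglyMeasurable
  · filter_upwards [eventually_gt_atTop 0] with t ht
    refine (ae_restrict_iff' measurableSet_Ioi).2 (ae_of_all _ fun x hx => ?_)
    rw [norm_mul]
    have := hC _ (mul_nonneg (Real.rpow_nonneg ht.le (1 / (q : ℝ))) (le_of_lt hx))
    exact mul_le_mul this (hle t x) (norm_nonneg _) ((norm_nonneg _).trans this)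
  · refine (ae_restrict_iff' measurableSet_Ioi).2 (ae_of_all _ fun x hx => ?_)
    refine (hE.comp ?_).mul (hlim x)
    refine (tendsto_rpow_atTop ?_).atTop_mul_const hx
    have : (0 : ℝ) < q := by exact_mod_cast (by omega : 0 < q)
    positivity

theorem integrableOn_pow_mul_exp_neg_pow {q : ℕ} (hq : 2 ≤ q) (n : ℕ) :
    IntegrableOn (fun x : ℝ => x ^ n * Real.exp (-x ^ q)) (Set.Ioi 0) := by
  have h := integrableOn_rpow_mul_exp_neg_rpow (p := q) (s := n)
    (by have : (0 : ℝ) ≤ n := n.cast_nonneg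
        linarith) (by exact_mod_cast (by omega : 0 < q))
  simpa only [Real.rpow_natCast] using h

theorem norm_exp_neg_one_sub_I_mul (q : ℕ) (s x : ℝ) :
    ‖Complex.exp (-(1 - Complex.I * s) * (x : ℂ) ^ q)‖ = Real.exp (-x ^ q) := by
  rw [Complex.norm_exp, ← Complex.ofReal_pow]
  simp [-Complex.ofReal_pow]

theorem integrableOn_pow_mul_cexp {q : ℕ} (hq : 2 ≤ q) (n : ℕ) (s : ℝ) :
    IntegrableOn (fun x : ℝ => (x : ℂ) ^ n * Complex.exp (-(1 - Complex.I * s) * (x : ℂ) ^ q))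
      (Set.Ioi 0) := by
  refine (integrableOn_pow_mul_exp_neg_pow hq n).mono'
    (Continuous.aestronglyMeasurable (by fun_prop)) ?_
  refine (ae_restrict_iff' measurableSet_Ioi).2 (ae_of_all _ fun x hx => ?_)
  rw [norm_mul, norm_exp_neg_one_sub_I_mul, norm_pow, Complex.norm_real,
    Real.norm_of_nonneg (le_of_lt hx)]

theorem tendsto_mul_exp_neg_pow {q : ℕ} (hq : 2 ≤ q) :
    Tendsto (fun x : ℝ => x * Real.exp (-x ^ q)) atTop (nhds 0) := by
  have h := Real.tendsto_pow_mul_exp_neg_atTop_nhds_zero 1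
  refine tendsto_of_tendsto_of_tendsto_of_le_of_le' tendsto_const_nhds h ?_ ?_
  · filter_upwards [eventually_ge_atTop 0] with x hx
    positivity
  · filter_upwards [eventually_ge_atTop 1] with x hx
    rw [pow_one]
    gcongr
    exact le_self_pow₀ hx (by omega)

theorem mul_integral_pow_mul_cexp {q : ℕ} (hq : 2 ≤ q) (s : ℝ) :
    (1 - Complex.I * s) * q *
        ∫ x in Set.Ioi (0 : ℝ), (x : ℂ) ^ q * Complex.exp (-(1 - Complex.I * s) * (x : ℂ) ^ q) =
      ∫ x in Set.Ioi (0 : ℝ), Complex.exp (-(1 - Complex.I * s) * (x : ℂ) ^ q) := by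
  have hderiv : ∀ x ∈ Set.Ici (0 : ℝ), HasDerivAt
      (fun x : ℝ => (x : ℂ) * Complex.exp (-(1 - Complex.I * s) * (x : ℂ) ^ q))
      (Complex.exp (-(1 - Complex.I * s) * (x : ℂ) ^ q) - (1 - Complex.I * s) * q *
        ((x : ℂ) ^ q * Complex.exp (-(1 - Complex.I * s) * (x : ℂ) ^ q))) x := by
    intro x _
    have h1 : HasDerivAt (fun x : ℝ => (x : ℂ)) 1 x := (hasDerivAt_id x).ofReal_comp
    convert! h1.mul ((hasDerivAt_ofReal_pow q x).const_mul (-(1 - Complex.I * s))).cexp using 1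
    obtain ⟨m, rfl⟩ : ∃ m, q = m + 1 := ⟨q - 1, by omega⟩
    simp only [Nat.add_sub_cancel]
    ring
  have hi0 : IntegrableOn (fun x : ℝ => Complex.exp (-(1 - Complex.I * s) * (x : ℂ) ^ q))
      (Set.Ioi 0) := by
    simpa using integrableOn_pow_mul_cexp hq 0 s
  have hi := (integrableOn_pow_mul_cexp hq q s).const_mul ((1 - Complex.I * s) * q)
  have hlim : Tendsto (fun x : ℝ => (x : ℂ) * Complex.exp (-(1 - Complex.I * s) * (x : ℂ) ^ q))
      atTop (nhds 0) := by
    rw [tendsto_zero_iff_norm_tendsto_zero]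
    refine (tendsto_mul_exp_neg_pow hq).congr' ?_
    filter_upwards [eventually_ge_atTop 0] with x hx
    rw [norm_mul, norm_exp_neg_one_sub_I_mul, Complex.norm_real, Real.norm_of_nonneg hx]
  have key := integral_Ioi_of_hasDerivAt_of_tendsto' hderiv (hi0.sub hi) hlim
  rw [integral_sub hi0 hi, integral_const_mul] at key
  simp only [Complex.ofReal_zero, zero_mul, sub_zero] at key
  exact (sub_eq_zero.1 key).symm

theorem hasDerivAt_integral_cexp {q : ℕ} (hq : 2 ≤ q) (s : ℝ) :
    HasDerivAt
      (fun s : ℝ => ∫ x in Set.Ioi (0 : ℝ), Complex.exp (-(1 - Complex.I * s) * (x : ℂ) ^ q))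
      (Complex.I * ∫ x in Set.Ioi (0 : ℝ),
        (x : ℂ) ^ q * Complex.exp (-(1 - Complex.I * s) * (x : ℂ) ^ q)) s := by
  rw [← integral_const_mul]
  refine (hasDerivAt_integral_of_dominated_loc_of_deriv_le
    (F := fun (s x : ℝ) => Complex.exp (-(1 - Complex.I * s) * (x : ℂ) ^ q))
    (F' := fun (s x : ℝ) =>
      Complex.I * ((x : ℂ) ^ q * Complex.exp (-(1 - Complex.I * s) * (x : ℂ) ^ q)))
    (bound := fun x : ℝ => x ^ q * Real.exp (-x ^ q)) (s := Set.univ) univ_mem ?_ ?_ ?_ ?_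
    (integrableOn_pow_mul_exp_neg_pow hq q) ?_).2
  · exact Eventually.of_forall fun s => Continuous.aestronglyMeasurable (by fun_prop)
  · simpa using! integrableOn_pow_mul_cexp hq 0 s
  · exact Continuous.aestronglyMeasurable (by fun_prop)
  · refine (ae_restrict_iff' measurableSet_Ioi).2 (ae_of_all _ fun x hx s _ => ?_)
    rw [norm_mul, norm_mul, norm_exp_neg_one_sub_I_mul, norm_pow, Complex.norm_real,
      Real.norm_of_nonneg (le_of_lt hx), Complex.norm_I, one_mul]
  · refine ae_of_all _ fun x s _ => ?_
    have h1 : HasDerivAt (fun s : ℝ => (s : ℂ)) 1 s := (hasDerivAt_id s).ofReal_comp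
    convert! ((((h1.const_mul Complex.I).const_sub 1).fun_neg).mul_const ((x : ℂ) ^ q)).cexp using 1
    ring

theorem integral_cexp_neg_one_sub_I_mul_pow {q : ℕ} (hq : 2 ≤ q) (s : ℝ) :
    (∫ x in Set.Ioi (0 : ℝ), Complex.exp (-(1 - Complex.I * s) * (x : ℂ) ^ q)) *
      (1 - Complex.I * s) ^ (1 / (q : ℂ)) = (Real.Gamma (1 / (q : ℝ) + 1) : ℂ) := by
  have hq0 : (q : ℂ) ≠ 0 := by exact_mod_cast (by omega : q ≠ 0)
  have hslit (s : ℝ) : 1 - Complex.I * s ∈ Complex.slitPlane := Or.inl (by simp)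
  have hderiv (s : ℝ) : HasDerivAt (fun s : ℝ =>
      (∫ x in Set.Ioi (0 : ℝ), Complex.exp (-(1 - Complex.I * s) * (x : ℂ) ^ q)) *
        (1 - Complex.I * s) ^ (1 / (q : ℂ))) 0 s := by
    have h1 : HasDerivAt (fun s : ℝ => 1 - Complex.I * (s : ℂ)) (-Complex.I) s := by
      simpa using (((hasDerivAt_id s).ofReal_comp).const_mul Complex.I).const_sub 1
    have h2 := (hasDerivAt_integral_cexp hq s).mul (
      (((hasDerivAt_id (1 - Complex.I * (s : ℂ))).cpow_const (c := 1 / (q : ℂ)) (hslit s)).scomp s h1))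
    convert! h2 using 1
    have hne := Complex.slitPlane_ne_zero (hslit s)
    simp only [Function.comp, id, smul_eq_mul]
    rw [← mul_integral_pow_mul_cexp hq s, Complex.cpow_sub _ _ hne, Complex.cpow_one]
    field_simp
    ring_nf
  have hconst := is_const_of_deriv_eq_zero (fun s => (hderiv s).differentiableAt)
    (fun s => (hderiv s).deriv) s 0
  have h0 := integral_exp_neg_rpow (p := q) (by exact_mod_cast (by omega : 0 < q))
  refine hconst.trans ?_
  rw [← h0, ← integral_complex_ofReal]
  simp [Real.rpow_natCast]

theorem tendsto_rpow_mul_integral_cexp {q : ℕ} (hq : 2 ≤ q) :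
    Tendsto (fun t : ℝ => ((t ^ (1 / (q : ℝ)) : ℝ) : ℂ) *
        ∫ x in Set.Ioi (0 : ℝ), Complex.exp (-(1 - Complex.I * t) * (x : ℂ) ^ q)) atTop
      (nhds ((Real.Gamma (1 / (q : ℝ) + 1) : ℂ) *
        Complex.exp (((Real.pi / (2 * (q : ℝ)) : ℝ) : ℂ) * Complex.I))) := by
  have hlim : Tendsto (fun t : ℝ => (((t⁻¹ : ℝ) : ℂ) - Complex.I) ^ (-(1 / (q : ℂ)))) atTop
      (nhds ((-Complex.I) ^ (-(1 / (q : ℂ))))) := by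
    refine (continuousAt_cpow_const ?_).tendsto.comp ?_
    · exact Or.inr (by simp)
    · have := (Complex.continuous_ofReal.tendsto 0).comp tendsto_inv_atTop_zero
      simpa using! this.sub_const Complex.I
  have hI : (-Complex.I) ^ (-(1 / (q : ℂ))) =
      Complex.exp (((Real.pi / (2 * (q : ℝ)) : ℝ) : ℂ) * Complex.I) := by
    rw [Complex.cpow_def_of_ne_zero (neg_ne_zero.2 Complex.I_ne_zero), Complex.log_neg_I]
    congr 1
    push_cast
    field_simp
  rw [← hI]
  refine (hlim.const_mul _).congr' ?_
  filter_upwards [eventually_gt_atTop 0] with t ht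
  have htc : (t : ℂ) ≠ 0 := by exact_mod_cast ht.ne'
  have hne : ((t⁻¹ : ℝ) : ℂ) - Complex.I ≠ 0 := fun h => by
    have := congrArg Complex.im h
    simp at this
  have hsplit : (1 - Complex.I * t : ℂ) = (t : ℂ) * (((t⁻¹ : ℝ) : ℂ) - Complex.I) := by
    push_cast
    field_simp
  have hpow : (1 - Complex.I * t : ℂ) ^ (1 / (q : ℂ)) =
      ((t ^ (1 / (q : ℝ)) : ℝ) : ℂ) * (((t⁻¹ : ℝ) : ℂ) - Complex.I) ^ (1 / (q : ℂ)) := by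
    rw [hsplit, Complex.cpow_def_of_ne_zero (mul_ne_zero htc hne),
      Complex.log_ofReal_mul ht hne, add_mul, Complex.exp_add,
      ← Complex.cpow_def_of_ne_zero hne, Complex.ofReal_cpow ht.le,
      Complex.cpow_def_of_ne_zero htc, Complex.ofReal_log ht.le]
    push_cast
    rfl
  rw [← integral_cexp_neg_one_sub_I_mul_pow hq t, hpow, Complex.cpow_neg]
  have : (((t⁻¹ : ℝ) : ℂ) - Complex.I) ^ (1 / (q : ℂ)) ≠ 0 := by
    rw [Complex.cpow_def_of_ne_zero hne]
    exact Complex.exp_ne_zero _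
  generalize (((t⁻¹ : ℝ) : ℂ) - Complex.I) ^ (1 / (q : ℂ)) = w at this ⊢
  field_simp

theorem tendsto_oscPrimitive {q : ℕ} (hq : 2 ≤ q) :
    Tendsto (oscPrimitive q) atTop (nhds ((Real.Gamma (1 / (q : ℝ) + 1) : ℂ) *
        Complex.exp (((Real.pi / (2 * (q : ℝ)) : ℝ) : ℂ) * Complex.I))) := by
  obtain ⟨E, hE⟩ := exists_tendsto_oscPrimitive hq
  let g : ℝ → ℂ := fun x => Complex.exp (-(x : ℂ) ^ q)
  let g' : ℝ → ℂ := fun x => Complex.exp (-(x : ℂ) ^ q) * -(q * (x : ℂ) ^ (q - 1))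
  have hg (x : ℝ) : HasDerivAt g (g' x) x := (hasDerivAt_ofReal_pow q x).neg.cexp
  have hgi : IntegrableOn g (Set.Ioi 0) := by
    simpa using! integrableOn_pow_mul_cexp hq 0 0
  have hgi' : IntegrableOn g' (Set.Ioi 0) := by
    refine ((integrableOn_pow_mul_cexp hq (q - 1) 0).const_mul (-(q : ℂ))).congr
      (ae_of_all _ fun x => ?_)
    simp only [g', Complex.ofReal_zero, mul_zero, sub_zero, neg_one_mul]
    ring
  have hg0 : Tendsto g atTop (nhds 0) := by
    rw [tendsto_zero_iff_norm_tendsto_zero]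
    have h := Real.tendsto_exp_neg_atTop_nhds_zero.comp
      (tendsto_pow_atTop (α := ℝ) (n := q) (by omega))
    refine h.congr fun x => ?_
    simpa [g] using (norm_exp_neg_one_sub_I_mul q 0 x).symm
  have hint : ∫ x in Set.Ioi (0 : ℝ), g' x = -1 := by
    rw [integral_Ioi_of_hasDerivAt_of_tendsto' (fun x _ => hg x) hgi' hg0]
    simp [g, show q ≠ 0 by omega]
  have h1 := (tendsto_integral_oscPrimitive_mul hq hE (h := fun _ => g') (h₀ := g')
    (B := fun x => ‖g' x‖) (fun _ => hgi'.aestronglyMeasurable) hgi'.norm (fun _ _ => le_rfl)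
    (fun _ => tendsto_const_nhds)).neg
  rw [hint, mul_neg, mul_one, neg_neg] at h1
  have h2 := h1.congr' (by
    filter_upwards [eventually_gt_atTop 0] with t ht
    exact (rpow_mul_integral_exp_mul hq ht hg hgi hgi' hg0).symm)
  have h3 := tendsto_rpow_mul_integral_cexp hq
  have h4 := tendsto_nhds_unique (h2.congr fun t => by
    congr 2
    ext x
    rw [← Complex.exp_add]
    congr 1
    ring) h3
  rwa [← h4]

theorem setIntegral_Ioo_zero_eq_smul {L : ℝ} (hL : 0 < L) (G : ℝ → ℂ) :
    ∫ x in Set.Ioo 0 L, G x = L * ∫ y in Set.Ioo (0 : ℝ) 1, G (L * y) := by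
  rw [← integral_Ioc_eq_integral_Ioo, ← integral_Ioc_eq_integral_Ioo,
    ← intervalIntegral.integral_of_le hL.le, ← intervalIntegral.integral_of_le zero_le_one,
    intervalIntegral.integral_comp_mul_left _ hL.ne', mul_zero, mul_one, Complex.real_smul,
    Complex.ofReal_inv, mul_inv_cancel_left₀ (by exact_mod_cast hL.ne')]

theorem rpow_log_mul_Jone {p : ℝ} {q : ℕ} {φ : ℝ × ℝ → ℝ} (hφ : Continuous φ)
    (hφc : HasCompactSupport φ) {t : ℝ} (ht : 1 < t) :
    (((Real.log t) ^ (1 / p) : ℝ) : ℂ) * Jone p q φ t =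
      ∫ y in Set.Ioo (0 : ℝ) 1,
        Complex.exp (Complex.I *
          ((t * Real.exp (-1 / ((Real.log t) ^ (-(1 / p)) * y) ^ p) : ℝ) : ℂ)) *
        ∫ x in Set.Ioi (0 : ℝ), Complex.exp (Complex.I * t * (x : ℂ) ^ q) *
          (φ ((Real.log t) ^ (-(1 / p)) * y, x) : ℂ) := by
  have hlog : 0 < Real.log t := Real.log_pos ht
  have hL : 0 < (Real.log t) ^ (-(1 / p)) := Real.rpow_pos_of_pos hlog _
  rw [Jone, integral_integral_swap, setIntegral_Ioo_zero_eq_smul hL, ← mul_assoc,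
    ← Complex.ofReal_mul, ← Real.rpow_add hlog, add_neg_cancel, Real.rpow_zero,
    Complex.ofReal_one, one_mul]
  · congr 1
    ext y
    rw [← integral_const_mul]
    congr 1
    ext x
    rw [← mul_assoc, ← Complex.exp_add]
    congr 2
    push_cast
    ring
  · rw [Measure.prod_restrict]
    refine Integrable.integrableOn ?_
    have hi : Integrable (fun z : ℝ × ℝ => (φ z.swap : ℂ)) (volume.prod volume) :=
      ((hφ.integrable_of_hasCompactSupport hφc).swap).ofReal
    refine hi.bdd_mul (c := 1) (Measurable.aestronglyMeasurable (by fun_prop))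
      (ae_of_all _ fun z => ?_)
    rw [mul_assoc, ← Complex.ofReal_mul, mul_comm, Complex.norm_exp_ofReal_mul_I]

theorem tendsto_mul_exp_neg_one_div {p : ℝ} (hp : 0 < p) {y : ℝ} (hy : y ∈ Set.Ioo (0 : ℝ) 1) :
    Tendsto (fun t : ℝ => t * Real.exp (-1 / ((Real.log t) ^ (-(1 / p)) * y) ^ p)) atTop
      (nhds 0) := by
  have hyp : 0 < y ^ p := Real.rpow_pos_of_pos hy.1 p
  have hneg : 1 - 1 / y ^ p < 0 := by
    rw [sub_neg, lt_div_iff₀ hyp, one_mul]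
    exact Real.rpow_lt_one hy.1.le hy.2 hp
  have h := Real.tendsto_exp_atBot.comp (Real.tendsto_log_atTop.atTop_mul_const_of_neg hneg)
  refine h.congr' ?_
  filter_upwards [eventually_gt_atTop 1] with t ht
  have hlog : 0 < Real.log t := Real.log_pos ht
  have hpow : ((Real.log t) ^ (-(1 / p)) * y) ^ p = (Real.log t)⁻¹ * y ^ p := by
    rw [Real.mul_rpow (Real.rpow_nonneg hlog.le _) hy.1.le, ← Real.rpow_mul hlog.le,
      neg_mul, one_div_mul_cancel hp.ne', Real.rpow_neg_one]
  rw [hpow, Function.comp_apply]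
  nth_rw 2 [← Real.exp_log (zero_lt_one.trans ht)]
  rw [← Real.exp_add]
  congr 1
  field_simp
  ring

theorem tendsto_log_rpow_neg_mul {p : ℝ} (hp : 0 < p) (y : ℝ) :
    Tendsto (fun t : ℝ => (Real.log t) ^ (-(1 / p)) * y) atTop (nhds 0) := by
  simpa using! ((tendsto_rpow_neg_atTop (one_div_pos.2 hp)).comp
    Real.tendsto_log_atTop).mul_const y

theorem exists_norm_le_indicator {f : ℝ × ℝ → ℝ} (hf : Continuous f) (hfc : HasCompactSupport f) :
    ∃ M R : ℝ, ∀ a x : ℝ, ‖f (a, x)‖ ≤ (Set.Icc (-R) R).indicator (fun _ => M) x := by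
  obtain ⟨M, hM⟩ := hfc.exists_bound_of_continuous hf
  obtain ⟨R, hR⟩ := hfc.isCompact.isBounded.subset_closedBall (0 : ℝ × ℝ)
  refine ⟨M, R, fun a x => ?_⟩
  by_cases hx : x ∈ Set.Icc (-R) R
  · rw [Set.indicator_of_mem hx]
    exact hM _
  · have h0 : f (a, x) = 0 := image_eq_zero_of_notMem_tsupport fun h =>
      hx (abs_le.1 ((norm_snd_le (a, x)).trans (mem_closedBall_zero_iff.1 (hR h))))
    rw [Set.indicator_of_notMem hx, h0, norm_zero]

theorem integrable_indicator_Icc_const (M R : ℝ) :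
    Integrable ((Set.Icc (-R) R).indicator fun _ : ℝ => M) :=
  (integrable_indicator_iff measurableSet_Icc).2 (integrableOn_const (by simp))

theorem integrable_section {f : ℝ × ℝ → ℝ} (hf : Continuous f) (hfc : HasCompactSupport f)
    (a : ℝ) : Integrable fun x : ℝ => (f (a, x) : ℂ) := by
  obtain ⟨M, R, hMR⟩ := exists_norm_le_indicator hf hfc
  refine (integrable_indicator_Icc_const M R).mono'
    (Continuous.aestronglyMeasurable (by fun_prop)) (ae_of_all _ fun x => ?_)
  rw [Complex.norm_real]
  exact hMR a x

theorem tendsto_section_atTop {f : ℝ × ℝ → ℝ} (hf : Continuous f) (hfc : HasCompactSupport f)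
    (a : ℝ) : Tendsto (fun x : ℝ => (f (a, x) : ℂ)) atTop (nhds 0) := by
  obtain ⟨M, R, hMR⟩ := exists_norm_le_indicator hf hfc
  refine tendsto_const_nhds.congr' ?_
  filter_upwards [eventually_gt_atTop R] with x hx
  have h := hMR a x
  rw [Set.indicator_of_notMem (fun h => not_le.2 hx h.2)] at h
  have h0 : f (a, x) = 0 := norm_le_zero_iff.1 h
  rw [h0, Complex.ofReal_zero]

theorem stmt6 (p : ℝ) (hp : 0 < p) (q : ℕ) (hq : 2 ≤ q)
    (φ : ℝ × ℝ → ℝ) (hφ : ContDiff ℝ (⊤ : ℕ∞) φ) (hφc : HasCompactSupport φ) :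
    Tendsto (fun t : ℝ =>
        ((t ^ (1 / (q : ℝ)) * (Real.log t) ^ (1 / p) : ℝ) : ℂ) * Jone p q φ t)
      atTop
      (nhds (((Real.Gamma (1 / (q : ℝ) + 1) : ℝ) : ℂ) *
        Complex.exp (((Real.pi / (2 * (q : ℝ)) : ℝ) : ℂ) * Complex.I) *
        ((φ (0, 0) : ℝ) : ℂ))) := by
  have hE := tendsto_oscPrimitive hq
  set E : ℂ := ((Real.Gamma (1 / (q : ℝ) + 1) : ℝ) : ℂ) *
    Complex.exp (((Real.pi / (2 * (q : ℝ)) : ℝ) : ℂ) * Complex.I)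
  let ψ : ℝ × ℝ → ℝ := fun z => fderiv ℝ φ z (0, 1)
  have hψ : Continuous ψ := (hφ.continuous_fderiv (by simp)).clm_apply continuous_const
  have hψc : HasCompactSupport ψ := hφc.fderiv_apply ℝ (0, 1)
  have hderiv (a x : ℝ) : HasDerivAt (fun x : ℝ => (φ (a, x) : ℂ)) (ψ (a, x) : ℂ) x := by
    have h1 : HasFDerivAt φ (fderiv ℝ φ (a, x)) (a, x) :=
      (hφ.differentiable (by simp) _).hasFDerivAt
    exact (h1.comp_hasDerivAt x ((hasDerivAt_const x a).prodMk (hasDerivAt_id x))).ofReal_comp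
  let L : ℝ → ℝ := fun t => (Real.log t) ^ (-(1 / p))
  let K : ℝ → ℝ → ℂ := fun t y =>
    ∫ x in Set.Ioi (0 : ℝ), oscPrimitive q (t ^ (1 / (q : ℝ)) * x) * (ψ (L t * y, x) : ℂ)
  let e : ℝ → ℝ → ℂ := fun t y =>
    Complex.exp (Complex.I * ((t * Real.exp (-1 / (L t * y) ^ p) : ℝ) : ℂ))
  have he (t y : ℝ) : ‖e t y‖ = 1 := by
    simp only [e]
    rw [mul_comm, Complex.norm_exp_ofReal_mul_I]
  obtain ⟨M, R, hMR⟩ := exists_norm_le_indicator hψ hψc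
  have hB := integrable_indicator_Icc_const M R
  set B : ℝ → ℝ := (Set.Icc (-R) R).indicator fun _ => M
  have hMR' (a x : ℝ) : ‖(ψ (a, x) : ℂ)‖ ≤ B x := by
    rw [Complex.norm_real]
    exact hMR a x
  obtain ⟨C, hC⟩ := exists_norm_oscPrimitive_le hq
  have hK (y : ℝ) : Tendsto (fun t => K t y) atTop (nhds (-(E * φ (0, 0)))) := by
    have h := tendsto_integral_oscPrimitive_mul hq hE (h := fun t x => (ψ (L t * y, x) : ℂ))
      (h₀ := fun x => (ψ (0, x) : ℂ)) (fun t => Continuous.aestronglyMeasurable (by fun_prop))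
      hB.integrableOn (fun t x => hMR' _ x) (fun x => by
        refine ((Complex.continuous_ofReal.comp hψ).tendsto (0, x)).comp ?_
        exact (tendsto_log_rpow_neg_mul hp y).prodMk_nhds tendsto_const_nhds)
    rwa [integral_Ioi_of_hasDerivAt_of_tendsto' (fun x _ => hderiv 0 x)
      (integrable_section hψ hψc 0).integrableOn (tendsto_section_atTop hφ.continuous hφc 0),
      zero_sub, mul_neg] at h
  have hKle : ∀ t : ℝ, 0 < t → ∀ y, ‖K t y‖ ≤ ∫ x in Set.Ioi (0 : ℝ), C * B x := by
    intro t ht y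
    refine norm_integral_le_of_norm_le (hB.integrableOn.const_mul C) ?_
    refine (ae_restrict_iff' measurableSet_Ioi).2 (ae_of_all _ fun x hx => ?_)
    have h1 := hC _ (mul_nonneg (Real.rpow_nonneg ht.le (1 / (q : ℝ))) (le_of_lt hx))
    rw [norm_mul]
    exact mul_le_mul h1 (hMR' _ x) (norm_nonneg _) ((norm_nonneg _).trans h1)
  have hKmeas (t : ℝ) : StronglyMeasurable (K t) := by
    have hosc := continuous_oscPrimitive q
    refine StronglyMeasurable.integral_prod_right (f := fun y x =>
      oscPrimitive q (t ^ (1 / (q : ℝ)) * x) * (ψ (L t * y, x) : ℂ)) ?_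
    exact Continuous.stronglyMeasurable (by unfold Function.uncurry; fun_prop)
  have hmain : Tendsto (fun t => ∫ y in Set.Ioo (0 : ℝ) 1, e t y * K t y) atTop
      (nhds (∫ _ in Set.Ioo (0 : ℝ) 1, -(E * φ (0, 0)))) := by
    refine tendsto_integral_filter_of_dominated_convergence
      (fun _ => ∫ x in Set.Ioi (0 : ℝ), C * B x) ?_ ?_ (integrable_const _) ?_
    · refine Eventually.of_forall fun t => AEStronglyMeasurable.mul ?_
        (hKmeas t).aestronglyMeasurable
      exact Measurable.aestronglyMeasurable (by fun_prop)
    · filter_upwards [eventually_gt_atTop 0] with t ht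
      refine ae_of_all _ fun y => ?_
      rw [norm_mul, he, one_mul]
      exact hKle t ht y
    · refine (ae_restrict_iff' measurableSet_Ioo).2 (ae_of_all _ fun y hy => ?_)
      have h1 : Continuous fun s : ℝ => Complex.exp (Complex.I * (s : ℂ)) := by fun_prop
      have h2 := (h1.tendsto 0).comp (tendsto_mul_exp_neg_one_div hp hy)
      rw [Complex.ofReal_zero, mul_zero, Complex.exp_zero] at h2
      have h3 := h2.mul (hK y)
      rwa [one_mul] at h3
  have hneg := hmain.neg
  simp only [integral_const, neg_neg, measureReal_restrict_apply_univ, Real.volume_real_Ioo,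
    sub_zero, zero_le_one, sup_of_le_left, one_smul] at hneg
  refine hneg.congr' ?_
  filter_upwards [eventually_gt_atTop 1] with t ht
  rw [Complex.ofReal_mul, mul_assoc, rpow_log_mul_Jone hφ.continuous hφc ht,
    ← integral_const_mul, ← integral_neg]
  congr 1
  ext y
  rw [mul_left_comm, rpow_mul_integral_exp_mul hq (zero_lt_one.trans ht) (hderiv _)
    (integrable_section hφ.continuous hφc _).integrableOn
    (integrable_section hψ hψc _).integrableOn (tendsto_section_atTop hφ.continuous hφc _), mul_neg]
end

section
/- Let p > 0 be a real number, let q ≥ 2 be an integer, and let φ : ℝ² → ℝ be a smooth compactly supported function. Then there exist constants C > 0 and t₀ > 1, independent of t, such that |J⁽²⁾(t)| ≤ C t^{-1/q} (log t)^{-(1/p + 1)} for all t ≥ t₀. -/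
open MeasureTheory Filter

/-- `J⁽²⁾(t) = ∫₀^∞ ∫_{(log t)^{-1/p}}^∞ e^{i t (x₂^q + exp(-1/x₁^p))} φ(x₁,x₂) dx₁ dx₂`. -/
noncomputable def Jtwo (p : ℝ) (q : ℕ) (φ : ℝ × ℝ → ℝ) (t : ℝ) : ℂ :=
  ∫ x₂ in Set.Ioi (0 : ℝ), ∫ x₁ in Set.Ioi ((Real.log t) ^ (-(1 / p))),
    Complex.exp (Complex.I * (t : ℂ) *
        ((x₂ ^ q + Real.exp (-1 / x₁ ^ p) : ℝ) : ℂ)) * ((φ (x₁, x₂) : ℝ) : ℂ)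

lemma norm_cexp_I_mul_ofReal_mul (t x : ℝ) :
    ‖Complex.exp (Complex.I * (t : ℂ) * (x : ℂ))‖ = 1 := by
  rw [show Complex.I * (t : ℂ) * (x : ℂ) = ((t * x : ℝ) : ℂ) * Complex.I by push_cast; ring]
  exact Complex.norm_exp_ofReal_mul_I _

/-- A first-derivative van der Corput estimate: the phase `g` has derivative `1 / w`, and the
one-sided bound `hK` on `w'` replaces the usual monotonicity of the derivative of the phase. -/
lemma norm_integral_cexp_mul_le {a b t K M : ℝ} {g w w' : ℝ → ℝ} {h h' : ℝ → ℂ}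
    (hab : a ≤ b) (ht : 0 < t) (hwpos : ∀ x ∈ Set.Icc a b, 0 < w x)
    (hg : ∀ x ∈ Set.Icc a b, HasDerivAt g (w x)⁻¹ x)
    (hw : ∀ x ∈ Set.Icc a b, HasDerivAt w (w' x) x)
    (hw' : ContinuousOn w' (Set.Icc a b))
    (hK : ∀ x ∈ Set.Icc a b, |w' x| ≤ K - w' x)
    (hh : ∀ x ∈ Set.Icc a b, HasDerivAt h (h' x) x)
    (hh' : ContinuousOn h' (Set.Icc a b))
    (hM : ∀ x ∈ Set.Icc a b, ‖h x‖ ≤ M) (hM' : ∀ x ∈ Set.Icc a b, ‖h' x‖ ≤ M) :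
    ‖∫ x in a..b, Complex.exp (Complex.I * (t : ℂ) * (g x : ℂ)) * h x‖ ≤
      M / t * (2 * w a + (K + (w a + K * (b - a))) * (b - a)) := by
  have hamem : a ∈ Set.Icc a b := ⟨le_rfl, hab⟩
  have hbmem : b ∈ Set.Icc a b := ⟨hab, le_rfl⟩
  have hM0 : 0 ≤ M := (norm_nonneg _).trans (hM a hamem)
  have hK0 : 0 ≤ K := by
    have h1 := hK a hamem
    have h2 := neg_abs_le (w' a)
    linarith
  have hgc : ContinuousOn g (Set.Icc a b) := fun x hx => (hg x hx).continuousAt.continuousWithinAt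
  have hwc : ContinuousOn w (Set.Icc a b) := fun x hx => (hw x hx).continuousAt.continuousWithinAt
  have hhc : ContinuousOn h (Set.Icc a b) := fun x hx => (hh x hx).continuousAt.continuousWithinAt
  have hwle : ∀ x ∈ Set.Icc a b, w x ≤ w a + K * (b - a) := by
    intro x hx
    have h1 := (convex_Icc a b).image_sub_le_mul_sub_of_deriv_le (f := w) (C := K) hwc
      (fun y hy => (hw y (interior_subset hy)).differentiableAt.differentiableWithinAt)
      (fun y hy => by
        rw [(hw y (interior_subset hy)).deriv]
        have h1 := hK y (interior_subset hy)
        have h2 := le_abs_self (w' y)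
        linarith) a hamem x hx hx.1
    have h2 : K * (x - a) ≤ K * (b - a) := by
      gcongr
      exact hx.2
    linarith
  set E : ℝ → ℂ := fun x => Complex.exp (Complex.I * (t : ℂ) * (g x : ℂ)) with hE
  have hEn : ∀ x, ‖E x‖ = 1 := fun x => norm_cexp_I_mul_ofReal_mul t (g x)
  have hEc : ContinuousOn E (Set.Icc a b) := by
    apply Complex.continuous_exp.comp_continuousOn
    exact continuousOn_const.mul (Complex.continuous_ofReal.comp_continuousOn hgc)
  have hwcC : ContinuousOn (fun x => (w x : ℂ)) (Set.Icc a b) :=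
    Complex.continuous_ofReal.comp_continuousOn hwc
  have hw'cC : ContinuousOn (fun x => (w' x : ℂ)) (Set.Icc a b) :=
    Complex.continuous_ofReal.comp_continuousOn hw'
  have hItn : ‖Complex.I * (t : ℂ)‖ = t := by simp [abs_of_pos ht]
  set r : ℝ → ℂ := fun x => E x * ((w' x : ℂ) * h x + (w x : ℂ) * h' x) with hr
  have hrc : ContinuousOn r (Set.Icc a b) := hEc.mul ((hw'cC.mul hhc).add (hwcC.mul hh'))
  have hder : ∀ x ∈ Set.uIcc a b, HasDerivAt (fun x => E x * ((w x : ℂ) * h x))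
      (Complex.I * (t : ℂ) * (E x * h x) + r x) x := by
    intro x hx
    rw [Set.uIcc_of_le hab] at hx
    have h1 : HasDerivAt E (E x * (Complex.I * (t : ℂ) * (((w x)⁻¹ : ℝ) : ℂ))) x :=
      (((hg x hx).ofReal_comp).const_mul _).cexp
    have h2 := h1.mul (((hw x hx).ofReal_comp).mul (hh x hx))
    refine h2.congr_deriv ?_
    have h3 : (w x : ℂ) ≠ 0 := by exact_mod_cast (hwpos x hx).ne'
    simp only [hr, Complex.ofReal_inv, Pi.mul_apply]
    field_simp
  have hi1 : IntervalIntegrable (fun x => E x * h x) volume a b :=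
    ContinuousOn.intervalIntegrable_of_Icc hab (hEc.mul hhc)
  have hi2 : IntervalIntegrable r volume a b := hrc.intervalIntegrable_of_Icc hab
  have hi3 : IntervalIntegrable w' volume a b := hw'.intervalIntegrable_of_Icc hab
  have hibp := intervalIntegral.integral_eq_sub_of_hasDerivAt hder ((hi1.const_mul _).add hi2)
  rw [intervalIntegral.integral_add (hi1.const_mul _) hi2, intervalIntegral.integral_const_mul]
    at hibp
  have hw'int : ∫ x in a..b, w' x = w b - w a :=
    intervalIntegral.integral_eq_sub_of_hasDerivAt
      (fun x hx => hw x (by rwa [Set.uIcc_of_le hab] at hx)) hi3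
  have hrn : ‖∫ x in a..b, r x‖ ≤ ∫ x in a..b, M * ((K + (w a + K * (b - a))) - w' x) := by
    refine intervalIntegral.norm_integral_le_of_norm_le hab ?_
      ((intervalIntegrable_const.sub hi3).const_mul _)
    refine Eventually.of_forall fun x hx => ?_
    have hx' : x ∈ Set.Icc a b := ⟨hx.1.le, hx.2⟩
    have h1 : ‖(w' x : ℂ) * h x + (w x : ℂ) * h' x‖ ≤ |w' x| * M + w x * M := by
      refine (norm_add_le _ _).trans ?_
      rw [norm_mul, norm_mul, Complex.norm_real, Complex.norm_real, Real.norm_eq_abs,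
        Real.norm_eq_abs, abs_of_pos (hwpos x hx')]
      have := hM x hx'
      have := hM' x hx'
      have := hwpos x hx'
      gcongr
    rw [show r x = E x * ((w' x : ℂ) * h x + (w x : ℂ) * h' x) from rfl, norm_mul, hEn, one_mul]
    refine h1.trans ?_
    have h2 := hK x hx'
    have h3 := hwle x hx'
    rw [← add_mul, mul_comm]
    gcongr
    linarith
  rw [intervalIntegral.integral_const_mul,
    intervalIntegral.integral_sub intervalIntegrable_const hi3, hw'int,
    intervalIntegral.integral_const, smul_eq_mul] at hrn
  have hend : ∀ x ∈ Set.Icc a b, ‖E x * ((w x : ℂ) * h x)‖ ≤ w x * M := by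
    intro x hx
    rw [norm_mul, hEn, one_mul, norm_mul, Complex.norm_real, Real.norm_eq_abs,
      abs_of_pos (hwpos x hx)]
    exact mul_le_mul_of_nonneg_left (hM x hx) (hwpos x hx).le
  have hmain : t * ‖∫ x in a..b, E x * h x‖ ≤
      M * (2 * w a + (K + (w a + K * (b - a))) * (b - a)) := by
    rw [← hItn, ← norm_mul, eq_sub_of_add_eq hibp]
    refine (norm_sub_le _ _).trans ?_
    have h1 := norm_sub_le (E b * ((w b : ℂ) * h b)) (E a * ((w a : ℂ) * h a))
    have h2 := hend a hamem
    have h3 := hend b hbmem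
    nlinarith
  rw [div_mul_eq_mul_div, le_div_iff₀ ht, mul_comm]
  exact hmain

/-- Decay of the one-dimensional oscillatory integral with phase `t * x ^ q`. -/
lemma norm_integral_cexp_pow_mul_le {q : ℕ} (hq : 1 ≤ q) {R t M : ℝ} (hR : 1 ≤ R) (ht : 1 ≤ t)
    {h h' : ℝ → ℂ} (hh : ∀ x, HasDerivAt h (h' x) x) (hh' : Continuous h')
    (hM : ∀ x, ‖h x‖ ≤ M) (hM' : ∀ x, ‖h' x‖ ≤ M) :
    ‖∫ x in (0 : ℝ)..R, Complex.exp (Complex.I * (t : ℂ) * ((x ^ q : ℝ) : ℂ)) * h x‖ ≤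
      M * (3 + R) * t ^ (-(1 / (q : ℝ))) := by
  have ht0 : 0 < t := by linarith
  have hq0 : (0 : ℝ) < q := by exact_mod_cast hq
  have hq1 : (1 : ℝ) ≤ q := by exact_mod_cast hq
  have hM0 : 0 ≤ M := (norm_nonneg _).trans (hM 0)
  set δ : ℝ := t ^ (-(1 / (q : ℝ))) with hδ
  have hδ0 : 0 < δ := Real.rpow_pos_of_pos ht0 _
  have hδ1 : δ ≤ 1 := Real.rpow_le_one_of_one_le_of_nonpos ht (by
    rw [neg_nonpos]; positivity)
  have hhc : Continuous h := continuous_iff_continuousAt.2 fun x => (hh x).continuousAt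
  have hc : Continuous fun x : ℝ =>
      Complex.exp (Complex.I * (t : ℂ) * ((x ^ q : ℝ) : ℂ)) * h x := by fun_prop
  rw [← intervalIntegral.integral_add_adjacent_intervals (b := δ) (hc.intervalIntegrable _ _)
    (hc.intervalIntegrable _ _)]
  have hfirst : ‖∫ x in (0 : ℝ)..δ,
      Complex.exp (Complex.I * (t : ℂ) * ((x ^ q : ℝ) : ℂ)) * h x‖ ≤ M * δ := by
    have := intervalIntegral.norm_integral_le_of_norm_le_const (a := 0) (b := δ) (C := M)
      (f := fun x : ℝ => Complex.exp (Complex.I * (t : ℂ) * ((x ^ q : ℝ) : ℂ)) * h x)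
      (fun x _ => by
        rw [norm_mul, norm_cexp_I_mul_ofReal_mul, one_mul]
        exact hM x)
    rwa [sub_zero, abs_of_pos hδ0] at this
  have hsecond := norm_integral_cexp_mul_le (a := δ) (b := R) (t := t) (K := 0) (M := M)
    (g := fun x => x ^ q) (w := fun x => (q : ℝ)⁻¹ * x ^ (1 - (q : ℝ)))
    (w' := fun x => (q : ℝ)⁻¹ * ((1 - (q : ℝ)) * x ^ (1 - (q : ℝ) - 1))) (h := h) (h' := h')
    (hδ1.trans hR) ht0
    (fun x hx => by
      have : 0 < x := hδ0.trans_le hx.1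
      positivity)
    (fun x hx => by
      have hx0 : 0 < x := hδ0.trans_le hx.1
      refine (hasDerivAt_pow q x).congr_deriv ?_
      rw [mul_inv, inv_inv, ← Real.rpow_neg hx0.le, neg_sub, ← Real.rpow_natCast,
        Nat.cast_sub hq, Nat.cast_one])
    (fun x hx => by
      have hx0 : 0 < x := hδ0.trans_le hx.1
      exact (Real.hasDerivAt_rpow_const (Or.inl hx0.ne')).const_mul _)
    (by
      refine continuousOn_const.mul (continuousOn_const.mul ?_)
      exact continuousOn_id.rpow_const fun x hx => Or.inl (hδ0.trans_le hx.1).ne')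
    (fun x hx => by
      have hx0 : 0 < x := hδ0.trans_le hx.1
      rw [zero_sub, abs_of_nonpos]
      refine mul_nonpos_of_nonneg_of_nonpos (by positivity)
        (mul_nonpos_of_nonpos_of_nonneg (by linarith) (by positivity)))
    (fun x _ => hh x) hh'.continuousOn (fun x _ => hM x) (fun x _ => hM' x)
  have hδt : δ ^ (1 - (q : ℝ)) = t * δ := by
    have : δ ^ (-(q : ℝ)) = t := by
      rw [hδ, ← Real.rpow_mul ht0.le]
      field_simp
      exact Real.rpow_one t
    rw [sub_eq_add_neg, Real.rpow_add hδ0, Real.rpow_one, this, mul_comm]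
  have hbd : M / t * (2 * ((q : ℝ)⁻¹ * δ ^ (1 - (q : ℝ))) +
      (0 + ((q : ℝ)⁻¹ * δ ^ (1 - (q : ℝ)) + 0 * (R - δ))) * (R - δ)) ≤ M * (2 + R) * δ := by
    rw [hδt]
    have h1 : M / t * (2 * ((q : ℝ)⁻¹ * (t * δ)) +
        (0 + ((q : ℝ)⁻¹ * (t * δ) + 0 * (R - δ))) * (R - δ)) =
        M * (q : ℝ)⁻¹ * (2 + (R - δ)) * δ := by
      field_simp
      ring
    rw [h1]
    have h2 : (q : ℝ)⁻¹ ≤ 1 := inv_le_one_of_one_le₀ hq1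
    have h3 : M * (q : ℝ)⁻¹ ≤ M := mul_le_of_le_one_right hM0 h2
    have h4 : 0 ≤ 2 + (R - δ) := by linarith
    gcongr
    linarith
  refine (norm_add_le _ _).trans ((add_le_add hfirst (hsecond.trans hbd)).trans (le_of_eq ?_))
  ring

lemma hasDerivAt_exp_neg_one_div_rpow {p x : ℝ} (hx : 0 < x) :
    HasDerivAt (fun x : ℝ => Real.exp (-1 / x ^ p))
      (p⁻¹ * (x * x ^ p) * Real.exp (1 / x ^ p))⁻¹ x := by
  have hu : 0 < x ^ p := Real.rpow_pos_of_pos hx p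
  have h1 : HasDerivAt (fun x : ℝ => x ^ p) (p * x ^ (p - 1)) x :=
    Real.hasDerivAt_rpow_const (Or.inl hx.ne')
  refine (((hasDerivAt_const x (-1 : ℝ)).div h1 hu.ne').exp).congr_deriv ?_
  rw [Pi.div_apply, Real.rpow_sub_one hx.ne', neg_div, Real.exp_neg]
  have := (Real.exp_pos (1 / x ^ p)).ne'
  field_simp
  ring

lemma hasDerivAt_mul_rpow_mul_exp_one_div_rpow {p x : ℝ} (hp : 0 < p) (hx : 0 < x) :
    HasDerivAt (fun x : ℝ => p⁻¹ * (x * x ^ p) * Real.exp (1 / x ^ p))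
      (p⁻¹ * Real.exp (1 / x ^ p) * ((p + 1) * x ^ p - p)) x := by
  have hu : 0 < x ^ p := Real.rpow_pos_of_pos hx p
  have h1 : HasDerivAt (fun x : ℝ => x ^ p) (p * x ^ (p - 1)) x :=
    Real.hasDerivAt_rpow_const (Or.inl hx.ne')
  have h2 := (((hasDerivAt_id x).mul h1).const_mul p⁻¹).mul
    (((hasDerivAt_const x (1 : ℝ)).div h1 hu.ne').exp)
  refine h2.congr_deriv ?_
  simp only [Pi.mul_apply, Pi.div_apply, id]
  rw [Real.rpow_sub_one hx.ne']
  field_simp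
  ring

/-- Decay of the one-dimensional oscillatory integral with the flat phase `t * exp (-1 / x ^ p)`,
away from the region where the phase is bounded. -/
lemma exists_norm_integral_cexp_exp_mul_le {p R : ℝ} (hp : 0 < p) (hR : 1 ≤ R) :
    ∃ C > (0 : ℝ), ∃ t₀ > (1 : ℝ), ∀ t ≥ t₀, 1 ≤ Real.log t ∧
      ∀ (M : ℝ) (h h' : ℝ → ℂ), (∀ x, HasDerivAt h (h' x) x) → Continuous h' →
        (∀ x, ‖h x‖ ≤ M) → (∀ x, ‖h' x‖ ≤ M) →
        ‖∫ x in (Real.log t ^ (-(1 / p)))..R,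
          Complex.exp (Complex.I * (t : ℂ) * ((Real.exp (-1 / x ^ p) : ℝ) : ℂ)) * h x‖ ≤
          M * (C * Real.log t ^ (-(1 / p + 1))) := by
  have hR0 : 0 < R := by linarith
  set K : ℝ := 2 * (p⁻¹ * Real.exp ((p + 1) / p) * ((p + 1) * R ^ p)) with hKdef
  have hK0 : 0 < K := by positivity
  refine ⟨(2 + R) * p⁻¹ + (K + K * R) * R, by positivity, ?_⟩
  have hlog := ((isLittleO_log_rpow_rpow_atTop (1 / p + 1) one_pos).bound one_pos).and
    (Real.tendsto_log_atTop.eventually_ge_atTop 1)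
  obtain ⟨t₁, ht₁⟩ := eventually_atTop.1 hlog
  refine ⟨max t₁ 2, lt_max_of_lt_right one_lt_two, fun t ht => ?_⟩
  obtain ⟨hlt, hL⟩ := ht₁ t ((le_max_left _ _).trans ht)
  refine ⟨hL, fun M h h' hh hh' hM hM' => ?_⟩
  have ht0 : 0 < t := two_pos.trans_le ((le_max_right _ _).trans ht)
  have hM0 : 0 ≤ M := (norm_nonneg _).trans (hM 0)
  set L := Real.log t with hLdef
  have hL0 : 0 < L := by linarith
  have hlt' : L ^ (1 / p + 1) ≤ t := by
    rw [Real.rpow_one, one_mul, Real.norm_eq_abs, Real.norm_eq_abs, abs_of_pos ht0] at hlt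
    exact (le_abs_self _).trans hlt
  have htinv : 1 / t ≤ L ^ (-(1 / p + 1)) := by
    rw [Real.rpow_neg hL0.le, one_div]
    exact inv_anti₀ (Real.rpow_pos_of_pos hL0 _) hlt'
  set a : ℝ := L ^ (-(1 / p)) with ha
  have ha0 : 0 < a := Real.rpow_pos_of_pos hL0 _
  have ha1 : a ≤ 1 := Real.rpow_le_one_of_one_le_of_nonpos hL (by
    rw [neg_nonpos]; positivity)
  have hpos : ∀ x ∈ Set.Icc a R, 0 < x := fun x hx => ha0.trans_le hx.1
  have hbound := norm_integral_cexp_mul_le (a := a) (b := R) (t := t) (K := K) (M := M)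
    (g := fun x => Real.exp (-1 / x ^ p))
    (w := fun x => p⁻¹ * (x * x ^ p) * Real.exp (1 / x ^ p))
    (w' := fun x => p⁻¹ * Real.exp (1 / x ^ p) * ((p + 1) * x ^ p - p)) (h := h) (h' := h')
    (ha1.trans hR) ht0
    (fun x hx => by
      have := hpos x hx
      positivity)
    (fun x hx => hasDerivAt_exp_neg_one_div_rpow (hpos x hx))
    (fun x hx => hasDerivAt_mul_rpow_mul_exp_one_div_rpow hp (hpos x hx))
    (by
      have hc : ContinuousOn (fun x : ℝ => x ^ p) (Set.Icc a R) :=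
        continuousOn_id.rpow_const fun x hx => Or.inl (hpos x hx).ne'
      have hd : ContinuousOn (fun x : ℝ => 1 / x ^ p) (Set.Icc a R) :=
        continuousOn_const.div hc fun x hx => (Real.rpow_pos_of_pos (hpos x hx) p).ne'
      exact (continuousOn_const.mul hd.rexp).mul ((continuousOn_const.mul hc).sub continuousOn_const))
    (fun x hx => by
      have hx0 := hpos x hx
      have hu : 0 < x ^ p := Real.rpow_pos_of_pos hx0 p
      rcases le_or_gt ((p + 1) * x ^ p - p) 0 with hs | hs
      · rw [abs_of_nonpos (mul_nonpos_of_nonneg_of_nonpos (by positivity) hs)]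
        linarith
      · rw [abs_of_pos (by positivity)]
        have h1 : 1 / x ^ p ≤ (p + 1) / p := by
          rw [div_le_div_iff₀ hu hp]
          linarith
        have h2 : (p + 1) * x ^ p - p ≤ (p + 1) * R ^ p := by
          have : x ^ p ≤ R ^ p := Real.rpow_le_rpow hx0.le hx.2 hp.le
          nlinarith
        have h3 : p⁻¹ * Real.exp (1 / x ^ p) * ((p + 1) * x ^ p - p) ≤
            p⁻¹ * Real.exp ((p + 1) / p) * ((p + 1) * R ^ p) := by gcongr
        linarith)
    (fun x _ => hh x) hh'.continuousOn (fun x _ => hM x) (fun x _ => hM' x)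
  refine hbound.trans ?_
  have hap : a ^ p = L⁻¹ := by
    rw [ha, ← Real.rpow_mul hL0.le, ← Real.rpow_neg_one]
    congr 1
    field_simp
  have hwa : p⁻¹ * (a * a ^ p) * Real.exp (1 / a ^ p) = p⁻¹ * L ^ (-(1 / p + 1)) * t := by
    rw [hap, one_div, inv_inv, hLdef, Real.exp_log ht0, ← hLdef, neg_add, Real.rpow_add hL0,
      Real.rpow_neg_one]
  simp only [hwa]
  set s := L ^ (-(1 / p + 1)) with hs
  have hs0 : 0 < s := Real.rpow_pos_of_pos hL0 _
  have hD : R - a ≤ R := by linarith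
  have hD0 : 0 ≤ R - a := by linarith
  calc M / t * (2 * (p⁻¹ * s * t) + (K + (p⁻¹ * s * t + K * (R - a))) * (R - a))
      ≤ M / t * (2 * (p⁻¹ * s * t) + (K + (p⁻¹ * s * t + K * R)) * R) := by gcongr
    _ = M * ((2 + R) * p⁻¹ * s + (K + K * R) * R * (1 / t)) := by
        field_simp
        ring
    _ ≤ M * ((2 + R) * p⁻¹ * s + (K + K * R) * R * s) := by gcongr
    _ = M * (((2 + R) * p⁻¹ + (K + K * R) * R) * s) := by ring

lemma hasDerivAt_snd {ψ : ℝ × ℝ → ℝ} (hψ : ContDiff ℝ 1 ψ) (x y : ℝ) :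
    HasDerivAt (fun y => ψ (x, y)) (fderiv ℝ ψ (x, y) (0, 1)) y :=
  ((hψ.differentiable one_ne_zero (x, y)).hasFDerivAt).comp_hasDerivAt y
    ((hasDerivAt_const y x).prodMk (hasDerivAt_id y))

lemma hasDerivAt_fst {ψ : ℝ × ℝ → ℝ} (hψ : ContDiff ℝ 1 ψ) (x y : ℝ) :
    HasDerivAt (fun x => ψ (x, y)) (fderiv ℝ ψ (x, y) (1, 0)) x :=
  ((hψ.differentiable one_ne_zero (x, y)).hasFDerivAt).comp_hasDerivAt x
    ((hasDerivAt_id x).prodMk (hasDerivAt_const x y))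

lemma hasDerivAt_integral_mul_snd {a b N : ℝ} (hab : a ≤ b) {E : ℝ → ℂ}
    (hE : ContinuousOn E (Set.Icc a b)) (hE1 : ∀ x, ‖E x‖ ≤ 1) {ψ : ℝ × ℝ → ℝ}
    (hψ : ContDiff ℝ 1 ψ) (hN : ∀ z, ‖fderiv ℝ ψ z (0, 1)‖ ≤ N) (y : ℝ) :
    HasDerivAt (fun y => ∫ x in a..b, E x * (ψ (x, y) : ℂ))
      (∫ x in a..b, E x * ((fderiv ℝ ψ (x, y) (0, 1) : ℝ) : ℂ)) y := by
  have hc : ∀ {χ : ℝ × ℝ → ℝ}, Continuous χ → ∀ y,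
      IntervalIntegrable (fun x => E x * (χ (x, y) : ℂ)) volume a b := fun {χ} hχ y =>
    ContinuousOn.intervalIntegrable_of_Icc hab
      (hE.mul (by fun_prop : Continuous fun x => (χ (x, y) : ℂ)).continuousOn)
  have hd : Continuous fun z => fderiv ℝ ψ z (0, 1) :=
    (hψ.continuous_fderiv one_ne_zero).clm_apply continuous_const
  refine (intervalIntegral.hasDerivAt_integral_of_dominated_loc_of_deriv_le
    (F := fun y x => E x * (ψ (x, y) : ℂ))
    (F' := fun y x => E x * ((fderiv ℝ ψ (x, y) (0, 1) : ℝ) : ℂ)) (bound := fun _ => N)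
    Filter.univ_mem (Eventually.of_forall fun y => ?_) (hc hψ.continuous y) ?_ ?_
    intervalIntegrable_const ?_).2
  · exact (hc hψ.continuous y).def'.aestronglyMeasurable
  · exact (hc hd y).def'.aestronglyMeasurable
  · refine Eventually.of_forall fun x _ y _ => ?_
    rw [norm_mul, Complex.norm_real]
    exact (mul_le_of_le_one_left (norm_nonneg _) (hE1 x)).trans (hN _)
  · exact Eventually.of_forall fun x _ y _ =>
      ((hasDerivAt_snd hψ x y).ofReal_comp).const_mul _

lemma setIntegral_Ioi_eq_intervalIntegral {a R : ℝ} (ha : a ≤ R) {f : ℝ → ℂ}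
    (hf : ∀ x, R < x → f x = 0) : ∫ x in Set.Ioi a, f x = ∫ x in a..R, f x := by
  rw [intervalIntegral.integral_of_le ha]
  refine setIntegral_eq_of_subset_of_forall_sdiff_eq_zero measurableSet_Ioi
    Set.Ioc_subset_Ioi_self fun x hx => hf x ?_
  by_contra hxR
  exact hx.2 ⟨hx.1, not_lt.1 hxR⟩

theorem stmt7 (p : ℝ) (hp : 0 < p) (q : ℕ) (hq : 2 ≤ q)
    (φ : ℝ × ℝ → ℝ) (hφ : ContDiff ℝ (⊤ : ℕ∞) φ) (hφc : HasCompactSupport φ) :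
    ∃ C > (0 : ℝ), ∃ t₀ > (1 : ℝ), ∀ t ≥ t₀,
      ‖Jtwo p q φ t‖ ≤ C * t ^ (-(1 / (q : ℝ))) * (Real.log t) ^ (-(1 / p + 1)) := by
  set φ₂ : ℝ × ℝ → ℝ := fun z => fderiv ℝ φ z (0, 1) with hφ₂
  have hbdd : ∀ {χ : ℝ × ℝ → ℝ}, ContDiff ℝ (⊤ : ℕ∞) χ → HasCompactSupport χ →
      ∀ v, ContDiff ℝ (⊤ : ℕ∞) (fun z => fderiv ℝ χ z v) ∧
        HasCompactSupport (fun z => fderiv ℝ χ z v) := fun {χ} hχ hχc v =>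
    ⟨(hχ.fderiv_right (by simp)).clm_apply contDiff_const, hχc.fderiv_apply ℝ v⟩
  obtain ⟨hφ₂s, hφ₂c⟩ := hbdd hφ hφc (0, 1)
  obtain ⟨B₁, hB₁⟩ := hφc.exists_bound_of_continuous hφ.continuous
  obtain ⟨B₂, hB₂⟩ := hφ₂c.exists_bound_of_continuous hφ₂s.continuous
  have hφ₁ := hbdd hφ hφc (1, 0)
  obtain ⟨B₃, hB₃⟩ := hφ₁.2.exists_bound_of_continuous hφ₁.1.continuous
  have hφ₁₂ := hbdd hφ₂s hφ₂c (1, 0)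
  obtain ⟨B₄, hB₄⟩ := hφ₁₂.2.exists_bound_of_continuous hφ₁₂.1.continuous
  have hφ₂₂ := hbdd hφ₂s hφ₂c (0, 1)
  obtain ⟨B₅, hB₅⟩ := hφ₂₂.2.exists_bound_of_continuous hφ₂₂.1.continuous
  obtain ⟨R₀, hR₀⟩ := hφc.isCompact.isBounded.subset_closedBall 0
  set R := max R₀ 1 with hRdef
  have hR : 1 ≤ R := le_max_right _ _
  have hzero : ∀ z : ℝ × ℝ, R < ‖z‖ → φ z = 0 := by
    intro z hz
    by_contra hne
    have h1 := hR₀ (subset_tsupport φ hne)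
    rw [mem_closedBall_zero_iff] at h1
    exact absurd (h1.trans (le_max_left R₀ 1)) (not_le.2 hz)
  set M := max (max (max B₁ B₂) (max B₃ B₄)) 1 with hM
  have hM0 : 0 < M := one_pos.trans_le (le_max_right _ _)
  have hM₁ : B₁ ≤ M := by simp [hM]
  have hM₂ : B₂ ≤ M := by simp [hM]
  have hM₃ : B₃ ≤ M := by simp [hM]
  have hM₄ : B₄ ≤ M := by simp [hM]
  obtain ⟨C, hC, t₀, ht₀, hmain⟩ := exists_norm_integral_cexp_exp_mul_le hp hR
  refine ⟨M * C * (3 + R), by positivity, t₀, ht₀, fun t ht => ?_⟩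
  obtain ⟨hL, hin⟩ := hmain t ht
  have ht1 : 1 ≤ t := ht₀.le.trans ht
  set a : ℝ := Real.log t ^ (-(1 / p)) with ha
  have ha0 : 0 < a := Real.rpow_pos_of_pos (by linarith) _
  have haR : a ≤ R := (Real.rpow_le_one_of_one_le_of_nonpos hL (by
    rw [neg_nonpos]; positivity)).trans hR
  set E : ℝ → ℂ := fun x =>
    Complex.exp (Complex.I * (t : ℂ) * ((Real.exp (-1 / x ^ p) : ℝ) : ℂ)) with hE
  have hE1 : ∀ x, ‖E x‖ ≤ 1 := fun x => (norm_cexp_I_mul_ofReal_mul t _).le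
  have hEc : ContinuousOn E (Set.Icc a R) := by
    apply Complex.continuous_exp.comp_continuousOn
    refine continuousOn_const.mul (Complex.continuous_ofReal.comp_continuousOn fun x hx => ?_)
    exact (hasDerivAt_exp_neg_one_div_rpow
      (ha0.trans_le hx.1)).continuousAt.continuousWithinAt
  have hslice : ∀ {χ : ℝ × ℝ → ℝ}, ContDiff ℝ (⊤ : ℕ∞) χ → (∀ z, ‖χ z‖ ≤ M) →
      (∀ z, ‖fderiv ℝ χ z (1, 0)‖ ≤ M) → ∀ y,
      ‖∫ x in a..R, E x * (χ (x, y) : ℂ)‖ ≤ M * (C * Real.log t ^ (-(1 / p + 1))) := by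
    intro χ hχ hχ0 hχ1 y
    have hχ' : ContDiff ℝ 1 χ := hχ.of_le (by exact_mod_cast le_top)
    have hd : Continuous fun z => fderiv ℝ χ z (1, 0) :=
      (hχ'.continuous_fderiv one_ne_zero).clm_apply continuous_const
    refine hin M (fun x => (χ (x, y) : ℂ)) (fun x => ((fderiv ℝ χ (x, y) (1, 0) : ℝ) : ℂ))
      (fun x => (hasDerivAt_fst hχ' x y).ofReal_comp) ?_ (fun x => ?_) (fun x => ?_)
    · exact Complex.continuous_ofReal.comp (hd.comp (by fun_prop))
    · rw [Complex.norm_real]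
      exact hχ0 _
    · rw [Complex.norm_real]
      exact hχ1 _
  have hH := hasDerivAt_integral_mul_snd haR hEc hE1
    (hφ.of_le (by exact_mod_cast le_top)) hB₂
  have hH' := hasDerivAt_integral_mul_snd haR hEc hE1
    (hφ₂s.of_le (by exact_mod_cast le_top)) hB₅
  have hJ : Jtwo p q φ t = ∫ y in (0 : ℝ)..R,
      Complex.exp (Complex.I * (t : ℂ) * ((y ^ q : ℝ) : ℂ)) *
        ∫ x in a..R, E x * (φ (x, y) : ℂ) := by
    have hsplit : ∀ y : ℝ, (∫ x in Set.Ioi a,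
        Complex.exp (Complex.I * (t : ℂ) * ((y ^ q + Real.exp (-1 / x ^ p) : ℝ) : ℂ)) *
          ((φ (x, y) : ℝ) : ℂ)) =
        Complex.exp (Complex.I * (t : ℂ) * ((y ^ q : ℝ) : ℂ)) *
          ∫ x in a..R, E x * (φ (x, y) : ℂ) := by
      intro y
      rw [setIntegral_Ioi_eq_intervalIntegral haR, ← intervalIntegral.integral_const_mul]
      · congr 1
        ext x
        rw [hE, Complex.ofReal_add, mul_add, Complex.exp_add, mul_assoc]
      · intro x hx
        rw [hzero (x, y) ((hx.trans_le (le_abs_self x)).trans_le (norm_fst_le (x, y))),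
          Complex.ofReal_zero, mul_zero]
    simp only [Jtwo, ← ha, hsplit]
    refine setIntegral_Ioi_eq_intervalIntegral (by linarith) fun y hy => ?_
    have h0 : ∀ x, φ (x, y) = 0 := fun x =>
      hzero (x, y) ((hy.trans_le (le_abs_self y)).trans_le (norm_snd_le (x, y)))
    simp [h0]
  rw [hJ]
  refine (norm_integral_cexp_pow_mul_le (by omega) hR ht1 hH
    (continuous_iff_continuousAt.2 fun y => (hH' y).continuousAt)
    (hslice hφ (fun z => (hB₁ z).trans hM₁) (fun z => (hB₃ z).trans hM₃))
    (hslice hφ₂s (fun z => (hB₂ z).trans hM₂) (fun z => (hB₄ z).trans hM₄))).trans (le_of_eq ?_)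
  ring
end

section
/- Let p > 0 be a real number and let ψ : ℝ → ℝ be a smooth function whose support is contained in (−1/log 2, 1/log 2). Define ψ̃ : [0,1) → ℝ by ψ̃(u) = ψ((−1/log u)^{1/p}) for u ∈ (0,1) and ψ̃(0) = ψ(0), and for t > 2 define M⁽²⁾(t) = −(1/(it)) ∫_{1/t}^{1/2} e^{itu} (d/du)[ (1/u) (−1/log u)^{1/p+1} ψ̃(u) ] du. Then lim_{t→∞} (log t)^{1/p+1} · M⁽²⁾(t) = −i ψ(0) ∫₁^∞ (e^{iw}/w²) dw. -/
open MeasureTheory Filter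

/-- `ψ̃(u) = ψ((−1/log u)^{1/p})` for `u ≠ 0`, with `ψ̃(0) = ψ(0)`. -/
noncomputable def psiTilde (p : ℝ) (ψ : ℝ → ℝ) (u : ℝ) : ℝ :=
  if u = 0 then ψ 0 else ψ ((-1 / Real.log u) ^ (1 / p))

/-- The integrand `u ↦ (1/u) (−1/log u)^{1/p+1} ψ̃(u)` to be differentiated. -/
noncomputable def gFun (p : ℝ) (ψ : ℝ → ℝ) (u : ℝ) : ℝ :=
  (1 / u) * (-1 / Real.log u) ^ (1 / p + 1) * psiTilde p ψ u

/-- `M⁽²⁾(t) = −(1/(it)) ∫_{1/t}^{1/2} e^{itu} (d/du)[(1/u)(−1/log u)^{1/p+1} ψ̃(u)] du`. -/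
noncomputable def Mtwo (p : ℝ) (ψ : ℝ → ℝ) (t : ℝ) : ℂ :=
  -(1 / (Complex.I * (t : ℂ))) *
    ∫ u in (1 / t : ℝ)..(1 / 2 : ℝ),
      Complex.exp (Complex.I * (t : ℂ) * (u : ℂ)) * ((deriv (gFun p ψ) u : ℝ) : ℂ)

/-- The bounded continuous factor in `gFun' u = u⁻² L ^ (1 / p + 1) * derivFactor p ψ L`,
where `L = -1 / log u`. -/
noncomputable def derivFactor (p : ℝ) (ψ : ℝ → ℝ) (x : ℝ) : ℝ :=
  -ψ (x ^ (1 / p)) + (1 / p + 1) * x * ψ (x ^ (1 / p))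
    + 1 / p * x ^ (1 / p + 1) * deriv ψ (x ^ (1 / p))

lemma continuous_derivFactor {p : ℝ} (hp : 0 < p) {ψ : ℝ → ℝ} (hψ : ContDiff ℝ (⊤ : ℕ∞) ψ) :
    Continuous (derivFactor p ψ) := by
  have hq : 0 ≤ 1 / p := by positivity
  have h1 : Continuous fun x : ℝ => x ^ (1 / p) := Real.continuous_rpow_const hq
  have h2 : Continuous fun x : ℝ => x ^ (1 / p + 1) := Real.continuous_rpow_const (by positivity)
  have h3 := hψ.continuous
  have h4 : Continuous (deriv ψ) := hψ.continuous_deriv (by simp)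
  unfold derivFactor
  fun_prop

lemma derivFactor_zero {p : ℝ} (hp : 0 < p) (ψ : ℝ → ℝ) : derivFactor p ψ 0 = -ψ 0 := by
  have h1 : (1 / p) ≠ 0 := by positivity
  have h2 : (1 / p + 1) ≠ 0 := by positivity
  simp [derivFactor, Real.zero_rpow h1, Real.zero_rpow h2, -one_div]

lemma neg_one_div_log_pos {u : ℝ} (h0 : 0 < u) (h1 : u < 1) : 0 < -1 / Real.log u :=
  div_pos_of_neg_of_neg (by norm_num) (Real.log_neg h0 h1)

lemma deriv_gFun (p : ℝ) {ψ : ℝ → ℝ} (hψ : ContDiff ℝ (⊤ : ℕ∞) ψ) {u : ℝ}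
    (h0 : 0 < u) (h1 : u < 1) :
    deriv (gFun p ψ) u =
      (1 / u ^ 2) * ((-1 / Real.log u) ^ (1 / p + 1) * derivFactor p ψ (-1 / Real.log u)) := by
  have hL := neg_one_div_log_pos h0 h1
  have hlog : Real.log u ≠ 0 := (Real.log_neg h0 h1).ne
  have hdL : HasDerivAt (fun u => -1 / Real.log u) ((-1 / Real.log u) ^ 2 / u) u := by
    refine ((hasDerivAt_const u (-1 : ℝ)).div (Real.hasDerivAt_log h0.ne') hlog).congr_deriv ?_
    field_simp
    ring
  have hψ' : HasDerivAt ψ (deriv ψ ((-1 / Real.log u) ^ (1 / p))) ((-1 / Real.log u) ^ (1 / p)) :=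
    (hψ.differentiable (by simp) _).hasDerivAt
  have e1 := hdL.rpow_const (p := 1 / p + 1) (Or.inl hL.ne')
  have e2 := hψ'.comp u (hdL.rpow_const (p := 1 / p) (Or.inl hL.ne'))
  have e := ((hasDerivAt_inv h0.ne').mul e1).mul e2
  have heq : gFun p ψ =ᶠ[nhds u] (((fun u : ℝ => u⁻¹) * fun u => (-1 / Real.log u) ^ (1 / p + 1)) *
      (ψ ∘ fun u => (-1 / Real.log u) ^ (1 / p))) := by
    filter_upwards [lt_mem_nhds h0] with v hv
    simp [gFun, psiTilde, hv.ne']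
  rw [heq.deriv_eq, e.deriv]
  simp only [Pi.mul_apply, Function.comp_apply]
  have r1 : (-1 / Real.log u) ^ (1 / p + 1) = (-1 / Real.log u) ^ (1 / p) * (-1 / Real.log u) :=
    Real.rpow_add_one hL.ne' _
  have r2 : (-1 / Real.log u) ^ (1 / p - 1) = (-1 / Real.log u) ^ (1 / p) / (-1 / Real.log u) :=
    Real.rpow_sub_one hL.ne' _
  rw [add_sub_cancel_right, r2, derivFactor, r1]
  generalize -1 / Real.log u = L at *
  have := hL.ne'
  generalize L ^ (1 / p) = X
  generalize (1 / p) = q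
  field_simp

/-- The rescaled integrand, after the substitution `u = w / t` and up to the factor
`exp (i w) / w ^ 2`. -/
noncomputable def amplitude (p : ℝ) (ψ : ℝ → ℝ) (t w : ℝ) : ℝ :=
  Real.log t ^ (1 / p + 1) *
    ((-1 / Real.log (w / t)) ^ (1 / p + 1) * derivFactor p ψ (-1 / Real.log (w / t)))

lemma measurable_amplitude {p : ℝ} (hp : 0 < p) {ψ : ℝ → ℝ} (hψ : ContDiff ℝ (⊤ : ℕ∞) ψ) (t : ℝ) :
    Measurable (amplitude p ψ t) := by
  have h := (continuous_derivFactor hp hψ).measurable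
  unfold amplitude
  fun_prop

lemma log_rpow_mul_Mtwo (p : ℝ) {ψ : ℝ → ℝ} (hψ : ContDiff ℝ (⊤ : ℕ∞) ψ) {t : ℝ} (ht : 2 < t) :
    ((Real.log t ^ (1 / p + 1) : ℝ) : ℂ) * Mtwo p ψ t =
      Complex.I * ∫ w in Set.Ioi (1 : ℝ), (Set.Ioc 1 (t / 2)).indicator
        (fun w : ℝ => Complex.exp (Complex.I * (w : ℂ)) / ((w : ℂ) ^ 2) *
          (amplitude p ψ t w : ℂ)) w := by
  have ht0 : 0 < t := by linarith
  have htc : (t : ℂ) ≠ 0 := by exact_mod_cast ht0.ne'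
  have hsub := intervalIntegral.integral_comp_div (a := 1) (b := t / 2)
    (fun u : ℝ => Complex.exp (Complex.I * (t : ℂ) * (u : ℂ)) * ((deriv (gFun p ψ) u : ℝ) : ℂ))
    ht0.ne'
  have hhalf : t / 2 / t = 1 / 2 := by field_simp
  rw [hhalf, Complex.real_smul] at hsub
  rw [Mtwo, setIntegral_indicator measurableSet_Ioc,
    Set.inter_eq_self_of_subset_right Set.Ioc_subset_Ioi_self,
    ← intervalIntegral.integral_of_le (by linarith)]
  have hcongr : ∫ w in (1 : ℝ)..(t / 2), Complex.exp (Complex.I * (w : ℂ)) / ((w : ℂ) ^ 2) *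
        (amplitude p ψ t w : ℂ) =
      ∫ w in (1 : ℝ)..(t / 2), (((Real.log t ^ (1 / p + 1) : ℝ) : ℂ) / (t : ℂ) ^ 2) *
        (Complex.exp (Complex.I * (t : ℂ) * ((w / t : ℝ) : ℂ)) *
          ((deriv (gFun p ψ) (w / t) : ℝ) : ℂ)) := by
    refine intervalIntegral.integral_congr fun w hw => ?_
    rw [Set.uIcc_of_le (by linarith)] at hw
    have hw0 : 0 < w := by linarith [hw.1]
    have hwc : (w : ℂ) ≠ 0 := by exact_mod_cast hw0.ne'
    have hwt : w / t < 1 := by rw [div_lt_one ht0]; linarith [hw.2]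
    have harg : Complex.I * (t : ℂ) * ((w / t : ℝ) : ℂ) = Complex.I * w := by
      push_cast; field_simp
    simp only [harg, deriv_gFun p hψ (div_pos hw0 ht0) hwt, amplitude]
    push_cast
    field_simp
  rw [hcongr, intervalIntegral.integral_const_mul, hsub]
  field_simp
  rw [Complex.I_sq]
  ring

lemma log_mul_le {t w : ℝ} (hw : 1 ≤ w) (hwt : w ≤ t / 2) :
    -1 / Real.log (w / t) ≤ 1 / Real.log 2 ∧
      Real.log t * (-1 / Real.log (w / t)) ≤ 1 + Real.log w / Real.log 2 := by
  have hw0 : 0 < w := by linarith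
  have ht0 : 0 < t := by linarith
  have h2 : 0 < Real.log 2 := Real.log_pos (by norm_num)
  have hlw : 0 ≤ Real.log w := Real.log_nonneg hw
  have hle : Real.log w ≤ Real.log t - Real.log 2 := by
    rw [← Real.log_div ht0.ne' two_ne_zero]
    exact Real.log_le_log hw0 hwt
  have hpos : 0 < Real.log t - Real.log w := by linarith
  have hL : -1 / Real.log (w / t) = 1 / (Real.log t - Real.log w) := by
    rw [Real.log_div hw0.ne' ht0.ne', ← neg_sub (Real.log t), neg_div_neg_eq]
  rw [hL]
  refine ⟨one_div_le_one_div_of_le h2 (by linarith), ?_⟩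
  have : Real.log t * (1 / (Real.log t - Real.log w)) =
      1 + Real.log w / (Real.log t - Real.log w) := by
    field_simp; ring
  rw [this]
  gcongr
  linarith

lemma one_add_log_div_rpow_le {s : ℝ} (hs : 0 < s) {w : ℝ} (hw : 1 ≤ w) :
    (1 + Real.log w / Real.log 2) ^ s ≤ (1 + 2 * s / Real.log 2) ^ s * w ^ (1 / 2 : ℝ) := by
  have hw0 : 0 < w := by linarith
  have h2 : 0 < Real.log 2 := Real.log_pos (by norm_num)
  have hlw : 0 ≤ Real.log w := Real.log_nonneg hw
  have hε : 0 < 1 / (2 * s) := by positivity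
  have h1 : 1 ≤ w ^ (1 / (2 * s)) := Real.one_le_rpow hw hε.le
  have h3 := Real.log_le_rpow_div hw0.le hε
  have h4 : 1 + Real.log w / Real.log 2 ≤ (1 + 2 * s / Real.log 2) * w ^ (1 / (2 * s)) := by
    calc 1 + Real.log w / Real.log 2
        ≤ w ^ (1 / (2 * s)) + (w ^ (1 / (2 * s)) / (1 / (2 * s))) / Real.log 2 := by gcongr
      _ = _ := by field_simp
  calc (1 + Real.log w / Real.log 2) ^ s
      ≤ ((1 + 2 * s / Real.log 2) * w ^ (1 / (2 * s))) ^ s :=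
        Real.rpow_le_rpow (by positivity) h4 hs.le
    _ = _ := by
        rw [Real.mul_rpow (by positivity) (by positivity), ← Real.rpow_mul hw0.le]
        congr 2
        field_simp

lemma amplitude_eq (p : ℝ) (ψ : ℝ → ℝ) {t w : ℝ} (hw : 0 < w) (hwt : w < t) (ht : 1 ≤ t) :
    amplitude p ψ t w = (Real.log t * (-1 / Real.log (w / t))) ^ (1 / p + 1) *
      derivFactor p ψ (-1 / Real.log (w / t)) := by
  have ht0 : 0 < t := hw.trans hwt
  rw [amplitude, Real.mul_rpow (Real.log_nonneg ht)
    (neg_one_div_log_pos (div_pos hw ht0) ((div_lt_one ht0).2 hwt)).le, mul_assoc]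

lemma exists_abs_amplitude_le {p : ℝ} (hp : 0 < p) {ψ : ℝ → ℝ} (hψ : ContDiff ℝ (⊤ : ℕ∞) ψ) :
    ∃ K : ℝ, 0 ≤ K ∧ ∀ t w : ℝ, 1 ≤ w → w ≤ t / 2 → |amplitude p ψ t w| ≤ K * w ^ (1 / 2 : ℝ) := by
  obtain ⟨C, hC⟩ := (isCompact_Icc (a := (0 : ℝ)) (b := 1 / Real.log 2)).exists_bound_of_continuousOn
    (continuous_derivFactor hp hψ).continuousOn
  have h2 : 0 < Real.log 2 := Real.log_pos (by norm_num)
  have hC0 : 0 ≤ C := (norm_nonneg _).trans (hC 0 ⟨le_rfl, by positivity⟩)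
  have hs : 0 < 1 / p + 1 := by positivity
  refine ⟨(1 + 2 * (1 / p + 1) / Real.log 2) ^ (1 / p + 1) * C, by positivity, ?_⟩
  intro t w hw hwt
  have hw0 : 0 < w := by linarith
  have ht0 : 0 < t := by linarith
  obtain ⟨hL1, hL2⟩ := log_mul_le hw hwt
  have hL0 := neg_one_div_log_pos (div_pos hw0 ht0) ((div_lt_one ht0).2 (by linarith : w < t))
  have hlt : 0 ≤ Real.log t := Real.log_nonneg (by linarith)
  have hX : 0 ≤ Real.log t * (-1 / Real.log (w / t)) := mul_nonneg hlt hL0.le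
  have hb := hC _ ⟨hL0.le, hL1⟩
  rw [Real.norm_eq_abs] at hb
  rw [amplitude_eq p ψ hw0 (by linarith) (by linarith), abs_mul,
    abs_of_nonneg (Real.rpow_nonneg hX _)]
  calc _ ≤ ((1 + 2 * (1 / p + 1) / Real.log 2) ^ (1 / p + 1) * w ^ (1 / 2 : ℝ)) * C :=
        mul_le_mul ((Real.rpow_le_rpow hX hL2 hs.le).trans (one_add_log_div_rpow_le hs hw)) hb
          (abs_nonneg _) (by positivity)
    _ = _ := by ring

lemma tendsto_amplitude {p : ℝ} (hp : 0 < p) {ψ : ℝ → ℝ} (hψ : ContDiff ℝ (⊤ : ℕ∞) ψ) {w : ℝ}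
    (hw : 0 < w) : Tendsto (fun t => amplitude p ψ t w) atTop (nhds (-ψ 0)) := by
  have hsub : Tendsto (fun t => Real.log t - Real.log w) atTop atTop :=
    tendsto_atTop_add_const_right _ _ Real.tendsto_log_atTop
  have hinv : Tendsto (fun t => 1 / (Real.log t - Real.log w)) atTop (nhds 0) :=
    tendsto_const_nhds.div_atTop hsub
  have hratio : Tendsto (fun t => 1 + Real.log w * (1 / (Real.log t - Real.log w))) atTop
      (nhds 1) := by
    simpa using (hinv.const_mul (Real.log w)).const_add 1
  have hmain := (hratio.rpow_const (p := 1 / p + 1) (Or.inl one_ne_zero)).mul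
    (((continuous_derivFactor hp hψ).tendsto 0).comp hinv)
  rw [Real.one_rpow, one_mul, derivFactor_zero hp] at hmain
  refine hmain.congr' ?_
  filter_upwards [eventually_gt_atTop w, eventually_ge_atTop 1] with t hwt ht
  have ht0 : 0 < t := hw.trans hwt
  have hpos : 0 < Real.log t - Real.log w := sub_pos.2 (Real.log_lt_log hw hwt)
  have hL : -1 / Real.log (w / t) = 1 / (Real.log t - Real.log w) := by
    rw [Real.log_div hw.ne' ht0.ne', ← neg_sub (Real.log t), neg_div_neg_eq]
  have hr : Real.log t * (1 / (Real.log t - Real.log w)) =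
      1 + Real.log w * (1 / (Real.log t - Real.log w)) := by
    field_simp; ring
  rw [amplitude_eq p ψ hw hwt ht, hL, hr, Function.comp_apply]

theorem stmt8 (p : ℝ) (hp : 0 < p) (ψ : ℝ → ℝ) (hψ : ContDiff ℝ (⊤ : ℕ∞) ψ)
    (hsupp : Function.support ψ ⊆ Set.Ioo (-1 / Real.log 2) (1 / Real.log 2)) :
    Tendsto (fun t : ℝ => (((Real.log t) ^ (1 / p + 1) : ℝ) : ℂ) * Mtwo p ψ t)
      atTop
      (nhds (-Complex.I * ((ψ 0 : ℝ) : ℂ) *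
        ∫ w in Set.Ioi (1 : ℝ), Complex.exp (Complex.I * (w : ℂ)) / ((w : ℂ) ^ 2))) := by
  obtain ⟨K, hK0, hK⟩ := exists_abs_amplitude_le hp hψ
  have hlim : Tendsto (fun t : ℝ => ∫ w in Set.Ioi (1 : ℝ), (Set.Ioc 1 (t / 2)).indicator
        (fun w : ℝ => Complex.exp (Complex.I * (w : ℂ)) / ((w : ℂ) ^ 2) *
          (amplitude p ψ t w : ℂ)) w) atTop
      (nhds (∫ w in Set.Ioi (1 : ℝ), Complex.exp (Complex.I * (w : ℂ)) / ((w : ℂ) ^ 2) *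
        ((-ψ 0 : ℝ) : ℂ))) := by
    refine tendsto_integral_filter_of_dominated_convergence
      (fun w => K * w ^ (-(3 / 2) : ℝ)) ?_ ?_ ?_ ?_
    · refine Eventually.of_forall fun t => ?_
      have := measurable_amplitude hp hψ t
      refine (Measurable.indicator ?_ measurableSet_Ioc).aestronglyMeasurable
      fun_prop
    · refine Eventually.of_forall fun t => ?_
      filter_upwards [ae_restrict_mem measurableSet_Ioi] with w hw
      have hw1 : 1 < w := hw
      have hw0 : 0 < w := by linarith
      by_cases hwt : w ∈ Set.Ioc 1 (t / 2)
      · rw [Set.indicator_of_mem hwt, norm_mul, norm_div, mul_comm Complex.I,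
          Complex.norm_exp_ofReal_mul_I, norm_pow, Complex.norm_real, Complex.norm_real,
          Real.norm_of_nonneg hw0.le, Real.norm_eq_abs]
        calc 1 / w ^ 2 * |amplitude p ψ t w| ≤ 1 / w ^ 2 * (K * w ^ (1 / 2 : ℝ)) := by
              gcongr
              exact hK t w hw1.le hwt.2
          _ = K * w ^ (-(3 / 2) : ℝ) := by
              rw [show (-(3 / 2) : ℝ) = 1 / 2 - (2 : ℕ) by norm_num, Real.rpow_sub_natCast hw0.ne']
              ring
      · rw [Set.indicator_of_notMem hwt, norm_zero]
        positivity
    · exact (integrableOn_Ioi_rpow_of_lt (by norm_num) one_pos).const_mul K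
    · filter_upwards [ae_restrict_mem measurableSet_Ioi] with w hw
      have hw1 : 1 < w := hw
      have h := ((Complex.continuous_ofReal.tendsto _).comp
        (tendsto_amplitude hp hψ (by linarith : 0 < w))).const_mul
          (Complex.exp (Complex.I * (w : ℂ)) / ((w : ℂ) ^ 2))
      refine h.congr' ?_
      filter_upwards [eventually_ge_atTop (2 * w)] with t ht
      have hmem : w ∈ Set.Ioc 1 (t / 2) := ⟨hw1, by linarith⟩
      rw [Set.indicator_of_mem hmem, Function.comp_apply]
  have hfin := hlim.const_mul Complex.I
  rw [integral_mul_const] at hfin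
  have hval : ∀ J : ℂ, Complex.I * (J * ((-ψ 0 : ℝ) : ℂ)) = -Complex.I * ((ψ 0 : ℝ) : ℂ) * J := by
    intro J
    push_cast
    ring
  rw [hval] at hfin
  refine hfin.congr' ?_
  filter_upwards [eventually_gt_atTop 2] with t ht
  exact (log_rpow_mul_Mtwo p hψ ht).symm
end

section
/- Let p > 0 be a real number, let q ≥ 2 be an integer, and let ψ : ℝ → ℝ be a smooth compactly supported function. Define K⁽¹⁾(t) = L⁽¹⁾(t;ψ) · ∫₀^∞ e^{−(1−it)x₂^q} dx₂ for t > 1. Then lim_{t→∞} t^{1/q} (log t)^{1/p} · K⁽¹⁾(t) = Γ(1/q + 1) · e^{iπ/(2q)} · ψ(0). -/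
open MeasureTheory Filter

/-- `L⁽¹⁾(t;ψ) = ∫₀^{(log t)^{-1/p}} e^{i t exp(-1/x^p)} ψ(x) dx`. -/
noncomputable def Lone (p t : ℝ) (ψ : ℝ → ℝ) : ℂ :=
  ∫ x in Set.Ioo (0 : ℝ) ((Real.log t) ^ (-(1 / p))),
    Complex.exp (Complex.I * (t : ℂ) * ((Real.exp (-1 / x ^ p) : ℝ) : ℂ)) * ((ψ x : ℝ) : ℂ)

/-- `K⁽¹⁾(t) = L⁽¹⁾(t;ψ) ⬝ ∫₀^∞ e^{−(1−it)x₂^q} dx₂`. -/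
noncomputable def Kone (p : ℝ) (q : ℕ) (ψ : ℝ → ℝ) (t : ℝ) : ℂ :=
  Lone p t ψ *
    ∫ x₂ in Set.Ioi (0 : ℝ), Complex.exp (-(1 - (t : ℂ) * Complex.I) * (x₂ : ℂ) ^ q)

theorem norm_cexp_neg_mul_ofReal_pow (b : ℂ) (x : ℝ) (q : ℕ) :
    ‖Complex.exp (-b * (x : ℂ) ^ q)‖ = Real.exp (-b.re * x ^ q) := by
  rw [Complex.norm_exp, ← Complex.ofReal_pow, Complex.re_mul_ofReal, Complex.neg_re]

theorem hasDerivAt_integral_cexp_neg_mul_pow {q : ℕ} (hq : q ≠ 0) {b : ℂ} (hb : 0 < b.re) :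
    HasDerivAt (fun b : ℂ => ∫ x in Set.Ioi (0 : ℝ), Complex.exp (-b * (x : ℂ) ^ q))
      (∫ x in Set.Ioi (0 : ℝ), -(x : ℂ) ^ q * Complex.exp (-b * (x : ℂ) ^ q)) b := by
  have hq' : (0 : ℝ) < q := by positivity
  have hopen : IsOpen {z : ℂ | b.re / 2 < z.re} := isOpen_lt continuous_const Complex.continuous_re
  refine (hasDerivAt_integral_of_dominated_loc_of_deriv_le
    (F' := fun (z : ℂ) (x : ℝ) => -(x : ℂ) ^ q * Complex.exp (-z * (x : ℂ) ^ q))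
    (bound := fun x : ℝ => x ^ (q : ℝ) * Real.exp (-(b.re / 2) * x ^ (q : ℝ)))
    (hopen.mem_nhds (by show b.re / 2 < b.re; linarith))
    (.of_forall fun z => ?_) ?_ ?_ ?_ ?_ ?_).2
  · exact Continuous.aestronglyMeasurable (by fun_prop)
  · have hint := integrableOn_rpow_mul_exp_neg_mul_rpow (s := 0) (by norm_num) hq' hb
    refine hint.mono' (Continuous.aestronglyMeasurable (by fun_prop)) (.of_forall fun x => ?_)
    rw [norm_cexp_neg_mul_ofReal_pow]
    simp
  · exact Continuous.aestronglyMeasurable (by fun_prop)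
  · refine ae_restrict_of_forall_mem measurableSet_Ioi fun x (hx : 0 < x) z hz => ?_
    rw [norm_mul, norm_cexp_neg_mul_ofReal_pow, norm_neg, norm_pow, Complex.norm_real,
      Real.norm_of_nonneg hx.le, Real.rpow_natCast]
    have hz' : b.re / 2 < z.re := hz
    gcongr
  · exact integrableOn_rpow_mul_exp_neg_mul_rpow (by linarith) hq' (by linarith)
  · refine .of_forall fun x z _ => ?_
    have h := (((hasDerivAt_id z).neg.mul_const ((x : ℂ) ^ q)).cexp)
    convert! h using 1
    simp
    ring

theorem integral_cexp_neg_mul_pow {q : ℕ} (hq : q ≠ 0) {b : ℂ} (hb : 0 < b.re) :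
    ∫ x in Set.Ioi (0 : ℝ), Complex.exp (-b * (x : ℂ) ^ q) =
      b ^ (-(1 / (q : ℂ))) * ((Real.Gamma (1 / (q : ℝ) + 1) : ℝ) : ℂ) := by
  have hq' : (0 : ℝ) < q := by positivity
  have hopen : IsOpen {z : ℂ | 0 < z.re} := isOpen_lt continuous_const Complex.continuous_re
  have hF : AnalyticOnNhd ℂ
      (fun b : ℂ => ∫ x in Set.Ioi (0 : ℝ), Complex.exp (-b * (x : ℂ) ^ q)) {z | 0 < z.re} :=
    DifferentiableOn.analyticOnNhd (fun z hz =>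
      (hasDerivAt_integral_cexp_neg_mul_pow hq hz).differentiableAt.differentiableWithinAt) hopen
  have hG : AnalyticOnNhd ℂ
      (fun b : ℂ => b ^ (-(1 / (q : ℂ))) * ((Real.Gamma (1 / (q : ℝ) + 1) : ℝ) : ℂ))
      {z | 0 < z.re} :=
    DifferentiableOn.analyticOnNhd (fun z hz =>
      ((differentiableAt_id.cpow_const (Or.inl hz)).mul_const _).differentiableWithinAt) hopen
  refine hF.eqOn_of_preconnected_of_frequently_eq hG
    (convex_halfSpace_re_gt 0).isPreconnected (z₀ := 1) (by simp) ?_ hb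
  have hreal : ∀ r : ℝ, 0 < r →
      ∫ x in Set.Ioi (0 : ℝ), Complex.exp (-(r : ℂ) * (x : ℂ) ^ q) =
      (r : ℂ) ^ (-(1 / (q : ℂ))) * ((Real.Gamma (1 / (q : ℝ) + 1) : ℝ) : ℂ) := by
    intro r hr
    have h := integral_exp_neg_mul_rpow hq' hr
    have h2 : (r : ℂ) ^ (-(1 / (q : ℂ))) = ((r ^ (-1 / (q : ℝ)) : ℝ) : ℂ) := by
      rw [Complex.ofReal_cpow hr.le]
      push_cast
      rw [neg_div]
    rw [h2, ← Complex.ofReal_mul, ← h, ← integral_complex_ofReal]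
    simp [Real.rpow_natCast]
  have htend : Tendsto (fun r : ℝ => (r : ℂ)) (nhdsWithin 1 (Set.Ioi 1))
      (nhdsWithin (1 : ℂ) {1}ᶜ) := by
    refine tendsto_nhdsWithin_iff.2 ⟨?_, ?_⟩
    · exact (Complex.continuous_ofReal.tendsto' 1 1 (by simp)).mono_left nhdsWithin_le_nhds
    · filter_upwards [self_mem_nhdsWithin] with r hr
      have hr' : (1 : ℝ) < r := hr
      simpa using hr'.ne'
  refine htend.frequently (Eventually.frequently ?_)
  filter_upwards [self_mem_nhdsWithin] with r hr
  exact hreal r (zero_lt_one.trans hr)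

theorem tendsto_rpow_mul_one_sub_mul_I_cpow (a : ℝ) :
    Tendsto (fun t : ℝ => ((t ^ a : ℝ) : ℂ) * (1 - (t : ℂ) * Complex.I) ^ (-(a : ℂ)))
      atTop (nhds (Complex.exp (((Real.pi / 2 * a : ℝ) : ℂ) * Complex.I))) := by
  have hinv : Tendsto (fun t : ℝ => ((t⁻¹ : ℝ) : ℂ) - Complex.I) atTop (nhds (-Complex.I)) := by
    have h := (Complex.continuous_ofReal.tendsto 0).comp tendsto_inv_atTop_zero
    simpa using h.sub_const Complex.I
  have hcont : ContinuousAt (fun z : ℂ => z ^ (-(a : ℂ))) (-Complex.I) :=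
    continuousAt_cpow_const (by simp [Complex.mem_slitPlane_iff])
  have hval : (-Complex.I) ^ (-(a : ℂ)) =
      Complex.exp (((Real.pi / 2 * a : ℝ) : ℂ) * Complex.I) := by
    rw [Complex.cpow_def_of_ne_zero (by simp), Complex.log_neg_I]
    congr 1
    push_cast
    ring
  rw [← hval]
  refine (hcont.tendsto.comp hinv).congr' ?_
  filter_upwards [eventually_gt_atTop 0] with t ht
  have ht' : (t : ℂ) ≠ 0 := Complex.ofReal_ne_zero.2 ht.ne'
  have hfac : 1 - (t : ℂ) * Complex.I = (t : ℂ) * (((t⁻¹ : ℝ) : ℂ) - Complex.I) := by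
    push_cast
    field_simp
  have hne : ((t⁻¹ : ℝ) : ℂ) - Complex.I ≠ 0 := fun h => by
    simpa using congrArg Complex.im h
  have hmul : ((t : ℂ) * (((t⁻¹ : ℝ) : ℂ) - Complex.I)) ^ (-(a : ℂ)) =
      (t : ℂ) ^ (-(a : ℂ)) * (((t⁻¹ : ℝ) : ℂ) - Complex.I) ^ (-(a : ℂ)) := by
    rw [Complex.cpow_def_of_ne_zero (mul_ne_zero ht' hne), Complex.cpow_def_of_ne_zero ht',
      Complex.cpow_def_of_ne_zero hne, Complex.log_ofReal_mul ht hne, ← Complex.exp_add,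
      Complex.ofReal_log ht.le, add_mul]
  rw [Function.comp_apply, hfac, hmul, Complex.ofReal_cpow ht.le, ← mul_assoc,
    ← Complex.cpow_add _ _ ht', add_neg_cancel, Complex.cpow_zero, one_mul]

theorem rpow_mul_Lone_eq {p t : ℝ} (ht : 1 < t) (ψ : ℝ → ℝ) :
    (((Real.log t) ^ (1 / p) : ℝ) : ℂ) * Lone p t ψ =
      ∫ u in Set.Ioo (0 : ℝ) 1,
        Complex.exp (Complex.I * (t : ℂ) *
          ((Real.exp (-1 / ((Real.log t) ^ (-(1 / p)) * u) ^ p) : ℝ) : ℂ)) *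
          ((ψ ((Real.log t) ^ (-(1 / p)) * u) : ℝ) : ℂ) := by
  have hlog : 0 < Real.log t := Real.log_pos ht
  have hs : 0 < (Real.log t) ^ (-(1 / p)) := by positivity
  have hinv : (Real.log t) ^ (1 / p) = ((Real.log t) ^ (-(1 / p)))⁻¹ := by
    rw [Real.rpow_neg hlog.le, inv_inv]
  rw [Lone, hinv]
  generalize (Real.log t) ^ (-(1 / p)) = s at *
  rw [← integral_Ioc_eq_integral_Ioo, ← integral_Ioc_eq_integral_Ioo,
    ← intervalIntegral.integral_of_le hs.le, ← intervalIntegral.integral_of_le zero_le_one]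
  have h := intervalIntegral.integral_comp_mul_left (a := 0) (b := 1)
    (fun x : ℝ => Complex.exp (Complex.I * (t : ℂ) * ((Real.exp (-1 / x ^ p) : ℝ) : ℂ)) *
      ((ψ x : ℝ) : ℂ)) hs.ne'
  rw [mul_zero, mul_one] at h
  rw [h, Complex.real_smul]

theorem tendsto_mul_exp_neg_inv_rpow {p u : ℝ} (hp : 0 < p) (hu : u ∈ Set.Ioo (0 : ℝ) 1) :
    Tendsto (fun t : ℝ => t * Real.exp (-1 / ((Real.log t) ^ (-(1 / p)) * u) ^ p))
      atTop (nhds 0) := by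
  have hup : 0 < u ^ p := Real.rpow_pos_of_pos hu.1 p
  have hneg : 1 - (u ^ p)⁻¹ < 0 :=
    sub_neg.2 ((one_lt_inv₀ hup).2 (Real.rpow_lt_one hu.1.le hu.2 hp))
  refine (Real.tendsto_exp_atBot.comp
    (Real.tendsto_log_atTop.atTop_mul_const_of_neg hneg)).congr' ?_
  filter_upwards [eventually_gt_atTop 1] with t ht
  have hlog : 0 < Real.log t := Real.log_pos ht
  have hpow : ((Real.log t) ^ (-(1 / p)) * u) ^ p = (Real.log t)⁻¹ * u ^ p := by
    rw [Real.mul_rpow (by positivity) hu.1.le, ← Real.rpow_mul hlog.le, neg_mul,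
      one_div_mul_cancel hp.ne', Real.rpow_neg_one]
  nth_rewrite 2 [← Real.exp_log (zero_lt_one.trans ht)]
  rw [Function.comp_apply, hpow, ← Real.exp_add]
  congr 1
  field_simp
  ring

theorem tendsto_rpow_mul_Lone {p : ℝ} (hp : 0 < p) {ψ : ℝ → ℝ} (hψ : Continuous ψ)
    (hψc : HasCompactSupport ψ) :
    Tendsto (fun t : ℝ => (((Real.log t) ^ (1 / p) : ℝ) : ℂ) * Lone p t ψ)
      atTop (nhds ((ψ 0 : ℝ) : ℂ)) := by
  obtain ⟨C, hC⟩ := hψc.exists_bound_of_continuous hψ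
  have hconst : ((ψ 0 : ℝ) : ℂ) = ∫ _ in Set.Ioo (0 : ℝ) 1, ((ψ 0 : ℝ) : ℂ) := by simp
  rw [hconst]
  refine Tendsto.congr' ((eventually_gt_atTop 1).mono fun t ht => (rpow_mul_Lone_eq ht ψ).symm) ?_
  refine tendsto_integral_filter_of_dominated_convergence (fun _ => C)
    (.of_forall fun t => ?_) (.of_forall fun t => .of_forall fun u => ?_) (by simp)
    (ae_restrict_of_forall_mem measurableSet_Ioo fun u hu => ?_)
  · have := hψ.measurable
    exact Measurable.aestronglyMeasurable (by fun_prop)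
  · rw [norm_mul, mul_assoc, ← Complex.ofReal_mul, mul_comm Complex.I,
      Complex.norm_exp_ofReal_mul_I, one_mul, Complex.norm_real]
    exact hC _
  · have hs : Tendsto (fun t : ℝ => (Real.log t) ^ (-(1 / p)) * u) atTop (nhds 0) := by
      have h := (tendsto_rpow_neg_atTop (one_div_pos.2 hp)).comp Real.tendsto_log_atTop
      simpa using h.mul_const u
    have hψs := (Complex.continuous_ofReal.comp hψ).tendsto 0 |>.comp hs
    have hcexp := ((by fun_prop : Continuous fun r : ℝ => Complex.exp (Complex.I * (r : ℂ))).tendsto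
      0).comp (tendsto_mul_exp_neg_inv_rpow hp hu)
    simpa [Function.comp_def, mul_assoc] using hcexp.mul hψs

theorem stmt11 (p : ℝ) (hp : 0 < p) (q : ℕ) (hq : 2 ≤ q)
    (ψ : ℝ → ℝ) (hψ : ContDiff ℝ (⊤ : ℕ∞) ψ) (hψc : HasCompactSupport ψ) :
    Tendsto (fun t : ℝ =>
        ((t ^ (1 / (q : ℝ)) * (Real.log t) ^ (1 / p) : ℝ) : ℂ) * Kone p q ψ t)
      atTop
      (nhds (((Real.Gamma (1 / (q : ℝ) + 1) : ℝ) : ℂ) *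
        Complex.exp (((Real.pi / (2 * (q : ℝ)) : ℝ) : ℂ) * Complex.I) *
        ((ψ 0 : ℝ) : ℂ))) := by
  have hq0 : q ≠ 0 := by omega
  have hcpow := tendsto_rpow_mul_one_sub_mul_I_cpow (1 / (q : ℝ))
  have hlim := (hcpow.mul (tendsto_rpow_mul_Lone hp hψ.continuous hψc)).const_mul
    ((Real.Gamma (1 / (q : ℝ) + 1) : ℝ) : ℂ)
  have hangle : Real.pi / 2 * (1 / (q : ℝ)) = Real.pi / (2 * (q : ℝ)) := by
    rw [mul_one_div, div_div]
  rw [hangle, ← mul_assoc] at hlim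
  refine hlim.congr fun t => ?_
  rw [Kone, integral_cexp_neg_mul_pow hq0 (by simp)]
  push_cast
  ring
end

section
/- Let p > 0 be a real number, let q ≥ 2 be an integer, and let R : ℝ² → ℝ be a smooth compactly supported function. Define K⁽³⁾(t) = ∫₀^∞ e^{i t x₂^q} L⁽¹⁾(t; R(·,x₂)) x₂ dx₂ for t > 1. Then there exist constants C > 0 and t₀ > 1 such that |K⁽³⁾(t)| ≤ C t^{−2/q} (log t)^{−1/p} for all t ≥ t₀. -/
open MeasureTheory Filter

/-- `K⁽³⁾(t) = ∫₀^∞ e^{i t x₂^q} L⁽¹⁾(t; R(·,x₂)) x₂ dx₂`. -/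
noncomputable def Kthree (p : ℝ) (q : ℕ) (R : ℝ × ℝ → ℝ) (t : ℝ) : ℂ :=
  ∫ x₂ in Set.Ioi (0 : ℝ),
    Complex.exp (Complex.I * (t : ℂ) * ((x₂ ^ q : ℝ) : ℂ)) *
      Lone p t (fun x₁ => R (x₁, x₂)) * ((x₂ : ℝ) : ℂ)

/-- If `g` is bounded by `M` with derivative bounded by `M'` and vanishes at `A`, then integrating by
parts against the phase `t x ^ q` on `[δ, A]`, where `t δ ^ q = 1`, gains a factor `δ ^ 2`. -/
theorem norm_integral_exp_pow_mul_le_of_pos {q : ℕ} (hq : 2 ≤ q) {g g' : ℝ → ℝ} {M M' A t δ : ℝ}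
    (hg : ∀ x, HasDerivAt g (g' x) x) (hg' : Continuous g')
    (hM : ∀ x, |g x| ≤ M) (hM' : ∀ x, |g' x| ≤ M') (hA : g A = 0)
    (hδ : 0 < δ) (hδA : δ ≤ A) (ht : t * δ ^ q = 1) :
    ‖∫ x in δ..A, Complex.exp (Complex.I * (t : ℂ) * ((x ^ q : ℝ) : ℂ)) * ((g x : ℝ) : ℂ) *
      ((x : ℝ) : ℂ)‖ ≤ (2 * M + M' * A) * δ ^ 2 := by
  have hM0 : 0 ≤ M := (abs_nonneg _).trans (hM 0)
  have hM0' : 0 ≤ M' := (abs_nonneg _).trans (hM' 0)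
  have htpos : 0 < t := by
    refine pos_of_mul_pos_left ?_ (pow_pos hδ q).le
    rw [ht]
    exact one_pos
  have hgc : Continuous g := continuous_iff_continuousAt.2 fun x => (hg x).continuousAt
  set m : ℤ := 2 - (q : ℤ) with hm
  set e : ℝ → ℂ := fun x => Complex.exp (Complex.I * (t : ℂ) * ((x ^ q : ℝ) : ℂ)) with he
  have hec : Continuous e := by simp only [he]; fun_prop
  have hen : ∀ x, ‖e x‖ = 1 := fun x => by
    have : Complex.I * (t : ℂ) * ((x ^ q : ℝ) : ℂ) = ((t * x ^ q : ℝ) : ℂ) * Complex.I := by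
      push_cast; ring
    simp only [he, this, Complex.norm_exp_ofReal_mul_I]
  have hed : ∀ x, HasDerivAt e (e x * (Complex.I * (t : ℂ) * ((q * x ^ (q - 1) : ℝ) : ℂ))) x :=
    fun x => (((hasDerivAt_pow q x).ofReal_comp).const_mul _).cexp
  have hpos : ∀ x ∈ Set.uIcc δ A, 0 < x := fun x hx => by
    rw [Set.uIcc_of_le hδA] at hx; exact hδ.trans_le hx.1
  have hzc : ∀ k : ℤ, ContinuousOn (fun x : ℝ => x ^ k) (Set.uIcc δ A) := fun k x hx =>
    (continuousAt_zpow₀ x k (Or.inl (hpos x hx).ne')).continuousWithinAt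
  set r : ℝ → ℝ := fun x => (m : ℝ) * x ^ (m - 1) * g x + x ^ m * g' x with hr
  have hrc : ContinuousOn r (Set.uIcc δ A) :=
    ((continuousOn_const.mul (hzc _)).mul hgc.continuousOn).add ((hzc _).mul hg'.continuousOn)
  have hmain : ContinuousOn (fun x => e x * ((g x : ℝ) : ℂ) * ((x : ℝ) : ℂ)) (Set.uIcc δ A) := by
    fun_prop
  have hrest : ContinuousOn (fun x => e x * ((r x : ℝ) : ℂ)) (Set.uIcc δ A) :=
    hec.continuousOn.mul (Complex.continuous_ofReal.comp_continuousOn hrc)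
  have hFd : ∀ x ∈ Set.uIcc δ A, HasDerivAt (fun x => e x * ((x ^ m * g x : ℝ) : ℂ))
      (Complex.I * (t * q) * (e x * ((g x : ℝ) : ℂ) * ((x : ℝ) : ℂ)) + e x * ((r x : ℝ) : ℂ)) x := by
    intro x hx
    have hx0 := hpos x hx
    have h1 := ((hasDerivAt_zpow m x (Or.inl hx0.ne')).mul (hg x)).ofReal_comp
    refine ((hed x).mul h1).congr_deriv ?_
    have h2 : x ^ (q - 1) * x ^ m = x := by
      rw [← zpow_natCast, ← zpow_add₀ hx0.ne']
      have : ((q - 1 : ℕ) : ℤ) + m = 1 := by omega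
      rw [this, zpow_one]
    have h3 : ((x ^ (q - 1) : ℝ) : ℂ) * ((x ^ m : ℝ) : ℂ) = (x : ℂ) := by
      rw [← Complex.ofReal_mul, h2]
    simp only [hr, Pi.mul_apply, Complex.ofReal_mul, Complex.ofReal_add]
    rw [← h3]
    push_cast
    ring
  have hFTC := intervalIntegral.integral_eq_sub_of_hasDerivAt hFd
    (((continuousOn_const.mul hmain).add hrest).intervalIntegrable)
  rw [intervalIntegral.integral_add (hmain.intervalIntegrable.const_mul _)
    hrest.intervalIntegrable, intervalIntegral.integral_const_mul] at hFTC
  have hzint : IntervalIntegrable (fun x : ℝ => -((m : ℝ) * x ^ (m - 1))) volume δ A :=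
    (continuousOn_const.mul (hzc _)).neg.intervalIntegrable
  have hz : ∫ x in δ..A, -((m : ℝ) * x ^ (m - 1)) = δ ^ m - A ^ m := by
    rw [intervalIntegral.integral_eq_sub_of_hasDerivAt (f := fun x : ℝ => -x ^ m)
      (fun x hx => (hasDerivAt_zpow m x (Or.inl (hpos x hx).ne')).neg) hzint]
    ring
  have hmle : (m : ℝ) ≤ 0 := by exact_mod_cast (by omega : m ≤ 0)
  have hbound : ‖∫ x in δ..A, e x * ((r x : ℝ) : ℂ)‖ ≤
      ∫ x in δ..A, (M * -((m : ℝ) * x ^ (m - 1)) + δ ^ m * M') := by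
    refine intervalIntegral.norm_integral_le_of_norm_le hδA (Eventually.of_forall fun x hx => ?_)
      ((hzint.const_mul M).add intervalIntegrable_const)
    have hx0 : 0 < x := hδ.trans hx.1
    rw [norm_mul, hen, one_mul, Complex.norm_real, Real.norm_eq_abs]
    refine (abs_add_le _ _).trans (add_le_add ?_ ?_)
    · have h : 0 ≤ -((m : ℝ) * x ^ (m - 1)) := by
        have := zpow_pos hx0 (m - 1)
        nlinarith
      rw [abs_mul, ← abs_neg, abs_of_nonneg h, mul_comm]
      exact mul_le_mul_of_nonneg_right (hM x) h
    · rw [abs_mul, abs_of_pos (zpow_pos hx0 m)]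
      have hxm : x ^ m ≤ δ ^ m := by
        have hmn : m = -((q - 2 : ℕ) : ℤ) := by omega
        rw [hmn, zpow_neg, zpow_neg, zpow_natCast, zpow_natCast]
        exact inv_anti₀ (pow_pos hδ _) (pow_le_pow_left₀ hδ.le hx.1.le _)
      exact mul_le_mul hxm (hM' x) (abs_nonneg _) (zpow_pos hδ m).le
  rw [intervalIntegral.integral_add (hzint.const_mul M) intervalIntegrable_const,
    intervalIntegral.integral_const_mul, hz, intervalIntegral.integral_const, smul_eq_mul] at hbound
  set J := ∫ x in δ..A, e x * ((g x : ℝ) : ℂ) * ((x : ℝ) : ℂ) with hJ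
  have hδm : δ ^ m = t * δ ^ 2 := by
    rw [hm, zpow_sub₀ hδ.ne', zpow_natCast, div_eq_iff (pow_pos hδ q).ne']
    have : t * δ ^ 2 * δ ^ q = (t * δ ^ q) * δ ^ 2 := by ring
    rw [this, ht, one_mul]; norm_cast
  have hJn : t * q * ‖J‖ ≤ (2 * M + M' * A) * (t * δ ^ 2) := by
    have h1 : Complex.I * (t * q) * J =
        -(e δ * ((δ ^ m * g δ : ℝ) : ℂ)) - ∫ x in δ..A, e x * ((r x : ℝ) : ℂ) := by
      rw [hA] at hFTC
      rw [eq_sub_iff_add_eq, hFTC]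
      simp
    have h2 : ‖Complex.I * (t * q) * J‖ = t * q * ‖J‖ := by
      simp [abs_of_pos htpos]
    have h3 : ‖-(e δ * ((δ ^ m * g δ : ℝ) : ℂ))‖ ≤ δ ^ m * M := by
      rw [norm_neg, norm_mul, hen, one_mul, Complex.norm_real, Real.norm_eq_abs, abs_mul,
        abs_of_pos (zpow_pos hδ m)]
      exact mul_le_mul_of_nonneg_left (hM δ) (zpow_pos hδ m).le
    rw [← h2, h1]
    refine (norm_sub_le _ _).trans ((add_le_add h3 hbound).trans ?_)
    have hAm := zpow_pos (hδ.trans_le hδA) m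
    have h4 : 0 ≤ δ * (δ ^ m * M') := by have := zpow_pos hδ m; positivity
    rw [← hδm]
    nlinarith [mul_nonneg hM0 hAm.le]
  have hq1 : (1 : ℝ) ≤ q := by exact_mod_cast (by omega : 1 ≤ q)
  have h5 : t * ‖J‖ ≤ t * ((2 * M + M' * A) * δ ^ 2) := by
    have h6 : t * ‖J‖ ≤ t * q * ‖J‖ :=
      mul_le_mul_of_nonneg_right (le_mul_of_one_le_right htpos.le hq1) (norm_nonneg _)
    linarith
  exact le_of_mul_le_mul_left h5 htpos

/-- An oscillatory integral with phase `t x ^ q` and amplitude `g x * x` on the half line decays like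
`t ^ (-2 / q)`, with a constant depending only on bounds for `g`, `g'` and the support of `g`. -/
theorem norm_integral_Ioi_exp_pow_mul_le {q : ℕ} (hq : 2 ≤ q) {g g' : ℝ → ℝ} {M M' A t : ℝ}
    (hg : ∀ x, HasDerivAt g (g' x) x) (hg' : Continuous g')
    (hM : ∀ x, |g x| ≤ M) (hM' : ∀ x, |g' x| ≤ M') (hA1 : 1 ≤ A) (hA : ∀ x, A ≤ x → g x = 0)
    (ht : 1 ≤ t) :
    ‖∫ x in Set.Ioi (0 : ℝ), Complex.exp (Complex.I * (t : ℂ) * ((x ^ q : ℝ) : ℂ)) *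
      ((g x : ℝ) : ℂ) * ((x : ℝ) : ℂ)‖ ≤ (3 * M + M' * A) * t ^ (-(2 / (q : ℝ))) := by
  have hM0 : 0 ≤ M := (abs_nonneg _).trans (hM 0)
  have ht0 : 0 < t := one_pos.trans_le ht
  have hq0 : (q : ℝ) ≠ 0 := by exact_mod_cast (by omega : q ≠ 0)
  have hgc : Continuous g := continuous_iff_continuousAt.2 fun x => (hg x).continuousAt
  set δ : ℝ := t ^ (-(1 / (q : ℝ))) with hδdef
  have hδ : 0 < δ := Real.rpow_pos_of_pos ht0 _
  have hδ1 : δ ≤ 1 := Real.rpow_le_one_of_one_le_of_nonpos ht (by simp)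
  have hδq : t * δ ^ q = 1 := by
    rw [hδdef, ← Real.rpow_mul_natCast ht0.le, neg_mul, one_div_mul_cancel hq0, Real.rpow_neg_one,
      mul_inv_cancel₀ ht0.ne']
  have hδ2 : δ ^ 2 = t ^ (-(2 / (q : ℝ))) := by
    rw [hδdef, ← Real.rpow_mul_natCast ht0.le]
    congr 1
    push_cast
    ring
  set F : ℝ → ℂ := fun x => Complex.exp (Complex.I * (t : ℂ) * ((x ^ q : ℝ) : ℂ)) *
      ((g x : ℝ) : ℂ) * ((x : ℝ) : ℂ) with hF
  have hFc : Continuous F := by simp only [hF]; fun_prop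
  have hsplit : ∫ x in Set.Ioi (0 : ℝ), F x = (∫ x in (0 : ℝ)..δ, F x) + ∫ x in δ..A, F x := by
    rw [intervalIntegral.integral_add_adjacent_intervals (hFc.intervalIntegrable _ _)
      (hFc.intervalIntegrable _ _), intervalIntegral.integral_of_le (by linarith)]
    refine setIntegral_eq_of_subset_of_forall_sdiff_eq_zero measurableSet_Ioi
      (fun x hx => hx.1) fun x hx => ?_
    have : A ≤ x := by
      by_contra! h
      exact hx.2 ⟨hx.1, h.le⟩
    simp [hF, hA x this]
  have hnear : ‖∫ x in (0 : ℝ)..δ, F x‖ ≤ M * δ ^ 2 := by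
    have h := intervalIntegral.norm_integral_le_of_norm_le_const (a := 0) (b := δ) (f := F)
      (C := M * δ) (fun x hx => by
        rw [Set.uIoc_of_le hδ.le] at hx
        have hexp : Complex.I * (t : ℂ) * ((x ^ q : ℝ) : ℂ) = ((t * x ^ q : ℝ) : ℂ) * Complex.I := by
          push_cast; ring
        simp only [hF, norm_mul, hexp, Complex.norm_exp_ofReal_mul_I, one_mul, Complex.norm_real,
          Real.norm_eq_abs, abs_of_pos hx.1]
        exact mul_le_mul (hM x) hx.2 hx.1.le hM0)
    rw [sub_zero, abs_of_pos hδ] at h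
    linarith
  have hfar := norm_integral_exp_pow_mul_le_of_pos hq hg hg' hM hM' (hA A le_rfl) hδ
    (hδ1.trans hA1) hδq
  rw [hsplit, ← hδ2]
  refine (norm_add_le _ _).trans ((add_le_add hnear hfar).trans ?_)
  linarith

/-- Fubini's theorem for `Kthree`. -/
theorem Kthree_eq_integral_integral (p : ℝ) (q : ℕ) {R : ℝ × ℝ → ℝ} (hR : Continuous R)
    (hRc : HasCompactSupport R) (t : ℝ) :
    Kthree p q R t = ∫ x₁ in Set.Ioo (0 : ℝ) ((Real.log t) ^ (-(1 / p))),
      Complex.exp (Complex.I * (t : ℂ) * ((Real.exp (-1 / x₁ ^ p) : ℝ) : ℂ)) *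
        ∫ x₂ in Set.Ioi (0 : ℝ), Complex.exp (Complex.I * (t : ℂ) * ((x₂ ^ q : ℝ) : ℂ)) *
          ((R (x₁, x₂) : ℝ) : ℂ) * ((x₂ : ℝ) : ℂ) := by
  have hswap : Integrable (Function.uncurry fun x₂ x₁ : ℝ =>
      (Complex.exp (((t * x₂ ^ q + t * Real.exp (-1 / x₁ ^ p) : ℝ) : ℂ) * Complex.I)) *
        ((R (x₁, x₂) * x₂ : ℝ) : ℂ))
      ((volume.restrict (Set.Ioi (0 : ℝ))).prod
        (volume.restrict (Set.Ioo (0 : ℝ) ((Real.log t) ^ (-(1 / p)))))) := by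
    rw [Measure.prod_restrict]
    refine Integrable.mono_measure (ν := (volume : Measure ℝ).prod volume) ?_ Measure.restrict_le_self
    have hG : Integrable (fun z : ℝ × ℝ => ((R (z.2, z.1) * z.1 : ℝ) : ℂ))
        ((volume : Measure ℝ).prod volume) := by
      have hGc : Continuous fun z : ℝ × ℝ => R (z.2, z.1) * z.1 := by fun_prop
      refine Integrable.ofReal (hGc.integrable_of_hasCompactSupport ?_)
      exact (hRc.comp_homeomorph (Homeomorph.prodComm ℝ ℝ)).mul_right
    refine hG.bdd_mul (c := 1) (Measurable.aestronglyMeasurable ?_) (ae_of_all _ fun z => ?_)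
    · fun_prop
    · rw [Complex.norm_exp_ofReal_mul_I]
  have h := integral_integral_swap hswap
  have hphase : ∀ x₁ x₂ : ℝ,
      Complex.exp (((t * x₂ ^ q + t * Real.exp (-1 / x₁ ^ p) : ℝ) : ℂ) * Complex.I) =
      Complex.exp (Complex.I * (t : ℂ) * ((x₂ ^ q : ℝ) : ℂ)) *
      Complex.exp (Complex.I * (t : ℂ) * ((Real.exp (-1 / x₁ ^ p) : ℝ) : ℂ)) := fun x₁ x₂ => by
    rw [← Complex.exp_add]
    congr 1
    push_cast
    ring
  simp only [hphase] at h
  unfold Kthree Lone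
  convert h using 1
  · refine integral_congr_ae (ae_of_all _ fun x₂ => ?_)
    simp only
    rw [← integral_const_mul, ← integral_mul_const]
    refine integral_congr_ae (ae_of_all _ fun x₁ => ?_)
    simp only [Complex.ofReal_mul]
    ring
  · refine integral_congr_ae (ae_of_all _ fun x₁ => ?_)
    simp only
    rw [← integral_const_mul]
    refine integral_congr_ae (ae_of_all _ fun x₂ => ?_)
    simp only [Complex.ofReal_mul]
    ring

theorem stmt12 (p : ℝ) (hp : 0 < p) (q : ℕ) (hq : 2 ≤ q)
    (R : ℝ × ℝ → ℝ) (hR : ContDiff ℝ (⊤ : ℕ∞) R) (hRc : HasCompactSupport R) :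
    ∃ C > (0 : ℝ), ∃ t₀ > (1 : ℝ), ∀ t ≥ t₀,
      ‖Kthree p q R t‖ ≤ C * t ^ (-(2 / (q : ℝ))) * (Real.log t) ^ (-(1 / p)) := by
  have hcd : Continuous (fderiv ℝ R) := hR.continuous_fderiv (by simp)
  obtain ⟨M, hM⟩ := hRc.exists_bound_of_continuous hR.continuous
  obtain ⟨M', hM'⟩ := (hRc.fderiv_apply (𝕜 := ℝ) ((0 : ℝ), (1 : ℝ))).exists_bound_of_continuous
    (hcd.clm_apply continuous_const)
  obtain ⟨B, hB⟩ := hRc.isCompact.isBounded.exists_norm_le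
  have hM0 : 0 ≤ M := (norm_nonneg _).trans (hM 0)
  have hM0' : 0 ≤ M' := (norm_nonneg _).trans (hM' 0)
  set A : ℝ := max 1 (B + 1) with hAdef
  have hA1 : 1 ≤ A := le_max_left _ _
  have hA : ∀ x₁ x₂, A ≤ x₂ → R (x₁, x₂) = 0 := fun x₁ x₂ hx => by
    by_contra h
    have h1 := hB _ (subset_tsupport R h)
    have h2 : |x₂| ≤ B := (norm_snd_le (x₁, x₂)).trans h1
    have h3 : B + 1 ≤ A := le_max_right _ _
    linarith [le_abs_self x₂]
  refine ⟨3 * M + M' * A + 1, by positivity, 2, by norm_num, fun t ht => ?_⟩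
  have ht1 : 1 ≤ t := by linarith
  have ha : 0 ≤ (Real.log t) ^ (-(1 / p)) := Real.rpow_nonneg (Real.log_nonneg ht1) _
  have hinner : ∀ x₁ : ℝ, ‖∫ x₂ in Set.Ioi (0 : ℝ),
      Complex.exp (Complex.I * (t : ℂ) * ((x₂ ^ q : ℝ) : ℂ)) * ((R (x₁, x₂) : ℝ) : ℂ) *
        ((x₂ : ℝ) : ℂ)‖ ≤ (3 * M + M' * A) * t ^ (-(2 / (q : ℝ))) := fun x₁ =>
    norm_integral_Ioi_exp_pow_mul_le hq (g := fun x₂ => R (x₁, x₂))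
      (g' := fun x₂ => fderiv ℝ R (x₁, x₂) (0, 1))
      (fun x₂ => ((hR.differentiable (by simp)) (x₁, x₂)).hasFDerivAt.comp_hasDerivAt x₂
        ((hasDerivAt_const x₂ x₁).prodMk (hasDerivAt_id x₂)))
      (by fun_prop) (fun x₂ => hM _) (fun x₂ => hM' _) hA1 (hA x₁) ht1
  rw [Kthree_eq_integral_integral p q hR.continuous hRc t]
  refine (norm_setIntegral_le_of_norm_le_const (C := (3 * M + M' * A) * t ^ (-(2 / (q : ℝ))))
    measure_Ioo_lt_top fun x₁ _ => ?_).trans ?_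
  · have hexp : Complex.I * (t : ℂ) * ((Real.exp (-1 / x₁ ^ p) : ℝ) : ℂ) =
        ((t * Real.exp (-1 / x₁ ^ p) : ℝ) : ℂ) * Complex.I := by
      push_cast; ring
    rw [norm_mul, hexp, Complex.norm_exp_ofReal_mul_I, one_mul]
    exact hinner x₁
  · rw [Real.volume_real_Ioo_of_le ha, sub_zero]
    refine mul_le_mul_of_nonneg_right (mul_le_mul_of_nonneg_right ?_ ?_) ha
    · exact le_add_of_nonneg_right zero_le_one
    · positivity
end

section
/- Let p > 0 be a real number, let q ≥ 2 be an integer, let R : ℝ² → ℝ be a smooth compactly supported function, and let α : ℝ → ℝ be a smooth function with α(x) = 1 for |x| ≤ 1 and α(x) = 0 for |x| ≥ 2. Define H⁽¹⁾(t) = ∫₀^∞ e^{i t x₂^q} L⁽¹⁾(t; R(·,x₂)) α(t^{1/q} x₂) x₂ dx₂ for t > 1. Then lim_{t→∞} t^{2/q} (log t)^{1/p} · H⁽¹⁾(t) = R(0,0) · ∫₀^∞ e^{i u^q} α(u) u du. -/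
open MeasureTheory Filter

/-- `H⁽¹⁾(t) = ∫₀^∞ e^{i t x₂^q} L⁽¹⁾(t; R(·,x₂)) α(t^{1/q} x₂) x₂ dx₂`. -/
noncomputable def Hone (p : ℝ) (q : ℕ) (R : ℝ × ℝ → ℝ) (α : ℝ → ℝ) (t : ℝ) : ℂ :=
  ∫ x₂ in Set.Ioi (0 : ℝ),
    Complex.exp (Complex.I * (t : ℂ) * ((x₂ ^ q : ℝ) : ℂ)) *
      Lone p t (fun x₁ => R (x₁, x₂)) * ((α (t ^ (1 / (q : ℝ)) * x₂) : ℝ) : ℂ) *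
        ((x₂ : ℝ) : ℂ)

/-- The inner integral after rescaling `x = (log t)^{-1/p} y`. -/
noncomputable def rescaledLone (p t : ℝ) (ψ : ℝ → ℝ) : ℂ :=
  ∫ y in Set.Ioo (0 : ℝ) 1,
    Complex.exp (Complex.I * ((t * Real.exp (-1 / (Real.log t ^ (-(1 / p)) * y) ^ p) : ℝ) : ℂ)) *
      ((ψ (Real.log t ^ (-(1 / p)) * y) : ℝ) : ℂ)

theorem Lone_eq_rescaledLone (p : ℝ) {t : ℝ} (ht : 1 < t) (ψ : ℝ → ℝ) :
    Lone p t ψ = ((Real.log t ^ (-(1 / p)) : ℝ) : ℂ) * rescaledLone p t ψ := by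
  have hδ : 0 < Real.log t ^ (-(1 / p)) := Real.rpow_pos_of_pos (Real.log_pos ht) _
  unfold Lone rescaledLone
  generalize Real.log t ^ (-(1 / p)) = δ at *
  rw [← integral_Ioc_eq_integral_Ioo, ← integral_Ioc_eq_integral_Ioo,
    ← intervalIntegral.integral_of_le hδ.le, ← intervalIntegral.integral_of_le zero_le_one,
    ← Complex.real_smul]
  have h := intervalIntegral.smul_integral_comp_mul_left (a := 0) (b := 1)
    (fun x : ℝ => Complex.exp (Complex.I * (t : ℂ) * ((Real.exp (-1 / x ^ p) : ℝ) : ℂ)) *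
      ((ψ x : ℝ) : ℂ)) δ
  rw [mul_zero, mul_one] at h
  rw [← h]
  simp only [Complex.ofReal_mul, mul_assoc]

/-- Below the rescaled cutoff the phase `t exp(-1/x^p)` tends to zero. -/
theorem tendsto_rescaled_phase {p : ℝ} (hp : 0 < p) {y : ℝ} (hy : y ∈ Set.Ioo (0 : ℝ) 1) :
    Tendsto (fun t : ℝ => t * Real.exp (-1 / (Real.log t ^ (-(1 / p)) * y) ^ p))
      atTop (nhds 0) := by
  have hyp : 0 < y ^ p := Real.rpow_pos_of_pos hy.1 p
  have hlt : y ^ p < 1 := Real.rpow_lt_one hy.1.le hy.2 hp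
  have hc : 0 < 1 / y ^ p - 1 := by
    rw [sub_pos, lt_div_iff₀ hyp]
    linarith
  have h : Tendsto (fun t : ℝ => Real.exp (-((1 / y ^ p - 1) * Real.log t))) atTop (nhds 0) :=
    Real.tendsto_exp_neg_atTop_nhds_zero.comp (Real.tendsto_log_atTop.const_mul_atTop hc)
  refine h.congr' ?_
  filter_upwards [eventually_gt_atTop 1] with t ht
  have hl : 0 < Real.log t := Real.log_pos ht
  have hpow : (Real.log t ^ (-(1 / p)) * y) ^ p = (Real.log t)⁻¹ * y ^ p := by
    rw [Real.mul_rpow (Real.rpow_nonneg hl.le _) hy.1.le, ← Real.rpow_mul hl.le,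
      show -(1 / p) * p = -1 by field_simp, Real.rpow_neg_one]
  rw [hpow]
  nth_rw 2 [← Real.exp_log (zero_lt_one.trans ht)]
  rw [← Real.exp_add]
  congr 1
  field_simp
  ring

theorem norm_exp_I_mul_ofReal_mul_le (s r : ℝ) {C : ℝ} (h : ‖r‖ ≤ C) :
    ‖Complex.exp (Complex.I * (s : ℂ)) * (r : ℂ)‖ ≤ C := by
  rwa [norm_mul, Complex.norm_exp_I_mul_ofReal, one_mul, Complex.norm_real]

theorem norm_rescaledLone_le (p t : ℝ) {ψ : ℝ → ℝ} {C : ℝ} (hC : ∀ x, ‖ψ x‖ ≤ C) :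
    ‖rescaledLone p t ψ‖ ≤ C := by
  have h := norm_setIntegral_le_of_norm_le_const (μ := volume) (s := Set.Ioo (0 : ℝ) 1)
    (by simp) fun y _ => norm_exp_I_mul_ofReal_mul_le
      (t * Real.exp (-1 / (Real.log t ^ (-(1 / p)) * y) ^ p)) _ (hC (Real.log t ^ (-(1 / p)) * y))
  simpa [rescaledLone] using h

theorem tendsto_log_rpow_neg {p : ℝ} (hp : 0 < p) :
    Tendsto (fun t : ℝ => Real.log t ^ (-(1 / p))) atTop (nhds 0) :=
  (tendsto_rpow_neg_atTop (one_div_pos.2 hp)).comp Real.tendsto_log_atTop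

theorem tendsto_rescaledLone {p : ℝ} (hp : 0 < p) {R : ℝ × ℝ → ℝ} (hR : Continuous R)
    {C : ℝ} (hC : ∀ x, ‖R x‖ ≤ C) {x : ℝ → ℝ} (hx : Tendsto x atTop (nhds 0)) :
    Tendsto (fun t => rescaledLone p t fun x₁ => R (x₁, x t)) atTop
      (nhds ((R (0, 0) : ℝ) : ℂ)) := by
  have h : Tendsto (fun t => rescaledLone p t fun x₁ => R (x₁, x t)) atTop
      (nhds (∫ _ in Set.Ioo (0 : ℝ) 1, ((R (0, 0) : ℝ) : ℂ))) := by
    refine tendsto_integral_filter_of_dominated_convergence (fun _ => C) ?_ ?_ ?_ ?_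
    · refine Eventually.of_forall fun t => Measurable.aestronglyMeasurable ?_
      have := hR.measurable
      fun_prop
    · exact Eventually.of_forall fun t => Eventually.of_forall fun y =>
        norm_exp_I_mul_ofReal_mul_le _ _ (hC _)
    · exact integrable_const C
    · refine (ae_restrict_mem measurableSet_Ioo).mono fun y hy => ?_
      have h1 : Tendsto (fun t : ℝ => R (Real.log t ^ (-(1 / p)) * y, x t)) atTop
          (nhds (R (0, 0))) := by
        refine (hR.tendsto _).comp (Tendsto.prodMk_nhds ?_ hx)
        simpa using (tendsto_log_rpow_neg hp).mul_const y
      have h2 := (Complex.continuous_ofReal.tendsto _).comp (tendsto_rescaled_phase hp hy)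
      simpa using ((h2.const_mul Complex.I).cexp).mul
        ((Complex.continuous_ofReal.tendsto _).comp h1)
  simpa using h

theorem Hone_rescaled (p : ℝ) {q : ℕ} (hq : q ≠ 0) (R : ℝ × ℝ → ℝ) (α : ℝ → ℝ)
    {t : ℝ} (ht : 1 < t) :
    ((t ^ (2 / (q : ℝ)) * (Real.log t) ^ (1 / p) : ℝ) : ℂ) * Hone p q R α t =
      ∫ u in Set.Ioi (0 : ℝ), rescaledLone p t (fun x₁ => R (x₁, t ^ (-(1 / (q : ℝ))) * u)) *
        (Complex.exp (Complex.I * ((u ^ q : ℝ) : ℂ)) * ((α u : ℝ) : ℂ) * ((u : ℝ) : ℂ)) := by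
  have ht0 : 0 < t := zero_lt_one.trans ht
  have hl : 0 < Real.log t := Real.log_pos ht
  have hε : 0 < t ^ (-(1 / (q : ℝ))) := Real.rpow_pos_of_pos ht0 _
  have hεinv : t ^ (1 / (q : ℝ)) = (t ^ (-(1 / (q : ℝ))))⁻¹ := by
    rw [Real.rpow_neg ht0.le, inv_inv]
  have hεsq : t ^ (2 / (q : ℝ)) = (t ^ (-(1 / (q : ℝ))))⁻¹ * (t ^ (-(1 / (q : ℝ))))⁻¹ := by
    rw [← hεinv, ← Real.rpow_add ht0]
    ring_nf
  have hεpow : t * (t ^ (-(1 / (q : ℝ)))) ^ q = 1 := by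
    rw [Real.rpow_neg ht0.le, inv_pow, one_div, Real.rpow_inv_natCast_pow ht0.le hq,
      mul_inv_cancel₀ ht0.ne']
  have hδinv : Real.log t ^ (1 / p) = (Real.log t ^ (-(1 / p)))⁻¹ := by
    rw [Real.rpow_neg hl.le, inv_inv]
  have hδ : 0 < Real.log t ^ (-(1 / p)) := Real.rpow_pos_of_pos hl _
  have h := integral_comp_mul_left_Ioi (fun x₂ : ℝ =>
    Complex.exp (Complex.I * (t : ℂ) * ((x₂ ^ q : ℝ) : ℂ)) *
      Lone p t (fun x₁ => R (x₁, x₂)) * ((α (t ^ (1 / (q : ℝ)) * x₂) : ℝ) : ℂ) *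
        ((x₂ : ℝ) : ℂ)) 0 hε
  rw [mul_zero, Complex.real_smul] at h
  unfold Hone
  rw [hεsq, hδinv, mul_right_comm, Complex.ofReal_mul, mul_assoc, ← h, ← integral_const_mul]
  refine integral_congr_ae (Eventually.of_forall fun u => ?_)
  have hphase : Complex.I * (t : ℂ) * (((t ^ (-(1 / (q : ℝ))) * u) ^ q : ℝ) : ℂ) =
      Complex.I * ((u ^ q : ℝ) : ℂ) := by
    rw [mul_assoc, ← Complex.ofReal_mul, mul_pow, ← mul_assoc, hεpow, one_mul]
  simp only [hphase, Lone_eq_rescaledLone p ht, hεinv, inv_mul_cancel_left₀ hε.ne']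
  have h1 : ((t ^ (-(1 / (q : ℝ))) : ℝ) : ℂ) ≠ 0 := by exact_mod_cast hε.ne'
  have h2 : ((Real.log t ^ (-(1 / p)) : ℝ) : ℂ) ≠ 0 := by exact_mod_cast hδ.ne'
  push_cast only [Complex.ofReal_mul, Complex.ofReal_inv]
  field_simp

theorem measurable_rescaledLone (p t c : ℝ) {R : ℝ × ℝ → ℝ} (hR : Measurable R) :
    Measurable fun u : ℝ => rescaledLone p t fun x₁ => R (x₁, c * u) := by
  refine (StronglyMeasurable.integral_prod_right (Measurable.stronglyMeasurable ?_)).measurable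
  fun_prop

theorem stmt13 (p : ℝ) (hp : 0 < p) (q : ℕ) (hq : 2 ≤ q)
    (R : ℝ × ℝ → ℝ) (hR : ContDiff ℝ (⊤ : ℕ∞) R) (hRc : HasCompactSupport R)
    (α : ℝ → ℝ) (hα : ContDiff ℝ (⊤ : ℕ∞) α)
    (hα1 : ∀ x : ℝ, |x| ≤ 1 → α x = 1) (hα0 : ∀ x : ℝ, 2 ≤ |x| → α x = 0) :
    Tendsto (fun t : ℝ =>
        ((t ^ (2 / (q : ℝ)) * (Real.log t) ^ (1 / p) : ℝ) : ℂ) * Hone p q R α t)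
      atTop
      (nhds (((R (0, 0) : ℝ) : ℂ) *
        ∫ u in Set.Ioi (0 : ℝ),
          Complex.exp (Complex.I * ((u ^ q : ℝ) : ℂ)) * ((α u : ℝ) : ℂ) * ((u : ℝ) : ℂ))) := by
  obtain ⟨C, hC⟩ := hRc.exists_bound_of_continuous hR.continuous
  have hq0 : (0 : ℝ) < 1 / (q : ℝ) := by positivity
  have hαc : Continuous α := hα.continuous
  have hcont : Continuous fun u : ℝ =>
      Complex.exp (Complex.I * ((u ^ q : ℝ) : ℂ)) * ((α u : ℝ) : ℂ) * ((u : ℝ) : ℂ) := by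
    fun_prop
  have hsupp : HasCompactSupport fun u : ℝ =>
      Complex.exp (Complex.I * ((u ^ q : ℝ) : ℂ)) * ((α u : ℝ) : ℂ) * ((u : ℝ) : ℂ) := by
    refine HasCompactSupport.intro (isCompact_Icc (a := (-2 : ℝ)) (b := 2)) fun u hu => ?_
    rw [hα0 u (le_of_not_ge fun h => hu (abs_le.1 h))]
    simp
  rw [← integral_const_mul]
  refine Tendsto.congr' ((eventually_gt_atTop 1).mono fun t ht =>
    (Hone_rescaled p (by omega) R α ht).symm) ?_
  refine tendsto_integral_filter_of_dominated_convergence (fun u : ℝ => C *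
    ‖Complex.exp (Complex.I * ((u ^ q : ℝ) : ℂ)) * ((α u : ℝ) : ℂ) * ((u : ℝ) : ℂ)‖) ?_ ?_ ?_ ?_
  · exact Eventually.of_forall fun t =>
      ((measurable_rescaledLone p t _ hR.continuous.measurable).mul
        hcont.measurable).aestronglyMeasurable
  · refine Eventually.of_forall fun t => Eventually.of_forall fun u => ?_
    rw [norm_mul]
    exact mul_le_mul_of_nonneg_right (norm_rescaledLone_le p t fun _ => hC _) (norm_nonneg _)
  · exact ((hcont.integrable_of_hasCompactSupport hsupp).norm.const_mul C).integrableOn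
  · refine Eventually.of_forall fun u => (tendsto_rescaledLone hp hR.continuous hC ?_).mul_const _
    simpa using (tendsto_rpow_neg_atTop hq0).mul_const u
end

section
/- Let p > 0 be a real number, let q ≥ 2 be an integer, let R : ℝ² → ℝ be a smooth compactly supported function, and let β : ℝ → ℝ be a smooth function with β(x) = 0 for |x| ≤ 1 and β(x) = 1 for |x| ≥ 2. Define H⁽²⁾(t) = ∫₀^∞ e^{i t x₂^q} L⁽¹⁾(t; R(·,x₂)) β(t^{1/q} x₂) x₂ dx₂ for t > 1. Then there exist constants C > 0 and t₀ > 1 such that |H⁽²⁾(t)| ≤ C t^{−2/q} (log t)^{−1/p} for all t ≥ t₀. -/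
open MeasureTheory Filter

/-- `H⁽²⁾(t) = ∫₀^∞ e^{i t x₂^q} L⁽¹⁾(t; R(·,x₂)) β(t^{1/q} x₂) x₂ dx₂`. -/
noncomputable def Htwo (p : ℝ) (q : ℕ) (R : ℝ × ℝ → ℝ) (β : ℝ → ℝ) (t : ℝ) : ℂ :=
  ∫ x₂ in Set.Ioi (0 : ℝ),
    Complex.exp (Complex.I * (t : ℂ) * ((x₂ ^ q : ℝ) : ℂ)) *
      Lone p t (fun x₁ => R (x₁, x₂)) * ((β (t ^ (1 / (q : ℝ)) * x₂) : ℝ) : ℂ) *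
        ((x₂ : ℝ) : ℂ)

/-- A first-derivative estimate for the oscillatory integral with phase `l ^ (n + 2) * y ^ (n + 2)`
and amplitude `h y * b (l * y) * y` vanishing at both ends of `[l⁻¹, A]`. -/
theorem norm_oscillatory_integral_le (n : ℕ) {A l M B D : ℝ} (hl : 1 ≤ l) (hA : 1 ≤ A)
    {h h' b b' : ℝ → ℝ} (hh : ∀ y, HasDerivAt h (h' y) y) (hh'c : Continuous h')
    (hb : ∀ y, HasDerivAt b (b' y) y) (hb'c : Continuous b')
    (hM : ∀ y, |h y| ≤ M) (hM' : ∀ y, |h' y| ≤ M) (hB : ∀ y, |b y| ≤ B)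
    (hD : ∀ v, |b' v| * v ^ 2 ≤ D) (hhA : h A = 0) (hb1 : b 1 = 0) :
    ‖∫ y in l⁻¹..A, Complex.exp (Complex.I * ((l ^ (n + 2) : ℝ) : ℂ) * ((y ^ (n + 2) : ℝ) : ℂ)) *
      ((h y * b (l * y) * y : ℝ) : ℂ)‖ ≤ (M * B * (A + 1) + M * D) * (l ^ 2)⁻¹ := by
  have hl0 : 0 < l := by linarith
  have hM0 : 0 ≤ M := (abs_nonneg _).trans (hM 0)
  have hB0 : 0 ≤ B := (abs_nonneg _).trans (hB 0)
  have hD0 : 0 ≤ D := le_trans (by positivity) (hD 0)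
  have hlA : l⁻¹ ≤ A := (inv_le_one_of_one_le₀ hl).trans hA
  have hpos : ∀ y ∈ Set.uIcc l⁻¹ A, 0 < y := fun y hy => by
    rw [Set.uIcc_of_le hlA] at hy
    exact (inv_pos.2 hl0).trans_le hy.1
  have hhc : Continuous h := continuous_iff_continuousAt.2 fun y => (hh y).continuousAt
  have hbc : Continuous b := continuous_iff_continuousAt.2 fun y => (hb y).continuousAt
  set E : ℝ → ℂ := fun y =>
    Complex.exp (Complex.I * ((l ^ (n + 2) : ℝ) : ℂ) * ((y ^ (n + 2) : ℝ) : ℂ)) with hE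
  set c : ℂ := Complex.I * ((l ^ (n + 2) : ℝ) : ℂ) * ((n + 2 : ℝ) : ℂ) with hc
  set W : ℝ → ℝ := fun y => h y * b (l * y) * y ^ (-n : ℤ) with hW
  set W' : ℝ → ℝ := fun y => (h' y * b (l * y) + h y * (b' (l * y) * l)) * y ^ (-n : ℤ) +
    h y * b (l * y) * (-n * y ^ (-n - 1 : ℤ)) with hW'
  have hEn : ∀ y, ‖E y‖ = 1 := fun y => by
    have : Complex.I * ((l ^ (n + 2) : ℝ) : ℂ) * ((y ^ (n + 2) : ℝ) : ℂ) =
      ((l ^ (n + 2) * y ^ (n + 2) : ℝ) : ℂ) * Complex.I := by push_cast; ring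
    simp only [hE]
    rw [this, Complex.norm_exp_ofReal_mul_I]
  have hEd : ∀ y, HasDerivAt E (E y * (c * ((y ^ (n + 1) : ℝ) : ℂ))) y := fun y => by
    have h1 : HasDerivAt (fun y : ℝ => y ^ (n + 2)) ((n + 2 : ℝ) * y ^ (n + 1)) y := by
      simpa using hasDerivAt_pow (n + 2) y
    have h2 := ((h1.ofReal_comp).const_mul (Complex.I * ((l ^ (n + 2) : ℝ) : ℂ))).cexp
    convert h2 using 1
    simp only [hE, hc]
    push_cast
    ring
  have hEc : Continuous E := continuous_iff_continuousAt.2 fun y => (hEd y).continuousAt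
  have hwd : ∀ y, 0 < y →
      HasDerivAt (fun y : ℝ => y ^ (-n : ℤ)) (-n * y ^ (-n - 1 : ℤ)) y := fun y hy => by
    simpa using hasDerivAt_zpow (-n : ℤ) y (Or.inl hy.ne')
  have hWd : ∀ y ∈ Set.uIcc l⁻¹ A, HasDerivAt W (W' y) y := fun y hy => by
    have h1 : HasDerivAt (fun y => b (l * y)) (b' (l * y) * l) y := by
      have h2 : HasDerivAt (fun y : ℝ => l * y) l y := by simpa using (hasDerivAt_id y).const_mul l
      exact (hb (l * y)).comp y h2
    exact ((hh y).mul h1).mul (hwd y (hpos y hy))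
  have hzc : ∀ m : ℤ, ContinuousOn (fun y : ℝ => y ^ m) (Set.uIcc l⁻¹ A) := fun m y hy =>
    (continuousAt_zpow₀ y m (Or.inl (hpos y hy).ne')).continuousWithinAt
  have hW'c : ContinuousOn W' (Set.uIcc l⁻¹ A) := by
    have h1 := hzc (-n)
    have h2 := hzc (-n - 1)
    fun_prop
  have hIBP := intervalIntegral.integral_mul_deriv_eq_deriv_mul (a := l⁻¹) (b := A)
    (u := fun y => (W y : ℂ)) (u' := fun y => (W' y : ℂ)) (v := E)
    (v' := fun y => E y * (c * ((y ^ (n + 1) : ℝ) : ℂ)))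
    (fun y hy => (hWd y hy).ofReal_comp) (fun y _ => hEd y)
    (Complex.continuous_ofReal.comp_continuousOn hW'c).intervalIntegrable
    (Continuous.intervalIntegrable (by fun_prop) _ _)
  have hWA : W A = 0 := by simp [hW, hhA]
  have hWl : W l⁻¹ = 0 := by simp [hW, hb1, hl0.ne']
  have hcI : (∫ y in l⁻¹..A, (W y : ℂ) * (E y * (c * ((y ^ (n + 1) : ℝ) : ℂ)))) =
      c * ∫ y in l⁻¹..A, E y * ((h y * b (l * y) * y : ℝ) : ℂ) := by
    rw [← intervalIntegral.integral_const_mul]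
    refine intervalIntegral.integral_congr fun y hy => ?_
    have hy0 := (hpos y hy).ne'
    have h1 : y ^ (-n : ℤ) * y ^ (n + 1) = y := by
      rw [zpow_neg, zpow_natCast, pow_succ]
      field_simp
    have h2 : h y * b (l * y) * y = W y * y ^ (n + 1) := by
      simp only [hW]
      rw [mul_assoc (h y * b (l * y)), h1]
    simp only [h2]
    push_cast
    ring
  set G : ℝ → ℝ := fun y => l ^ n * (M * B) * y - l ^ n * (M * D) / l * y⁻¹ -
    M * B * y ^ (-n : ℤ) with hG
  set g : ℝ → ℝ := fun y => l ^ n * (M * B) * 1 - l ^ n * (M * D) / l * (-(y ^ 2)⁻¹) -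
    M * B * (-n * y ^ (-n - 1 : ℤ)) with hg
  have hGd : ∀ y ∈ Set.uIcc l⁻¹ A, HasDerivAt G (g y) y := fun y hy =>
    (((hasDerivAt_id y).const_mul _).sub ((hasDerivAt_inv (hpos y hy).ne').const_mul _)).sub
      ((hwd y (hpos y hy)).const_mul _)
  have hgc : ContinuousOn g (Set.uIcc l⁻¹ A) := by
    have h2 := hzc (-n - 1)
    have h3 : ContinuousOn (fun y : ℝ => (y ^ 2)⁻¹) (Set.uIcc l⁻¹ A) :=
      (continuousOn_id.pow 2).inv₀ fun y hy => (pow_pos (hpos y hy) 2).ne'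
    fun_prop
  have hgint : IntervalIntegrable g volume l⁻¹ A := hgc.intervalIntegrable
  have hW'g : ∀ y ∈ Set.uIcc l⁻¹ A, |W' y| ≤ g y := fun y hy => by
    have hy0 := hpos y hy
    have hw0 : 0 ≤ y ^ (-n : ℤ) := by positivity
    have hz0 : 0 ≤ y ^ (-n - 1 : ℤ) := by positivity
    have hw : y ^ (-n : ℤ) ≤ l ^ n := by
      rw [Set.uIcc_of_le hlA] at hy
      rw [zpow_neg, zpow_natCast, ← inv_pow]
      exact pow_le_pow_left₀ (by positivity) (inv_le_of_inv_le₀ hl0 hy.1) n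
    have hb2 : |b' (l * y)| * l ≤ D / l * (y ^ 2)⁻¹ := by
      have := hD (l * y)
      rw [div_mul_eq_mul_div, ← div_eq_mul_inv, div_div, le_div_iff₀ (by positivity)]
      calc _ = |b' (l * y)| * (l * y) ^ 2 := by ring
        _ ≤ D := this
    have t1 : |h' y * b (l * y) * y ^ (-n : ℤ)| ≤ M * B * l ^ n := by
      rw [abs_mul, abs_mul, abs_of_nonneg hw0]
      exact mul_le_mul (mul_le_mul (hM' _) (hB _) (abs_nonneg _) hM0) hw hw0 (by positivity)
    have t2 : |h y * (b' (l * y) * l) * y ^ (-n : ℤ)| ≤ M * (D / l * (y ^ 2)⁻¹) * l ^ n := by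
      rw [abs_mul, abs_mul, abs_mul, abs_of_nonneg hw0, abs_of_pos hl0]
      exact mul_le_mul (mul_le_mul (hM _) hb2 (by positivity) hM0) hw hw0 (by positivity)
    have t3 : |h y * b (l * y) * (-n * y ^ (-n - 1 : ℤ))| ≤ M * B * (n * y ^ (-n - 1 : ℤ)) := by
      rw [abs_mul, abs_mul, neg_mul, abs_neg, abs_of_nonneg (a := (n : ℝ) * _) (by positivity)]
      exact mul_le_mul_of_nonneg_right (mul_le_mul (hM _) (hB _) (abs_nonneg _) hM0)
        (by positivity)
    have hsplit : W' y = h' y * b (l * y) * y ^ (-n : ℤ) +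
        h y * (b' (l * y) * l) * y ^ (-n : ℤ) + h y * b (l * y) * (-n * y ^ (-n - 1 : ℤ)) := by
      simp only [hW']
      ring
    have hgs : g y = M * B * l ^ n + M * (D / l * (y ^ 2)⁻¹) * l ^ n +
        M * B * (n * y ^ (-n - 1 : ℤ)) := by
      simp only [hg]
      ring
    rw [hsplit, hgs]
    exact (abs_add_three _ _ _).trans (add_le_add (add_le_add t1 t2) t3)
  have hbound : ‖∫ y in l⁻¹..A, (W' y : ℂ) * E y‖ ≤ G A - G l⁻¹ := by
    rw [← intervalIntegral.integral_eq_sub_of_hasDerivAt hGd hgint]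
    refine intervalIntegral.norm_integral_le_of_norm_le hlA (ae_of_all _ fun y hy => ?_) hgint
    rw [norm_mul, hEn, mul_one, Complex.norm_real]
    exact hW'g y (Set.uIcc_of_le hlA ▸ Set.Ioc_subset_Icc_self hy)
  have hGle : G A - G l⁻¹ ≤ l ^ n * (M * B * (A + 1) + M * D) := by
    have hA0 : 0 < A := by linarith
    have e1 : l⁻¹ ^ (-n : ℤ) = l ^ n := by simp
    have p1 : 0 ≤ l ^ n * (M * D) / l * A⁻¹ := by positivity
    have p2 : 0 ≤ M * B * A ^ (-n : ℤ) := by positivity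
    have p3 : 0 ≤ l ^ n * (M * B) * l⁻¹ := by positivity
    have e2 : l ^ n * (M * D) / l * l = l ^ n * (M * D) := by field_simp
    simp only [hG, e1, inv_inv, e2]
    linarith
  have hcn : l ^ (n + 2) ≤ ‖c‖ := by
    simp only [hc]
    rw [norm_mul, norm_mul, Complex.norm_I, one_mul, Complex.norm_real, Complex.norm_real,
      Real.norm_of_nonneg (by positivity), Real.norm_of_nonneg (by positivity)]
    exact le_mul_of_one_le_right (by positivity) (by linarith [(Nat.cast_nonneg n : (0 : ℝ) ≤ n)])
  rw [hcI, hWA, hWl] at hIBP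
  simp only [Complex.ofReal_zero, zero_mul, sub_zero, zero_sub] at hIBP
  have hfin : l ^ (n + 2) * ‖∫ y in l⁻¹..A, E y * ((h y * b (l * y) * y : ℝ) : ℂ)‖ ≤
      l ^ n * (M * B * (A + 1) + M * D) := by
    refine (mul_le_mul_of_nonneg_right hcn (norm_nonneg _)).trans ?_
    rw [← norm_mul, hIBP, norm_neg]
    exact hbound.trans hGle
  rw [← div_eq_mul_inv, le_div_iff₀ (by positivity)]
  refine le_of_mul_le_mul_left ?_ (pow_pos hl0 n)
  rwa [mul_comm (‖_‖) (l ^ 2), ← mul_assoc, ← pow_add]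

/-- A smooth function equal to `1` for `|x| ≥ 2` is bounded, and so is `x ^ 2` times its
derivative. -/
theorem exists_bounds_of_eq_one {b : ℝ → ℝ} (hb : ContDiff ℝ (⊤ : ℕ∞) b)
    (hb1 : ∀ x : ℝ, 2 ≤ |x| → b x = 1) :
    ∃ B D : ℝ, (∀ x, |b x| ≤ B) ∧ ∀ x, |deriv b x| * x ^ 2 ≤ D := by
  have hd : Continuous (deriv b) := hb.continuous_deriv (by simp)
  obtain ⟨B, hB⟩ := (isCompact_Icc (a := (-2 : ℝ)) (b := 2)).exists_bound_of_continuousOn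
    hb.continuous.continuousOn
  obtain ⟨D, hD⟩ := (isCompact_Icc (a := (-2 : ℝ)) (b := 2)).exists_bound_of_continuousOn
    (f := fun x => deriv b x * x ^ 2) (by fun_prop)
  refine ⟨max B 1, max D 0, fun x => ?_, fun x => ?_⟩
  · by_cases hx : |x| ≤ 2
    · exact (hB x (abs_le.1 hx)).trans (le_max_left _ _)
    · simp [hb1 x (not_le.1 hx).le]
  · by_cases hx : |x| ≤ 2
    · have := hD x (abs_le.1 hx)
      rw [Real.norm_eq_abs, abs_mul, abs_of_nonneg (sq_nonneg x)] at this
      exact this.trans (le_max_left _ _)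
    · have h1 : b =ᶠ[nhds x] fun _ => 1 := by
        filter_upwards [(isOpen_lt continuous_const continuous_abs).mem_nhds (not_le.1 hx)]
          with y hy
        exact hb1 y (le_of_lt hy)
      simp [h1.deriv_eq]

/-- `Htwo` as an integral in `x₁` of one-dimensional oscillatory integrals in `x₂`. -/
theorem Htwo_eq_integral (p : ℝ) {q : ℕ} {R : ℝ × ℝ → ℝ} (hR : Continuous R)
    {b : ℝ → ℝ} (hb : Continuous b) (hb0 : ∀ x : ℝ, |x| ≤ 1 → b x = 0)
    {A B M t l : ℝ} (hl : t ^ (1 / (q : ℝ)) = l) (hl1 : 1 ≤ l) (hA : 1 ≤ A)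
    (hM : ∀ z, |R z| ≤ M) (hB : ∀ x, |b x| ≤ B) (hRA : ∀ x y, A ≤ y → R (x, y) = 0) :
    Htwo p q R b t = ∫ x in Set.Ioo (0 : ℝ) ((Real.log t) ^ (-(1 / p))),
      Complex.exp (Complex.I * (t : ℂ) * ((Real.exp (-1 / x ^ p) : ℝ) : ℂ)) *
        ∫ y in l⁻¹..A, Complex.exp (Complex.I * (t : ℂ) * ((y ^ q : ℝ) : ℂ)) *
          ((R (x, y) * b (l * y) * y : ℝ) : ℂ) := by
  have hl0 : 0 < l := by linarith
  have hlA : l⁻¹ ≤ A := (inv_le_one_of_one_le₀ hl1).trans hA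
  have hM0 : 0 ≤ M := (abs_nonneg _).trans (hM 0)
  have hB0 : 0 ≤ B := (abs_nonneg _).trans (hB 0)
  have hexp : ∀ r : ℝ, ‖Complex.exp (Complex.I * (t : ℂ) * (r : ℂ))‖ = 1 := fun r => by
    have : Complex.I * (t : ℂ) * (r : ℂ) = ((t * r : ℝ) : ℂ) * Complex.I := by push_cast; ring
    rw [this, Complex.norm_exp_ofReal_mul_I]
  set K : ℝ → ℝ → ℂ := fun y x =>
    Complex.exp (Complex.I * (t : ℂ) * ((Real.exp (-1 / x ^ p) : ℝ) : ℂ)) *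
      (Complex.exp (Complex.I * (t : ℂ) * ((y ^ q : ℝ) : ℂ)) *
        ((R (x, y) * b (l * y) * y : ℝ) : ℂ)) with hK
  have hKm : Measurable (Function.uncurry K) := by
    have h1 : Measurable fun z : ℝ × ℝ => R (z.2, z.1) := hR.measurable.comp (by fun_prop)
    have h2 : Measurable fun z : ℝ × ℝ => b (l * z.1) := hb.measurable.comp (by fun_prop)
    have h3 : Measurable fun z : ℝ × ℝ => z.2 ^ p := measurable_snd.pow_const p
    simp only [hK, Function.uncurry_def]
    fun_prop
  have hKi : Integrable (Function.uncurry K) ((volume.restrict (Set.Ioc l⁻¹ A)).prod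
      (volume.restrict (Set.Ioo (0 : ℝ) ((Real.log t) ^ (-(1 / p)))))) := by
    refine Integrable.of_bound hKm.aestronglyMeasurable (M * B * A) ?_
    rw [Measure.prod_restrict]
    filter_upwards [ae_restrict_mem (measurableSet_Ioc.prod measurableSet_Ioo)] with z hz
    simp only [hK, Function.uncurry_def]
    rw [norm_mul, norm_mul, hexp, hexp, one_mul, one_mul, Complex.norm_real, Real.norm_eq_abs,
      abs_mul, abs_mul, abs_of_pos ((inv_pos.2 hl0).trans hz.1.1)]
    exact mul_le_mul (mul_le_mul (hM _) (hB _) (abs_nonneg _) hM0) hz.1.2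
      ((inv_pos.2 hl0).trans hz.1.1).le (by positivity)
  have hpt : ∀ y, Complex.exp (Complex.I * (t : ℂ) * ((y ^ q : ℝ) : ℂ)) *
      Lone p t (fun x₁ => R (x₁, y)) * ((b (l * y) : ℝ) : ℂ) * ((y : ℝ) : ℂ) =
      ∫ x in Set.Ioo (0 : ℝ) ((Real.log t) ^ (-(1 / p))), K y x := fun y => by
    have : ∀ x, K y x = Complex.exp (Complex.I * (t : ℂ) * ((y ^ q : ℝ) : ℂ)) *
        ((b (l * y) : ℝ) : ℂ) * ((y : ℝ) : ℂ) *
        (Complex.exp (Complex.I * (t : ℂ) * ((Real.exp (-1 / x ^ p) : ℝ) : ℂ)) *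
          ((R (x, y) : ℝ) : ℂ)) := fun x => by
      simp only [hK]
      push_cast
      ring
    simp only [this]
    rw [integral_const_mul, Lone]
    ring
  unfold Htwo
  rw [hl]
  simp only [hpt]
  rw [setIntegral_eq_of_subset_of_forall_sdiff_eq_zero measurableSet_Ioi
    (s := Set.Ioc l⁻¹ A) (fun y hy => (inv_pos.2 hl0).trans hy.1), integral_integral_swap hKi]
  · refine integral_congr_ae (ae_of_all _ fun x => ?_)
    simp only [hK]
    rw [integral_const_mul, intervalIntegral.integral_of_le hlA]
  · intro y hy
    have hKz : ∀ x, K y x = 0 := fun x => by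
      rcases le_total A y with h1 | h1
      · simp [hK, hRA x y h1]
      · have hy0 : 0 < y := hy.1
        have h2 : y ≤ l⁻¹ := not_lt.1 fun h3 => hy.2 ⟨h3, h1⟩
        have h4 : b (l * y) = 0 := hb0 _ <| by
          rw [abs_of_pos (by positivity)]
          calc l * y ≤ l * l⁻¹ := by gcongr
            _ = 1 := mul_inv_cancel₀ hl0.ne'
        simp [hK, h4]
    simp [hKz]

theorem stmt14 (p : ℝ) (hp : 0 < p) (q : ℕ) (hq : 2 ≤ q)
    (R : ℝ × ℝ → ℝ) (hR : ContDiff ℝ (⊤ : ℕ∞) R) (hRc : HasCompactSupport R)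
    (β : ℝ → ℝ) (hβ : ContDiff ℝ (⊤ : ℕ∞) β)
    (hβ0 : ∀ x : ℝ, |x| ≤ 1 → β x = 0) (hβ1 : ∀ x : ℝ, 2 ≤ |x| → β x = 1) :
    ∃ C > (0 : ℝ), ∃ t₀ > (1 : ℝ), ∀ t ≥ t₀,
      ‖Htwo p q R β t‖ ≤ C * t ^ (-(2 / (q : ℝ))) * (Real.log t) ^ (-(1 / p)) := by
  obtain ⟨n, rfl⟩ := Nat.exists_eq_add_of_le' hq
  obtain ⟨B, D, hB, hD⟩ := exists_bounds_of_eq_one hβ hβ1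
  obtain ⟨M₀, hM₀⟩ := hRc.exists_bound_of_continuous hR.continuous
  have hRd : Continuous (fderiv ℝ R) := hR.continuous_fderiv (by simp)
  obtain ⟨M₁, hM₁⟩ := (hRc.fderiv ℝ).exists_bound_of_continuous hRd
  set M := max M₀ M₁ with hMdef
  have hM : ∀ z, |R z| ≤ M := fun z => (hM₀ z).trans (le_max_left _ _)
  obtain ⟨A₀, hA₀⟩ := hRc.isCompact.isBounded.exists_norm_le
  set A := max 1 (A₀ + 1) with hAdef
  have hA : 1 ≤ A := le_max_left _ _
  have hRA : ∀ x y, A ≤ y → R (x, y) = 0 := fun x y hy => by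
    by_contra hne
    have h1 := hA₀ _ (subset_tsupport R hne)
    have h2 : |y| ≤ A₀ := (norm_snd_le (x, y)).trans h1
    have h3 : A₀ + 1 ≤ A := le_max_right _ _
    linarith [le_abs_self y]
  have hd : ∀ x y, HasDerivAt (fun y => R (x, y)) (fderiv ℝ R (x, y) (0, 1)) y := fun x y => by
    have h1 : HasDerivAt (fun y : ℝ => (x, y)) ((0 : ℝ), (1 : ℝ)) y :=
      (hasDerivAt_const y x).prodMk (hasDerivAt_id y)
    exact ((hR.differentiable (by simp)) (x, y)).hasFDerivAt.comp_hasDerivAt y h1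
  have hM' : ∀ x y, |fderiv ℝ R (x, y) (0, 1)| ≤ M := fun x y => by
    have h1 : ‖((0 : ℝ), (1 : ℝ))‖ = 1 := by simp [Prod.norm_def]
    have h2 := (fderiv ℝ R (x, y)).le_opNorm (0, 1)
    rw [h1, mul_one] at h2
    exact h2.trans ((hM₁ _).trans (le_max_right _ _))
  set C := M * B * (A + 1) + M * D with hC
  refine ⟨max C 1, by positivity, 2, by norm_num, fun t ht => ?_⟩
  have ht0 : 0 < t := by linarith
  set l := t ^ (1 / ((n + 2 : ℕ) : ℝ)) with hl
  have hl1 : 1 ≤ l := Real.one_le_rpow (by linarith) (by positivity)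
  have hlt : l ^ (n + 2) = t := by
    rw [hl, one_div, Real.rpow_inv_natCast_pow ht0.le (by lia)]
  have hl2 : (l ^ 2)⁻¹ = t ^ (-(2 / ((n + 2 : ℕ) : ℝ))) := by
    rw [Real.rpow_neg ht0.le, hl, ← Real.rpow_natCast, ← Real.rpow_mul ht0.le]
    congr 2
    push_cast
    ring
  have hlog : 0 ≤ (Real.log t) ^ (-(1 / p)) := Real.rpow_nonneg (Real.log_nonneg (by linarith)) _
  rw [Htwo_eq_integral p hR.continuous hβ.continuous hβ0 hl.symm hl1 hA hM hB hRA, ← hl2]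
  refine (norm_setIntegral_le_of_norm_le_const (C := max C 1 * (l ^ 2)⁻¹) (by simp)
    fun x _ => ?_).trans ?_
  · have h1 := norm_oscillatory_integral_le n hl1 hA (hd x)
      (by fun_prop) (fun y => (hβ.differentiable (by simp) y).hasDerivAt)
      (hβ.continuous_deriv (by simp)) (fun y => hM (x, y)) (hM' x) hB hD (hRA x A le_rfl)
      (hβ0 1 (by simp))
    rw [hlt] at h1
    have h2 : Complex.I * (t : ℂ) * ((Real.exp (-1 / x ^ p) : ℝ) : ℂ) =
        ((t * Real.exp (-1 / x ^ p) : ℝ) : ℂ) * Complex.I := by push_cast; ring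
    rw [norm_mul, h2, Complex.norm_exp_ofReal_mul_I, one_mul]
    exact h1.trans (mul_le_mul_of_nonneg_right (le_max_left _ _) (by positivity))
  · rw [measureReal_def, Real.volume_Ioo, sub_zero, ENNReal.toReal_ofReal hlog]
end

section
/- Let p > 0 be a real number, let q ≥ 2 be an integer, and let R : ℝ² → ℝ be a smooth compactly supported function. Then the convergence lim_{t→∞} (log t)^{1/p} · L⁽¹⁾(t; R(·, u₂ t^{−1/q})) = R(0,0) holds uniformly with respect to u₂ ∈ [0,2]; that is, for every ε > 0 there exists t₀ > 1 such that |(log t)^{1/p} · L⁽¹⁾(t; R(·, u₂ t^{−1/q})) − R(0,0)| < ε for all t ≥ t₀ and all u₂ ∈ [0,2]. -/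
open MeasureTheory Filter

/-- The integral `Lone` rescaled to the unit interval. -/
theorem rpow_log_mul_Lone {p t : ℝ} (hp : 0 < p) (ht : 1 < t) (ψ : ℝ → ℝ) :
    (((Real.log t) ^ (1 / p) : ℝ) : ℂ) * Lone p t ψ =
      ∫ y in Set.Ioo (0 : ℝ) 1,
        Complex.exp (Complex.I * ((t ^ (1 - (y ^ p)⁻¹) : ℝ) : ℂ)) *
          ((ψ (Real.log t ^ (-(1 / p)) * y) : ℝ) : ℂ) := by
  have hlog : 0 < Real.log t := Real.log_pos ht
  have ht0 : 0 < t := one_pos.trans ht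
  have hc : 0 < Real.log t ^ (-(1 / p)) := Real.rpow_pos_of_pos hlog _
  have hcL : (Real.log t) ^ (1 / p) * Real.log t ^ (-(1 / p)) = 1 := by
    rw [← Real.rpow_add hlog]; simp
  have hcp : (Real.log t ^ (-(1 / p))) ^ p = (Real.log t)⁻¹ := by
    rw [← Real.rpow_mul hlog.le, ← Real.rpow_neg_one]
    congr 1
    field_simp
  unfold Lone
  generalize Real.log t ^ (-(1 / p)) = c at *
  rw [← integral_Ioc_eq_integral_Ioo, ← intervalIntegral.integral_of_le hc.le]
  have h := intervalIntegral.smul_integral_comp_mul_left (a := 0) (b := 1)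
    (fun x : ℝ => Complex.exp (Complex.I * (t : ℂ) * ((Real.exp (-1 / x ^ p) : ℝ) : ℂ)) *
      ((ψ x : ℝ) : ℂ)) c
  rw [mul_zero, mul_one] at h
  rw [← h, Complex.real_smul, ← mul_assoc, ← Complex.ofReal_mul, hcL, Complex.ofReal_one, one_mul,
    intervalIntegral.integral_of_le zero_le_one, integral_Ioc_eq_integral_Ioo]
  refine setIntegral_congr_fun measurableSet_Ioo fun y hy => ?_
  have hphase : t * Real.exp (-1 / (c * y) ^ p) = t ^ (1 - (y ^ p)⁻¹) := by
    have hyp : 0 < y ^ p := Real.rpow_pos_of_pos hy.1 p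
    rw [Real.mul_rpow hc.le hy.1.le, hcp, Real.rpow_sub ht0, Real.rpow_one, div_eq_mul_inv t,
      ← Real.rpow_neg ht0.le, Real.rpow_def_of_pos ht0]
    congr 2
    field_simp
  simp only [← hphase, Complex.ofReal_mul, mul_assoc]

theorem tendsto_rpow_one_sub_inv_rpow {p y : ℝ} (hp : 0 < p) (hy : y ∈ Set.Ioo (0 : ℝ) 1) :
    Tendsto (fun t : ℝ => t ^ (1 - (y ^ p)⁻¹)) atTop (nhds 0) := by
  have h : 1 < (y ^ p)⁻¹ :=
    (one_lt_inv₀ (Real.rpow_pos_of_pos hy.1 p)).2 (Real.rpow_lt_one hy.1.le hy.2 hp)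
  simpa using tendsto_rpow_neg_atTop (sub_pos.2 h)

theorem tendsto_mul_rpow_neg_prod_principal {a : ℝ} (ha : 0 < a) :
    Tendsto (fun z : ℝ × ℝ => z.2 * z.1 ^ (-a)) (atTop ×ˢ 𝓟 (Set.Icc 0 2)) (nhds 0) := by
  refine Tendsto.zero_mul_isBoundedUnder_le ?_ ?_ |>.congr fun z => mul_comm (z.1 ^ (-a)) z.2
  · exact (tendsto_rpow_neg_atTop ha).comp tendsto_fst
  · refine isBoundedUnder_of_eventually_le (a := 2) ?_
    filter_upwards [tendsto_snd.eventually (mem_principal_self (Set.Icc (0 : ℝ) 2))] with z hz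
    exact abs_le.2 ⟨by linarith [hz.1], hz.2⟩

theorem tendsto_rpow_log_mul_Lone {p a : ℝ} (hp : 0 < p) (ha : 0 < a)
    {R : ℝ × ℝ → ℝ} (hR : Continuous R) (hRc : HasCompactSupport R) :
    Tendsto (fun z : ℝ × ℝ => (((Real.log z.1) ^ (1 / p) : ℝ) : ℂ) *
        Lone p z.1 (fun x => R (x, z.2 * z.1 ^ (-a))))
      (atTop ×ˢ 𝓟 (Set.Icc 0 2)) (nhds ((R (0, 0) : ℝ) : ℂ)) := by
  obtain ⟨M, hM⟩ := hRc.exists_bound_of_continuous hR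
  have hlim : Tendsto (fun z : ℝ × ℝ => ∫ y in Set.Ioo (0 : ℝ) 1,
      Complex.exp (Complex.I * ((z.1 ^ (1 - (y ^ p)⁻¹) : ℝ) : ℂ)) *
        ((R (Real.log z.1 ^ (-(1 / p)) * y, z.2 * z.1 ^ (-a)) : ℝ) : ℂ))
      (atTop ×ˢ 𝓟 (Set.Icc 0 2))
      (nhds (∫ _ in Set.Ioo (0 : ℝ) 1, ((R (0, 0) : ℝ) : ℂ))) := by
    refine tendsto_integral_filter_of_dominated_convergence (fun _ => M) ?_ ?_ ?_ ?_
    · refine Eventually.of_forall fun z => Measurable.aestronglyMeasurable ?_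
      have hRm := hR.measurable
      fun_prop
    · refine Eventually.of_forall fun z => Eventually.of_forall fun y => ?_
      rw [norm_mul, Complex.norm_exp_I_mul_ofReal, one_mul, Complex.norm_real]
      exact hM _
    · exact integrable_const M
    · filter_upwards [ae_restrict_mem measurableSet_Ioo] with y hy
      have hphase : Tendsto (fun z : ℝ × ℝ => z.1 ^ (1 - (y ^ p)⁻¹))
          (atTop ×ˢ 𝓟 (Set.Icc (0 : ℝ) 2)) (nhds 0) :=
        (tendsto_rpow_one_sub_inv_rpow hp hy).comp tendsto_fst
      have hexp : Tendsto (fun z : ℝ × ℝ =>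
          Complex.exp (Complex.I * ((z.1 ^ (1 - (y ^ p)⁻¹) : ℝ) : ℂ)))
          (atTop ×ˢ 𝓟 (Set.Icc (0 : ℝ) 2)) (nhds 1) := by
        have hcont : Continuous fun x : ℝ => Complex.exp (Complex.I * (x : ℂ)) := by fun_prop
        simpa [Function.comp_def] using (hcont.tendsto 0).comp hphase
      have hfst : Tendsto (fun z : ℝ × ℝ => Real.log z.1 ^ (-(1 / p)) * y)
          (atTop ×ˢ 𝓟 (Set.Icc (0 : ℝ) 2)) (nhds 0) := by
        simpa using (((tendsto_rpow_neg_atTop (one_div_pos.2 hp)).comp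
          Real.tendsto_log_atTop).comp tendsto_fst).mul_const y
      have hval := (hR.tendsto (0, 0)).comp
        (hfst.prodMk_nhds (tendsto_mul_rpow_neg_prod_principal ha))
      simpa using hexp.mul ((Complex.continuous_ofReal.tendsto _).comp hval)
  have hconst : ∫ _ in Set.Ioo (0 : ℝ) 1, ((R (0, 0) : ℝ) : ℂ) = ((R (0, 0) : ℝ) : ℂ) := by simp
  rw [hconst] at hlim
  refine hlim.congr' ?_
  filter_upwards [tendsto_fst.eventually (eventually_gt_atTop (1 : ℝ))] with z hz
  exact (rpow_log_mul_Lone hp hz fun x => R (x, z.2 * z.1 ^ (-a))).symm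

theorem stmt15 (p : ℝ) (hp : 0 < p) (q : ℕ) (hq : 2 ≤ q)
    (R : ℝ × ℝ → ℝ) (hR : ContDiff ℝ (⊤ : ℕ∞) R) (hRc : HasCompactSupport R) :
    ∀ ε > (0 : ℝ), ∃ t₀ > (1 : ℝ), ∀ t ≥ t₀, ∀ u₂ ∈ Set.Icc (0 : ℝ) 2,
      ‖(((Real.log t) ^ (1 / p) : ℝ) : ℂ) *
          Lone p t (fun x₁ => R (x₁, u₂ * t ^ (-(1 / (q : ℝ))))) -
        ((R (0, 0) : ℝ) : ℂ)‖ < ε := by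
  intro ε hε
  have hq0 : (0 : ℝ) < 1 / q := one_div_pos.2 (by exact_mod_cast (by omega : 0 < q))
  have h := (tendsto_rpow_log_mul_Lone hp hq0 hR.continuous hRc).eventually
    (Metric.ball_mem_nhds _ hε)
  rw [eventually_prod_principal_iff] at h
  obtain ⟨t₀, ht₀⟩ := eventually_atTop.1 h
  refine ⟨max t₀ 2, lt_max_of_lt_right one_lt_two, fun t ht u hu => ?_⟩
  simpa [dist_eq_norm] using ht₀ t (le_of_max_le_left ht) u hu
end

section
/- Let p > 0 be a real number and let φ : ℝ² → ℝ be a smooth compactly supported function. Then there exist constants C > 0 and t₀ > 1, independent of t and x₂, such that |L⁽²⁾(t; φ(·,x₂))| ≤ C (log t)^{−(1/p+1)} for all t ≥ t₀ and all x₂ > 0. -/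
open MeasureTheory Filter

/-- `L⁽²⁾(t;ψ) = ∫_{(log t)^{-1/p}}^∞ e^{i t exp(-1/x^p)} ψ(x) dx`. -/
noncomputable def Ltwo (p t : ℝ) (ψ : ℝ → ℝ) : ℂ :=
  ∫ x in Set.Ioi ((Real.log t) ^ (-(1 / p))),
    Complex.exp (Complex.I * (t : ℂ) * ((Real.exp (-1 / x ^ p) : ℝ) : ℂ)) * ((ψ x : ℝ) : ℂ)

/-- A first-derivative oscillatory integral bound: `g` is the reciprocal of the derivative of the
phase `Φ`, and it is decreasing up to an error of size `k`. -/
theorem norm_oscillatory_integral_le_s16 {a b M M' k : ℝ} (hab : a ≤ b) {Φ Φ' g g' ψ ψ' : ℝ → ℝ}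
    (hΦ : ∀ x ∈ Set.Icc a b, HasDerivAt Φ (Φ' x) x)
    (hg : ∀ x ∈ Set.Icc a b, HasDerivAt g (g' x) x)
    (hψ : ∀ x ∈ Set.Icc a b, HasDerivAt ψ (ψ' x) x)
    (hg'c : ContinuousOn g' (Set.Icc a b)) (hψ'c : ContinuousOn ψ' (Set.Icc a b))
    (hΦg : ∀ x ∈ Set.Icc a b, Φ' x * g x = 1)
    (hg0 : ∀ x ∈ Set.Icc a b, 0 ≤ g x)
    (hg' : ∀ x ∈ Set.Icc a b, |g' x| ≤ -g' x + k)
    (hM : ∀ x ∈ Set.Icc a b, |ψ x| ≤ M) (hM' : ∀ x ∈ Set.Icc a b, |ψ' x| ≤ M')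
    (hψb : ψ b = 0) :
    ‖∫ x in a..b, Complex.exp (Complex.I * (Φ x : ℂ)) * (ψ x : ℂ)‖ ≤
      M * g a + (M' * (b - a) + M) * (g a + k * (b - a)) := by
  have ha : a ∈ Set.Icc a b := Set.left_mem_Icc.2 hab
  have hb : b ∈ Set.Icc a b := Set.right_mem_Icc.2 hab
  have hM0 : 0 ≤ M := (abs_nonneg _).trans (hM a ha)
  have hM'0 : 0 ≤ M' := (abs_nonneg _).trans (hM' a ha)
  have hu : Set.uIcc a b = Set.Icc a b := Set.uIcc_of_le hab
  have hk : ∀ x ∈ Set.Icc a b, g' x ≤ k := fun x hx => by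
    have h := hg' x hx
    have h1 := abs_nonneg (g' x)
    linarith
  have hΦc : ContinuousOn Φ (Set.Icc a b) := fun x hx => (hΦ x hx).continuousAt.continuousWithinAt
  have hgc : ContinuousOn g (Set.Icc a b) := fun x hx => (hg x hx).continuousAt.continuousWithinAt
  have hψc : ContinuousOn ψ (Set.Icc a b) := fun x hx => (hψ x hx).continuousAt.continuousWithinAt
  have hgint : IntervalIntegrable g' volume a b := by
    apply ContinuousOn.intervalIntegrable; rwa [hu]
  have hgle : ∀ x ∈ Set.Icc a b, g x ≤ g a + k * (b - a) := by
    intro x hx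
    have hk0 : 0 ≤ k := by
      have h := hg' a ha
      have h1 := neg_le_abs (g' a)
      linarith
    have h := (convex_Icc a b).image_sub_le_mul_sub_of_deriv_le hgc
      (fun y hy => (hg y (interior_subset hy)).differentiableAt.differentiableWithinAt)
      (C := k) (fun y hy => by
        rw [(hg y (interior_subset hy)).deriv]; exact hk y (interior_subset hy)) a ha x hx hx.1
    have : k * (x - a) ≤ k * (b - a) := by gcongr; exact hx.2
    linarith
  set E : ℝ → ℂ := fun x => Complex.exp (Complex.I * (Φ x : ℂ)) with hE
  have hEn : ∀ x, ‖E x‖ = 1 := fun x => by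
    simp only [hE]; rw [mul_comm]; exact Complex.norm_exp_ofReal_mul_I _
  have hEc : ContinuousOn E (Set.Icc a b) := by
    have h : ContinuousOn (fun x => (Φ x : ℂ)) (Set.Icc a b) :=
      Complex.continuous_ofReal.comp_continuousOn hΦc
    exact Complex.continuous_exp.comp_continuousOn (continuousOn_const.mul h)
  have hc : ∀ {f : ℝ → ℝ}, ContinuousOn f (Set.Icc a b) →
      ContinuousOn (fun x => (f x : ℂ)) (Set.Icc a b) :=
    fun h => Complex.continuous_ofReal.comp_continuousOn h
  have hi1 : IntervalIntegrable (fun x => E x * (ψ x : ℂ)) volume a b := by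
    apply ContinuousOn.intervalIntegrable; rw [hu]; exact hEc.mul (hc hψc)
  have hi2 : IntervalIntegrable (fun x => E x * ((ψ' x * g x + ψ x * g' x : ℝ) : ℂ)) volume a b := by
    apply ContinuousOn.intervalIntegrable; rw [hu]
    exact hEc.mul (hc ((hψ'c.mul hgc).add (hψc.mul hg'c)))
  have hparts : ∫ x in a..b, (Complex.I * (E x * (ψ x : ℂ)) +
      E x * ((ψ' x * g x + ψ x * g' x : ℝ) : ℂ)) =
      E b * ((ψ b * g b : ℝ) : ℂ) - E a * ((ψ a * g a : ℝ) : ℂ) := by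
    apply intervalIntegral.integral_eq_sub_of_hasDerivAt (f := fun x => E x * ((ψ x * g x : ℝ) : ℂ))
    · intro x hx
      rw [hu] at hx
      have h1 : HasDerivAt E (E x * (Complex.I * (Φ' x : ℂ))) x :=
        ((hΦ x hx).ofReal_comp.const_mul Complex.I).cexp
      have h2 := ((hψ x hx).mul (hg x hx)).ofReal_comp
      refine (h1.mul h2).congr_deriv ?_
      have h3 : (Φ' x : ℂ) * (g x : ℂ) = 1 := by exact_mod_cast hΦg x hx
      push_cast [Pi.mul_apply]
      linear_combination ((Complex.I * E x * (ψ x : ℂ))) * h3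
    · exact (hi1.const_mul _).add hi2
  rw [intervalIntegral.integral_add (hi1.const_mul _) hi2, intervalIntegral.integral_const_mul,
    hψb] at hparts
  have hmain : Complex.I * (∫ x in a..b, E x * (ψ x : ℂ)) = -(E a * ((ψ a * g a : ℝ) : ℂ)) -
      ∫ x in a..b, E x * ((ψ' x * g x + ψ x * g' x : ℝ) : ℂ) := by
    simp only [zero_mul, Complex.ofReal_zero, mul_zero, zero_sub] at hparts
    exact eq_sub_of_add_eq hparts
  have hrem : ‖∫ x in a..b, E x * ((ψ' x * g x + ψ x * g' x : ℝ) : ℂ)‖ ≤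
      ∫ x in a..b, (M' * (g a + k * (b - a)) + M * k - M * g' x) := by
    apply intervalIntegral.norm_integral_le_of_norm_le hab
    · refine Filter.Eventually.of_forall fun x hx => ?_
      have hx := Set.Ioc_subset_Icc_self hx
      rw [norm_mul, hEn, one_mul, Complex.norm_real, Real.norm_eq_abs]
      calc |ψ' x * g x + ψ x * g' x| ≤ |ψ' x| * |g x| + |ψ x| * |g' x| := by
            rw [← abs_mul, ← abs_mul]; exact abs_add_le _ _
        _ ≤ M' * (g a + k * (b - a)) + M * (-g' x + k) := by
            rw [abs_of_nonneg (hg0 x hx)]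
            gcongr
            · exact hg0 x hx
            · exact hM' x hx
            · exact hgle x hx
            · exact hM x hx
            · exact hg' x hx
        _ = _ := by ring
    · exact intervalIntegrable_const.sub (hgint.const_mul _)
  rw [intervalIntegral.integral_sub intervalIntegrable_const (hgint.const_mul _),
    intervalIntegral.integral_const, intervalIntegral.integral_const_mul,
    intervalIntegral.integral_eq_sub_of_hasDerivAt (f := g) (fun x hx => hg x (hu ▸ hx)) hgint,
    smul_eq_mul] at hrem
  have hnorm : ‖∫ x in a..b, E x * (ψ x : ℂ)‖ = ‖Complex.I * ∫ x in a..b, E x * (ψ x : ℂ)‖ := by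
    rw [norm_mul, Complex.norm_I, one_mul]
  rw [hnorm, hmain]
  have hEa : ‖-(E a * ((ψ a * g a : ℝ) : ℂ))‖ ≤ M * g a := by
    rw [norm_neg, norm_mul, hEn, one_mul, Complex.norm_real, Real.norm_eq_abs, abs_mul,
      abs_of_nonneg (hg0 a ha)]
    exact mul_le_mul_of_nonneg_right (hM a ha) (hg0 a ha)
  have hMb : 0 ≤ M * g b := mul_nonneg hM0 (hg0 b hb)
  refine (norm_sub_le _ _).trans ((add_le_add hEa hrem).trans ?_)
  linarith

theorem hasDerivAt_rpow_neg {p x : ℝ} (hx : 0 < x) :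
    HasDerivAt (fun y : ℝ => y ^ (-p)) (-(p * x ^ (-(p + 1)))) x := by
  have h := Real.hasDerivAt_rpow_const (x := x) (p := -p) (Or.inl hx.ne')
  refine h.congr_deriv ?_
  rw [show -p - 1 = -(p + 1) by ring]; ring

theorem hasDerivAt_rpow_mul_exp_rpow_neg {p x : ℝ} (hx : 0 < x) :
    HasDerivAt (fun y : ℝ => y ^ (p + 1) * Real.exp (y ^ (-p)))
      (Real.exp (x ^ (-p)) * ((p + 1) * x ^ p - p)) x := by
  have h := (Real.hasDerivAt_rpow_const (x := x) (p := p + 1) (Or.inl hx.ne')).mul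
    (hasDerivAt_rpow_neg (p := p) hx).exp
  refine h.congr_deriv ?_
  have h1 : x ^ (p + 1) * x ^ (-(p + 1)) = 1 := by
    rw [← Real.rpow_add hx]; simp
  rw [add_sub_cancel_right]
  linear_combination (-(p * Real.exp (x ^ (-p)))) * h1

theorem abs_deriv_rpow_mul_exp_rpow_neg_le {p x R : ℝ} (hp : 0 < p) (hx : 0 < x) (hxR : x ≤ R) :
    |Real.exp (x ^ (-p)) * ((p + 1) * x ^ p - p)| ≤
      -(Real.exp (x ^ (-p)) * ((p + 1) * x ^ p - p)) +
        2 * (Real.exp ((p + 1) / p) * ((p + 1) * R ^ p)) := by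
  have hxp : 0 < x ^ p := Real.rpow_pos_of_pos hx p
  have hR : x ^ p ≤ R ^ p := Real.rpow_le_rpow hx.le hxR hp.le
  rcases le_total ((p + 1) * x ^ p - p) 0 with h | h
  · rw [abs_of_nonpos (mul_nonpos_of_nonneg_of_nonpos (Real.exp_pos _).le h)]
    have : 0 ≤ R ^ p := hxp.le.trans hR
    have : 0 ≤ Real.exp ((p + 1) / p) * ((p + 1) * R ^ p) := by positivity
    linarith
  · rw [abs_of_nonneg (mul_nonneg (Real.exp_pos _).le h)]
    have h1 : x ^ (-p) ≤ (p + 1) / p := by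
      rw [Real.rpow_neg hx.le, inv_eq_one_div, div_le_div_iff₀ hxp hp]; linarith
    have h2 : Real.exp (x ^ (-p)) * ((p + 1) * x ^ p - p) ≤
        Real.exp ((p + 1) / p) * ((p + 1) * R ^ p) := by
      gcongr
      have : (p + 1) * x ^ p ≤ (p + 1) * R ^ p := by gcongr
      linarith
    linarith

/-- A uniform bound for `L⁽²⁾` over all amplitudes supported to the left of `R`. -/
theorem norm_Ltwo_le {p t R M M' : ℝ} (hp : 0 < p) (ht : 1 < t) {ψ ψ' : ℝ → ℝ}
    (haR : Real.log t ^ (-(1 / p)) ≤ R)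
    (hψ : ∀ x, HasDerivAt ψ (ψ' x) x) (hψ'c : Continuous ψ')
    (hM : ∀ x, |ψ x| ≤ M) (hM' : ∀ x, |ψ' x| ≤ M') (hsupp : ∀ x, R ≤ x → ψ x = 0) :
    ‖Ltwo p t ψ‖ ≤ M * (Real.log t ^ (-(1 / p + 1)) / p) + (M' * R + M) *
      (Real.log t ^ (-(1 / p + 1)) / p +
        2 * (Real.exp ((p + 1) / p) * ((p + 1) * R ^ p)) / (p * t) * R) := by
  have ht0 : 0 < t := one_pos.trans ht
  have hpt : 0 < p * t := mul_pos hp ht0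
  have hlog : 0 < Real.log t := Real.log_pos ht
  set a := Real.log t ^ (-(1 / p)) with ha_def
  have ha : 0 < a := Real.rpow_pos_of_pos hlog _
  have hM0 : 0 ≤ M := (abs_nonneg _).trans (hM 0)
  have hM'0 : 0 ≤ M' := (abs_nonneg _).trans (hM' 0)
  have hap : a ^ (-p) = Real.log t := by
    rw [ha_def, ← Real.rpow_mul hlog.le, show -(1 / p) * -p = 1 by field_simp, Real.rpow_one]
  have hap1 : a ^ (p + 1) = Real.log t ^ (-(1 / p + 1)) := by
    rw [ha_def, ← Real.rpow_mul hlog.le]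
    congr 1
    field_simp
    ring
  have hpos : ∀ x ∈ Set.Icc a R, 0 < x := fun x hx => ha.trans_le hx.1
  have hL : Ltwo p t ψ = ∫ x in a..R,
      Complex.exp (Complex.I * ((t * Real.exp (-x ^ (-p)) : ℝ) : ℂ)) * (ψ x : ℂ) := by
    rw [intervalIntegral.integral_of_le haR, Ltwo, ← ha_def,
      setIntegral_eq_of_subset_of_forall_sdiff_eq_zero measurableSet_Ioi
        (show Set.Ioc a R ⊆ Set.Ioi a from Set.Ioc_subset_Ioi_self)]
    · refine setIntegral_congr_fun measurableSet_Ioc fun x hx => ?_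
      have hx0 : 0 < x := ha.trans hx.1
      rw [Real.rpow_neg hx0.le, neg_div, one_div]
      push_cast
      rw [mul_assoc]
    · intro x hx
      have : R ≤ x := by
        by_contra! h
        exact hx.2 ⟨hx.1, h.le⟩
      simp [hsupp x this]
  have key := norm_oscillatory_integral_le_s16 haR
    (Φ := fun x => t * Real.exp (-x ^ (-p)))
    (Φ' := fun x => t * (Real.exp (-x ^ (-p)) * (p * x ^ (-(p + 1)))))
    (g := fun x => x ^ (p + 1) * Real.exp (x ^ (-p)) / (p * t))
    (g' := fun x => Real.exp (x ^ (-p)) * ((p + 1) * x ^ p - p) / (p * t))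
    (ψ := ψ) (ψ' := ψ') (M := M) (M' := M')
    (k := 2 * (Real.exp ((p + 1) / p) * ((p + 1) * R ^ p)) / (p * t))
    (fun x hx => by
      simpa using ((hasDerivAt_rpow_neg (p := p) (hpos x hx)).neg.exp.const_mul t))
    (fun x hx => (hasDerivAt_rpow_mul_exp_rpow_neg (hpos x hx)).div_const _)
    (fun x _ => hψ x)
    (by
      have h1 : ∀ q : ℝ, ContinuousOn (fun x : ℝ => x ^ q) (Set.Icc a R) := fun q =>
        continuousOn_id.rpow_const fun x hx => Or.inl (hpos x hx).ne'
      exact ((Real.continuous_exp.comp_continuousOn (h1 _)).mul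
        ((continuousOn_const.mul (h1 _)).sub continuousOn_const)).div_const _)
    hψ'c.continuousOn
    (fun x hx => by
      have h1 : x ^ (-(p + 1)) * x ^ (p + 1) = 1 := by
        rw [← Real.rpow_add (hpos x hx)]; simp
      have h2 : Real.exp (-x ^ (-p)) * Real.exp (x ^ (-p)) = 1 := by
        rw [← Real.exp_add]; simp
      rw [mul_div_assoc', div_eq_one_iff_eq hpt.ne']
      linear_combination (p * t) * (x ^ (-(p + 1)) * x ^ (p + 1) * h2 + h1))
    (fun x hx => by
      have := hpos x hx
      positivity)
    (fun x hx => by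
      rw [abs_div, abs_of_pos hpt, ← neg_div, ← add_div]
      exact div_le_div_of_nonneg_right
        (abs_deriv_rpow_mul_exp_rpow_neg_le hp (hpos x hx) hx.2) hpt.le)
    (fun x _ => hM x) (fun x _ => hM' x) (hsupp R le_rfl)
  have hga : a ^ (p + 1) * Real.exp (a ^ (-p)) / (p * t) = Real.log t ^ (-(1 / p + 1)) / p := by
    rw [hap, hap1, Real.exp_log ht0]
    field_simp
  have hR0 : 0 < R := ha.trans_le haR
  have hRa : R - a ≤ R := by linarith
  rw [hL]
  refine key.trans ?_
  rw [hga]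
  gcongr

theorem stmt16 (p : ℝ) (hp : 0 < p)
    (φ : ℝ × ℝ → ℝ) (hφ : ContDiff ℝ (⊤ : ℕ∞) φ) (hφc : HasCompactSupport φ) :
    ∃ C > (0 : ℝ), ∃ t₀ > (1 : ℝ), ∀ t ≥ t₀, ∀ x₂ > (0 : ℝ),
      ‖Ltwo p t (fun x₁ => φ (x₁, x₂))‖ ≤ C * (Real.log t) ^ (-(1 / p + 1)) := by
  have hdiff : Differentiable ℝ φ := hφ.differentiable (by simp)
  have hfd : Continuous (fderiv ℝ φ) := hφ.continuous_fderiv (by simp)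
  obtain ⟨M, hM⟩ := hφc.exists_bound_of_continuous hφ.continuous
  obtain ⟨M', hM'⟩ := (hφc.fderiv (𝕜 := ℝ)).exists_bound_of_continuous hfd
  obtain ⟨R, hR1, hR⟩ : ∃ R : ℝ, 1 ≤ R ∧ ∀ x : ℝ × ℝ, R ≤ x.1 → φ x = 0 := by
    obtain ⟨r, hr⟩ := hφc.isCompact.isBounded.subset_closedBall 0
    refine ⟨max 1 (r + 1), le_max_left _ _, fun x hx => ?_⟩
    by_contra h
    have h1 := hr (subset_tsupport φ h)
    rw [mem_closedBall_zero_iff] at h1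
    have h2 := (le_abs_self x.1).trans ((norm_fst_le x).trans h1)
    have h3 := (le_max_right 1 (r + 1)).trans hx
    linarith
  have hM0 : 0 ≤ M := (norm_nonneg _).trans (hM 0)
  have hM'0 : 0 ≤ M' := (norm_nonneg _).trans (hM' 0)
  obtain ⟨T, hT⟩ : ∃ T, ∀ t ≥ T, Real.log t ^ (1 / p + 1) ≤ t := by
    have h := (isLittleO_log_rpow_rpow_atTop (1 / p + 1) one_pos).bound one_pos
    obtain ⟨T, hT⟩ := eventually_atTop.1 h
    refine ⟨max T 0, fun t ht => ?_⟩
    have h1 := hT t ((le_max_left _ _).trans ht)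
    have h2 : 0 ≤ t := (le_max_right _ _).trans ht
    rw [Real.rpow_one, one_mul, Real.norm_of_nonneg h2] at h1
    exact (le_abs_self _).trans h1
  set K := 2 * (Real.exp ((p + 1) / p) * ((p + 1) * R ^ p)) with hK
  have hK0 : 0 ≤ K := by positivity
  refine ⟨M / p + (M' * R + M) * (1 / p + K / p * R) + 1, by positivity,
    max T (Real.exp 1), lt_max_of_lt_right (Real.one_lt_exp_iff.2 one_pos), ?_⟩
  intro t ht x₂ _
  have hte : Real.exp 1 ≤ t := (le_max_right _ _).trans ht
  have ht1 : 1 < t := (Real.one_lt_exp_iff.2 one_pos).trans_le hte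
  have ht0 : 0 < t := one_pos.trans ht1
  have hlog1 : 1 ≤ Real.log t := (Real.le_log_iff_exp_le ht0).2 hte
  have haR : Real.log t ^ (-(1 / p)) ≤ R :=
    (Real.rpow_le_one_of_one_le_of_nonpos hlog1 (by simp [hp.le])).trans hR1
  have hcurve : ∀ x : ℝ, HasDerivAt (fun y : ℝ => (y, x₂)) ((1 : ℝ), (0 : ℝ)) x := fun x =>
    (hasDerivAt_id x).prodMk (hasDerivAt_const x x₂)
  have hbound := norm_Ltwo_le (M := M) (M' := M') hp ht1 haR
    (ψ := fun x => φ (x, x₂)) (ψ' := fun x => fderiv ℝ φ (x, x₂) (1, 0))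
    (fun x => (hdiff (x, x₂)).hasFDerivAt.comp_hasDerivAt x (hcurve x))
    ((hfd.comp (by fun_prop : Continuous fun x : ℝ => (x, x₂))).clm_apply continuous_const)
    (fun x => hM _)
    (fun x => by
      have h := (fderiv ℝ φ (x, x₂)).le_of_opNorm_le (hM' (x, x₂)) ((1 : ℝ), (0 : ℝ))
      simpa [Prod.norm_def] using h)
    (fun x hx => hR _ hx)
  set D := Real.log t ^ (-(1 / p + 1)) with hD
  have hD0 : 0 < D := Real.rpow_pos_of_pos (by linarith) _
  have htD : 1 / t ≤ D := by
    rw [hD, Real.rpow_neg (by linarith), ← one_div]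
    exact one_div_le_one_div_of_le (Real.rpow_pos_of_pos (by linarith) _)
      (hT t ((le_max_left _ _).trans ht))
  have hKt : K / (p * t) ≤ K / p * D := by
    rw [show K / (p * t) = K / p * (1 / t) by field_simp]
    gcongr
  calc _ ≤ _ := hbound
    _ ≤ M * (D / p) + (M' * R + M) * (D / p + K / p * D * R) := by gcongr
    _ = (M / p + (M' * R + M) * (1 / p + K / p * R)) * D := by ring
    _ ≤ _ := mul_le_mul_of_nonneg_right (by linarith) hD0.le
end
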